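/- If κ is a weakly super Ramsey cardinal, then κ has the maximum Ramsey M-rank o_Ram(κ) = κ⁺. -/

import Mathlib

noncomputable section

namespace MPaper

open ZFSet

attribute [local instance] Classical.propDecidable

/-! ### Basic set-theoretic vocabulary over `ZFSet` -/

/-- The (external) cardinality of a ZFC set. -/
def zcard (x : ZFSet) : Cardinal := Cardinal.mk x.toSet

/-- `x` is a von Neumann ordinal: a transitive set of transitive sets. -/
def IsOrd (x : ZFSet) : Prop := x.IsTransitive ∧ ∀ y ∈ x, ZFSet.IsTransitive y

/-- `κ` is a cardinal: an ordinal not equinumerous with any of its members. -/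
def IsCard (κ : ZFSet) : Prop := IsOrd κ ∧ ∀ α ∈ κ, zcard α < zcard κ

/-- The ordinal `κ⁺`, the cardinal successor of `κ`. -/
def cardSuccOrd (κ : ZFSet) : Ordinal := (Order.succ (zcard κ)).ord

/-- `f` is a set-coded function with domain `d` (a set of Kuratowski pairs). -/
def IsZFunc (d f : ZFSet) : Prop :=
  (∀ p ∈ f, ∃ a ∈ d, ∃ b, p = ZFSet.pair a b) ∧ ∀ a ∈ d, ∃! b, ZFSet.pair a b ∈ f

/-- Application of a set-coded function. -/
def fapp (f a : ZFSet) : ZFSet :=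
  ⋃₀ (ZFSet.sep (fun b => ZFSet.pair a b ∈ f) (⋃₀ (⋃₀ f)))

/-- `f` maps `d` into `y`. -/
def MapsInto (f d y : ZFSet) : Prop := ∀ a ∈ d, fapp f a ∈ y

/-- `f` maps `d` onto `y`. -/
def SurjOnto (f d y : ZFSet) : Prop := MapsInto f d y ∧ ∀ b ∈ y, ∃ a ∈ d, fapp f a = b

/-- `f` is injective on `d`. -/
def InjOnZ (f d : ZFSet) : Prop := ∀ a ∈ d, ∀ b ∈ d, fapp f a = fapp f b → a = b

/-- `f` is a bijection from `d` onto `y`. -/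
def IsBij (f d y : ZFSet) : Prop := IsZFunc d f ∧ SurjOnto f d y ∧ InjOnZ f d

/-- The tail `κ ∖ α = {ξ ∈ κ | α ≤ ξ}` (for ordinals `α ∈ κ`). -/
def tailSet (κ α : ZFSet) : ZFSet := ZFSet.sep (fun ξ => ξ ∉ α) κ

/-- The relative complement `κ ∖ A`. -/
def compl (κ A : ZFSet) : ZFSet := ZFSet.sep (fun ξ => ξ ∉ A) κ

/-! ### First-order satisfaction in ∈-structures -/

/-- First order formulas in the language of set theory, with variables indexed by `ℕ`. -/
inductive Fml : Type
  | mem : ℕ → ℕ → Fml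
  | eq : ℕ → ℕ → Fml
  | impl : Fml → Fml → Fml
  | neg : Fml → Fml
  | all : ℕ → Fml → Fml

/-- Tarskian satisfaction of a formula in the ∈-structure with domain `D`. -/
def Sat (D : Set ZFSet) : Fml → (ℕ → ZFSet) → Prop
  | .mem i j, v => v i ∈ v j
  | .eq i j, v => v i = v j
  | .impl φ ψ, v => Sat D φ v → Sat D ψ v
  | .neg φ, v => ¬ Sat D φ v
  | .all n φ, v => ∀ x ∈ D, Sat D φ (Function.update v n x)

/-- `D` is an elementary substructure of `E` (as ∈-structures). -/
def ElemSub (D E : Set ZFSet) : Prop :=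
  D ⊆ E ∧ ∀ (φ : Fml) (v : ℕ → ZFSet), (∀ n, v n ∈ D) → (Sat D φ v ↔ Sat E φ v)

/-- `r` is a well-ordering of `x` (coded as a set of Kuratowski pairs). -/
def IsWellOrderOn (x r : ZFSet) : Prop :=
  (∀ p ∈ r, ∃ a ∈ x, ∃ b ∈ x, p = ZFSet.pair a b) ∧
  (∀ a ∈ x, ∀ b ∈ x, a = b ∨ ZFSet.pair a b ∈ r ∨ ZFSet.pair b a ∈ r) ∧
  (∀ a ∈ x, ∀ b ∈ x, ∀ c ∈ x,
    ZFSet.pair a b ∈ r → ZFSet.pair b c ∈ r → ZFSet.pair a c ∈ r) ∧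
  (∀ a ∈ x, ZFSet.pair a a ∉ r) ∧
  (∀ S : Set ZFSet, S ⊆ x.toSet → S.Nonempty → ∃ a ∈ S, ∀ b ∈ S, ZFSet.pair b a ∉ r)

/-- A transitive model of `ZFC⁻` (ZFC minus power set): a transitive set closed under
pairing and union, containing `ω`, satisfying the separation and collection schemes for
first-order formulas, and choice in the guise of the well-ordering principle.
(Extensionality and foundation hold automatically in transitive sets.) -/
def IsTransModel (M : ZFSet) : Prop :=
  M.IsTransitive ∧
  ZFSet.omega ∈ M ∧
  (∀ x ∈ M, ∀ y ∈ M, ({x, y} : ZFSet) ∈ M) ∧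
  (∀ x ∈ M, (⋃₀ x : ZFSet) ∈ M) ∧
  (∀ (φ : Fml) (v : ℕ → ZFSet), (∀ n, v n ∈ M) → ∀ a ∈ M,
    ∃ b ∈ M, ∀ x, x ∈ b ↔ x ∈ a ∧ Sat M.toSet φ (Function.update v 0 x)) ∧
  (∀ (φ : Fml) (v : ℕ → ZFSet), (∀ n, v n ∈ M) → ∀ a ∈ M,
    (∀ x ∈ a, ∃ y ∈ M, Sat M.toSet φ (Function.update (Function.update v 0 x) 1 y)) →
    ∃ b ∈ M, ∀ x ∈ a, ∃ y ∈ b, Sat M.toSet φ (Function.update (Function.update v 0 x) 1 y)) ∧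
  (∀ x ∈ M, ∃ r ∈ M, IsWellOrderOn x r)

/-! ### Weak κ-models, κ-models, M-ultrafilters -/

/-- A weak `κ`-model: a transitive model of ZFC⁻ of size `κ` with `κ ∈ M`. -/
def IsWeakModel (κ M : ZFSet) : Prop :=
  IsTransModel M ∧ κ ∈ M ∧ zcard M = zcard κ

/-- `M` is closed under `<κ`-sequences (of its elements). -/
def SeqClosed (κ M : ZFSet) : Prop :=
  ∀ γ ∈ κ, ∀ f : ZFSet, IsZFunc γ f → (∀ a ∈ γ, fapp f a ∈ M) → f ∈ M

/-- A `κ`-model: a weak `κ`-model closed under `<κ`-sequences. -/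
def IsKappaModel (κ M : ZFSet) : Prop := IsWeakModel κ M ∧ SeqClosed κ M

/-- `U` is an `M`-ultrafilter on `κ`: `⟨M, ∈, U⟩` thinks `U` is a normal ultrafilter on `κ`
containing all tail sets. -/
def IsMUltrafilter (κ M U : ZFSet) : Prop :=
  (∀ A ∈ U, A ∈ M ∧ A ⊆ κ) ∧
  (∀ α ∈ κ, tailSet κ α ∈ U) ∧
  (∅ : ZFSet) ∉ U ∧
  (∀ A ∈ U, ∀ B ∈ U, A ∩ B ∈ U) ∧
  (∀ A ∈ U, ∀ B, B ∈ M → B ⊆ κ → A ⊆ B → B ∈ U) ∧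
  (∀ B, B ∈ M → B ⊆ κ → B ∈ U ∨ compl κ B ∈ U) ∧
  (∀ f ∈ M, IsZFunc κ f → ZFSet.sep (fun ξ => fapp f ξ ∈ ξ) κ ∈ U →
    ∃ γ ∈ κ, ZFSet.sep (fun ξ => fapp f ξ = γ) κ ∈ U)

/-- `U` is weakly amenable for `M`: for every `X ∈ M` of size at most `κ` in `M`,
the intersection `X ∩ U` belongs to `M`. -/
def WeaklyAmenable (κ M U : ZFSet) : Prop :=
  ∀ X ∈ M, (∃ f ∈ M.toSet, IsZFunc κ f ∧ ∀ y ∈ X, ∃ ξ ∈ κ, fapp f ξ = y) →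
    X ∩ U ∈ M

/-- `U` is `ω₁`-intersecting: every countable collection of its members has a common element. -/
def OmegaOneIntersecting (U : ZFSet) : Prop :=
  ∀ s : ℕ → ZFSet, (∀ n, s n ∈ U) → ∃ x, ∀ n, x ∈ s n

/-- `M` contains (its version of) `V_κ`, i.e. the set of all sets of rank `< κ`. -/
def HasVkappa (κ M : ZFSet) : Prop :=
  ∃ v ∈ M.toSet, ∀ x, x ∈ v ↔ ZFSet.rank x < ZFSet.rank κ

/-! ### Small universe measures and the associated models `M_U`, `N_U` -/

/-- `M` is the minimal model associated to `U` (the collection of Mostowski collapses of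
well-founded relations on `κ` coded by sets in `U` and their complements): a weak `κ`-model
with `V_κ ∈ M` for which `U` is an `M`-ultrafilter, contained in every transitive
ZFC⁻-model `M'` with `κ ∈ M'` for which `U` is an `M'`-ultrafilter. -/
def IsMUModel (κ U M : ZFSet) : Prop :=
  IsWeakModel κ M ∧ HasVkappa κ M ∧ IsMUltrafilter κ M U ∧
  ∀ M', IsTransModel M' → κ ∈ M' → IsMUltrafilter κ M' U → M ⊆ M'

/-- A small universe measure on `κ`: a set `U` of subsets of `κ` of size `κ` whose associated
minimal model `M_U` exists (is a weak `κ`-model with `V_κ ∈ M_U` and `U` an `M_U`-ultrafilter). -/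
def IsSUMeasure (κ U : ZFSet) : Prop :=
  zcard U = zcard κ ∧ (∀ A ∈ U, A ⊆ κ) ∧ ∃ M, IsMUModel κ U M

/-- The minimal model `M_U` associated to a small universe measure `U`. -/
def MU (κ U : ZFSet) : ZFSet :=
  if h : ∃ M, IsMUModel κ U M then h.choose else ∅

/-- `j : M → N` is (up to isomorphism) the ultrapower embedding of `M` by the
`M`-ultrafilter `U` on `κ`, with `N` transitive (so the ultrapower is well-founded):
`j` is elementary, every element of `N` has the form `j(f)(κ)` for `f : κ → M` in `M`,
and `U` is the `M`-ultrafilter derived from `j` with seed `κ`. -/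
def IsUltrapowerEmb (κ M U N : ZFSet) (j : ZFSet → ZFSet) : Prop :=
  N.IsTransitive ∧
  (∀ x ∈ M, j x ∈ N) ∧
  (∀ (φ : Fml) (v : ℕ → ZFSet), (∀ n, v n ∈ M) →
    (Sat M.toSet φ v ↔ Sat N.toSet φ (fun n => j (v n)))) ∧
  (∀ a ∈ N, ∃ f ∈ M.toSet, IsZFunc κ f ∧ MapsInto f κ M ∧ fapp (j f) κ = a) ∧
  (∀ A ∈ M, A ⊆ κ → (A ∈ U ↔ κ ∈ j A))

/-- The ultrapower of `M_U` by `U` is well-founded. -/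
def UltrapowerWF (κ U : ZFSet) : Prop :=
  ∃ (N : ZFSet) (j : ZFSet → ZFSet), IsUltrapowerEmb κ (MU κ U) U N j

/-- A choice of transitive collapse of the ultrapower of `M_U` by `U`, with its embedding. -/
def upData (κ U : ZFSet) : ZFSet × (ZFSet → ZFSet) :=
  if h : ∃ p : ZFSet × (ZFSet → ZFSet), IsUltrapowerEmb κ (MU κ U) U p.1 p.2
  then h.choose else (∅, id)

/-- `N_U`: the transitive collapse of the ultrapower of `M_U` by `U` (when well-founded). -/
def NU (κ U : ZFSet) : ZFSet := (upData κ U).1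

/-- The ultrapower embedding `j_U : M_U → N_U`. -/
def jU (κ U : ZFSet) : ZFSet → ZFSet := (upData κ U).2

/-- `M_U⋆ = V_{j(κ)}^{N_U}`, the rank-initial segment of `N_U` below `j_U(κ)`. -/
def MUstar (κ U : ZFSet) : ZFSet :=
  ZFSet.sep (fun x => ZFSet.rank x < ZFSet.rank (jU κ U κ)) (NU κ U)

/-! ### Hereditary size, `H_{κ⁺}`, elementarity -/

/-- `x` has hereditary size at most `κ`. -/
def HeredLE (κ : ZFSet) : ZFSet → Prop :=
  WellFounded.fix ZFSet.mem_wf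
    (fun x ih => zcard x ≤ zcard κ ∧ ∀ y, ∀ h : y ∈ x, ih y h)

/-- The class `H_{κ⁺}` of sets of hereditary size at most `κ`. -/
def Hclass (κ : ZFSet) : Set ZFSet := { x | HeredLE κ x }

/-! ### The measures witnessing Ramsey and Ramsey-like cardinals -/

/-- A Ramsey measure on `κ`: a weakly amenable `ω₁`-intersecting small universe measure. -/
def IsRamseyMeasure (κ U : ZFSet) : Prop :=
  IsSUMeasure κ U ∧ WeaklyAmenable κ (MU κ U) U ∧ OmegaOneIntersecting U

/-- A strong Ramsey measure on `κ`: a weakly amenable small universe measure whose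
minimal model `M_U` is a `κ`-model. -/
def IsStrongRamseyMeasure (κ U : ZFSet) : Prop :=
  IsSUMeasure κ U ∧ WeaklyAmenable κ (MU κ U) U ∧ SeqClosed κ (MU κ U)

/-- A super Ramsey measure on `κ`: a strong Ramsey measure with `M_U ≺ H_{κ⁺}`. -/
def IsSuperRamseyMeasure (κ U : ZFSet) : Prop :=
  IsStrongRamseyMeasure κ U ∧ ElemSub (MU κ U).toSet (Hclass κ)

/-- `I` certifies `U`: `I` is an unbounded subset of `κ` and the sets in `U` are exactly
the subsets of `κ` in `M_U` containing a tail of `I`. -/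
def Certifies (κ U : ZFSet) (I : Set ZFSet) : Prop :=
  (∀ ξ ∈ I, ξ ∈ κ) ∧ (∀ α ∈ κ, ∃ ξ ∈ I, ξ ∉ α) ∧
  ∀ X ∈ (MU κ U).toSet, X ⊆ κ →
    (X ∈ U ↔ ∃ α ∈ κ.toSet, ∀ ξ ∈ I, ξ ∉ α → ξ ∈ X)

/-- A certified Ramsey measure on `κ`: a weakly amenable small universe measure which is
certified by some unbounded `I ⊆ κ`. -/
def IsCertifiedRamseyMeasure (κ U : ZFSet) : Prop :=
  IsSUMeasure κ U ∧ WeaklyAmenable κ (MU κ U) U ∧ ∃ I : Set ZFSet, Certifies κ U I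

/-! ### Relativized (internal) versions of the measure predicates -/

/-- `ω₁`-intersecting from the point of view of the transitive model `N`: every
`ω`-sequence of members of `U` lying in `N` has a common element. -/
def OmegaOneIntersectingIn (N U : ZFSet) : Prop :=
  ∀ f ∈ N.toSet, IsZFunc ZFSet.omega f → (∀ n ∈ ZFSet.omega, fapp f n ∈ U) →
    ∃ x, ∀ n ∈ ZFSet.omega, x ∈ fapp f n

/-- `N ⊨ U is a Ramsey measure on κ`, for a transitive ZFC⁻-model `N`: all components are
absolute except `ω₁`-intersectingness, which is evaluated using sequences in `N`. -/
def RamseyMeasureIn (N κ U : ZFSet) : Prop :=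
  U ∈ N ∧ IsSUMeasure κ U ∧ WeaklyAmenable κ (MU κ U) U ∧ OmegaOneIntersectingIn N U

/-- `N ⊨ U is a strong Ramsey measure on κ`: closure of `M_U` under `<κ`-sequences is
evaluated using the sequences lying in `N`. -/
def StrongRamseyMeasureIn (N κ U : ZFSet) : Prop :=
  U ∈ N ∧ IsSUMeasure κ U ∧ WeaklyAmenable κ (MU κ U) U ∧
  ∀ f ∈ N.toSet, ∀ γ ∈ κ, IsZFunc γ f → (∀ a ∈ γ, fapp f a ∈ MU κ U) → f ∈ MU κ U

/-- The class `H_{κ⁺}` as computed in `N`. -/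
def HclassIn (N κ : ZFSet) : Set ZFSet := { x | x ∈ N ∧ HeredLE κ x }

/-- `N ⊨ U is a super Ramsey measure on κ`. -/
def SuperRamseyMeasureIn (N κ U : ZFSet) : Prop :=
  StrongRamseyMeasureIn N κ U ∧ ElemSub (MU κ U).toSet (HclassIn N κ)

/-- `N ⊨ U is a certified Ramsey measure on κ` (the certifying set is required to lie in `N`). -/
def CertifiedRamseyMeasureIn (N κ U : ZFSet) : Prop :=
  U ∈ N ∧ IsSUMeasure κ U ∧ WeaklyAmenable κ (MU κ U) U ∧
  ∃ I ∈ N.toSet, Certifies κ U I.toSet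

/-! ### Goodness, witness collections, and the M-order -/

/-- `U` is `A`-good: `A ∈ M_U`. -/
def AGood (κ A U : ZFSet) : Prop := A ∈ MU κ U

/-- A witness collection of `Pm`-measures on `κ`: a collection of `Pm`-measures containing
an `A`-good one for every `A ⊆ κ`. -/
def IsWitness (Pm : ZFSet → ZFSet → Prop) (κ : ZFSet) (𝒰 : Set ZFSet) : Prop :=
  (∀ U ∈ 𝒰, Pm κ U) ∧ ∀ A : ZFSet, A ⊆ κ → ∃ U ∈ 𝒰, AGood κ A U

/-- The M-order on witness collections of `Pm`-measures on `κ`; `PmIn N κ U` is the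
relativization `N ⊨ U is a Pm-measure on κ`.  `MOrder Pm PmIn κ 𝒰 𝒲` says `𝒰 ◁ 𝒲`. -/
def MOrder (Pm : ZFSet → ZFSet → Prop) (PmIn : ZFSet → ZFSet → ZFSet → Prop)
    (κ : ZFSet) (𝒰 𝒲 : Set ZFSet) : Prop :=
  IsWitness Pm κ 𝒰 ∧ IsWitness Pm κ 𝒲 ∧
  (∀ W ∈ 𝒲, ∀ A ∈ (NU κ W).toSet, A ⊆ κ →
    ∃ U ∈ 𝒰, U ∈ NU κ W ∧ AGood κ A U ∧ PmIn (NU κ W) κ U) ∧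
  (∀ U ∈ 𝒰, ∃ W ∈ 𝒲, U ∈ NU κ W)

/-! ### Ranks -/

/-- The rank of a point in an arbitrary binary relation (`0` at non-accessible points). -/
def relRank {X : Type*} (r : X → X → Prop) (x : X) : Ordinal :=
  if h : Acc r x then h.rank else 0

/-- The M-rank `o_Pm(κ)`: the strict supremum of the M-ranks of all witness collections of
`Pm`-measures on `κ` (and `0` if there are none). -/
def oRank (Pm : ZFSet → ZFSet → Prop) (PmIn : ZFSet → ZFSet → ZFSet → Prop)
    (κ : ZFSet) : Ordinal :=
  sSup { o : Ordinal |
    ∃ 𝒰 : Set ZFSet, IsWitness Pm κ 𝒰 ∧ o = relRank (MOrder Pm PmIn κ) 𝒰 + 1 }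

/-- `N ⊨ o_Pm(κ) ≥ α`, defined by the recursion: for every `A ⊆ κ` in `N` and every `β < α`
there is an `A`-good `Pm`-measure `W` in `N` (in the sense of `N`) whose ultrapower satisfies
`o_Pm(κ) ≥ β`. -/
def oGEin (PmIn : ZFSet → ZFSet → ZFSet → Prop) (κ : ZFSet) : Ordinal → ZFSet → Prop :=
  WellFounded.fix wellFounded_lt fun α ih N =>
    ∀ A ∈ N.toSet, A ⊆ κ → ∀ β, ∀ h : β < α,
      ∃ W ∈ N.toSet, PmIn N κ W ∧ AGood κ A W ∧ ih β h (NU κ W)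

/-- `N ⊨ o_Pm(κ) = α`. -/
def oEQin (PmIn : ZFSet → ZFSet → ZFSet → Prop) (κ : ZFSet) (α : Ordinal) (N : ZFSet) : Prop :=
  oGEin PmIn κ α N ∧ ¬ oGEin PmIn κ (α + 1) N

/-! ### The M-order and M-rank relativized to a model `ℳ` -/

/-- A witness collection (coded as a set) of `Pm`-measures in the sense of the model `ℳ`. -/
def IsWitnessIn (PmIn : ZFSet → ZFSet → ZFSet → Prop) (ℳ κ 𝒰 : ZFSet) : Prop :=
  𝒰 ∈ ℳ ∧ (∀ U ∈ 𝒰, PmIn ℳ κ U) ∧ ∀ A ∈ ℳ.toSet, A ⊆ κ → ∃ U ∈ 𝒰.toSet, AGood κ A U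

/-- The M-order on witness collections as computed in `ℳ`. -/
def MOrderIn (PmIn : ZFSet → ZFSet → ZFSet → Prop) (ℳ κ : ZFSet) (𝒰 𝒲 : ZFSet) : Prop :=
  IsWitnessIn PmIn ℳ κ 𝒰 ∧ IsWitnessIn PmIn ℳ κ 𝒲 ∧
  (∀ W ∈ 𝒲, ∀ A ∈ (NU κ W).toSet, A ⊆ κ →
    ∃ U ∈ 𝒰.toSet, U ∈ NU κ W ∧ AGood κ A U ∧ PmIn (NU κ W) κ U) ∧
  (∀ U ∈ 𝒰, ∃ W ∈ 𝒲.toSet, U ∈ NU κ W)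

/-- The M-rank `o_Pm(κ)` as computed in `ℳ`. -/
def oRankIn (PmIn : ZFSet → ZFSet → ZFSet → Prop) (ℳ κ : ZFSet) : Ordinal :=
  sSup { o : Ordinal |
    ∃ 𝒰 : ZFSet, IsWitnessIn PmIn ℳ κ 𝒰 ∧ o = relRank (MOrderIn PmIn ℳ κ) 𝒰 + 1 }

/-! ### Practical models, cover and approximation properties -/

/-- `ℳ` is practical for `κ`: a transitive ZFC⁻-model containing `κ` in which
`V_{κ+3}` exists. -/
def Practical (κ ℳ : ZFSet) : Prop :=
  IsTransModel ℳ ∧ κ ∈ ℳ ∧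
  ∃ v ∈ ℳ.toSet, ∀ x, x ∈ v ↔ (x ∈ ℳ ∧ ZFSet.rank x < ZFSet.rank κ + 3)

/-- `x` has size less than `δ` as witnessed inside the class `D`:
some `f ∈ D` injects `x` into an ordinal `γ ∈ δ`. -/
def SizeLTin (D : Set ZFSet) (x δ : ZFSet) : Prop :=
  ∃ γ ∈ δ.toSet, ∃ f ∈ D, IsZFunc x f ∧ MapsInto f x γ ∧ InjOnZ f x

/-- The pair `D ⊆ D'` has the `δ`-cover property. -/
def CoverProperty (δ : ZFSet) (D D' : Set ZFSet) : Prop :=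
  ∀ X ∈ D', X.toSet ⊆ D → SizeLTin D' X δ →
    ∃ Y ∈ D, X ⊆ Y ∧ SizeLTin D Y δ

/-- The pair `D ⊆ D'` has the `δ`-approximation property. -/
def ApproxProperty (δ : ZFSet) (D D' : Set ZFSet) : Prop :=
  ∀ X ∈ D', X.toSet ⊆ D → (∀ x ∈ D, SizeLTin D x δ → X ∩ x ∈ D) → X ∈ D

/-- `δ` is a cardinal from the point of view of the class `D`. -/
def IsCardIn (D : Set ZFSet) (δ : ZFSet) : Prop :=
  IsOrd δ ∧ δ ∈ D ∧ ∀ γ ∈ δ, ¬ ∃ f ∈ D, IsZFunc γ f ∧ SurjOnto f γ δ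

/-- `δ` is a regular (infinite) cardinal from the point of view of the class `D`. -/
def IsRegularIn (D : Set ZFSet) (δ : ZFSet) : Prop :=
  IsCardIn D δ ∧ ZFSet.omega ⊆ δ ∧
  ∀ γ ∈ δ, ∀ f ∈ D, IsZFunc γ f → MapsInto f γ δ →
    ∃ β ∈ δ, ∀ a ∈ γ, fapp f a ∈ β

/-- `H_λ` as computed in the model `V`: the members of `V` having, in `V`,
a transitive superset of size `< λ`. -/
def HIn (V lam : ZFSet) : Set ZFSet :=
  { x | x ∈ V ∧ ∃ t ∈ V.toSet, x ⊆ t ∧ t.IsTransitive ∧ SizeLTin V.toSet t lam }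

/-- `V` and `V'` have the same ordinals. -/
def SameOrdinals (D D' : Set ZFSet) : Prop :=
  ∀ α, IsOrd α → (α ∈ D ↔ α ∈ D')

/-- Every `ω`-sequence of elements of `ℳ` lying in `ℳ'` is an element of `ℳ`. -/
def OmegaSeqClosedPair (ℳ ℳ' : ZFSet) : Prop :=
  ∀ f ∈ ℳ'.toSet, IsZFunc ZFSet.omega f → (∀ n ∈ ZFSet.omega, fapp f n ∈ ℳ) → f ∈ ℳ

/-! ### Large cardinal properties -/

/-- `κ` is Ramsey: every `A ⊆ κ` belongs to a weak `κ`-model `M` carrying a weakly amenable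
`ω₁`-intersecting `M`-ultrafilter on `κ`. -/
def IsRamseyCard (κ : ZFSet) : Prop :=
  IsCard κ ∧ ∀ A : ZFSet, A ⊆ κ →
    ∃ M, IsWeakModel κ M ∧ A ∈ M ∧
      ∃ U, IsMUltrafilter κ M U ∧ WeaklyAmenable κ M U ∧ OmegaOneIntersecting U

/-- `κ` is strongly Ramsey: the model `M` can moreover be taken to be a `κ`-model. -/
def IsStronglyRamseyCard (κ : ZFSet) : Prop :=
  IsCard κ ∧ ∀ A : ZFSet, A ⊆ κ →
    ∃ M, IsKappaModel κ M ∧ A ∈ M ∧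
      ∃ U, IsMUltrafilter κ M U ∧ WeaklyAmenable κ M U ∧ OmegaOneIntersecting U

/-- `κ` is super Ramsey: the model `M` can moreover be taken to be a `κ`-model
elementary in `H_{κ⁺}`. -/
def IsSuperRamseyCard (κ : ZFSet) : Prop :=
  IsCard κ ∧ ∀ A : ZFSet, A ⊆ κ →
    ∃ M, IsKappaModel κ M ∧ ElemSub M.toSet (Hclass κ) ∧ A ∈ M ∧
      ∃ U, IsMUltrafilter κ M U ∧ WeaklyAmenable κ M U ∧ OmegaOneIntersecting U

/-- `κ` is weakly super Ramsey: the model `M` is a weak `κ`-model elementary in `H_{κ⁺}`. -/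
def IsWeaklySuperRamseyCard (κ : ZFSet) : Prop :=
  IsCard κ ∧ ∀ A : ZFSet, A ⊆ κ →
    ∃ M, IsWeakModel κ M ∧ ElemSub M.toSet (Hclass κ) ∧ A ∈ M ∧
      ∃ U, IsMUltrafilter κ M U ∧ WeaklyAmenable κ M U ∧ OmegaOneIntersecting U

/-- `κ` is measurable: there is a `κ`-complete nonprincipal ultrafilter on (all) subsets
of `κ`. -/
def IsMeasurableCard (κ : ZFSet) : Prop :=
  IsCard κ ∧ ZFSet.omega ∈ κ ∧
  ∃ 𝒰 : Set ZFSet,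
    (∀ A ∈ 𝒰, A ⊆ κ) ∧ (∅ : ZFSet) ∉ 𝒰 ∧ κ ∈ 𝒰 ∧
    (∀ A ∈ 𝒰, ∀ B : ZFSet, B ⊆ κ → A ⊆ B → B ∈ 𝒰) ∧
    (∀ A : ZFSet, A ⊆ κ → (A ∈ 𝒰 ∨ compl κ A ∈ 𝒰)) ∧
    (∀ γ ∈ κ.toSet, ∀ s : ZFSet → ZFSet, (∀ i ∈ γ, s i ∈ 𝒰) →
      ZFSet.sep (fun ξ => ∀ i ∈ γ, ξ ∈ s i) κ ∈ 𝒰)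

/-! ### Relativized large-cardinal properties -/

/-- `N ⊨ κ is Ramsey` (for a transitive model `N`): the witnessing models and ultrafilters
lie in `N`, smallness of the models is witnessed in `N`, and `ω₁`-intersectingness is
evaluated using the sequences in `N`. -/
def RamseyCardIn (N κ : ZFSet) : Prop :=
  ∀ A ∈ N.toSet, A ⊆ κ →
    ∃ M ∈ N.toSet, A ∈ M ∧ IsTransModel M ∧ κ ∈ M ∧
      (∃ f ∈ N.toSet, IsZFunc κ f ∧ SurjOnto f κ M) ∧
      ∃ U ∈ N.toSet, IsMUltrafilter κ M U ∧ WeaklyAmenable κ M U ∧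
        OmegaOneIntersectingIn N U

/-- `N ⊨ κ is strongly Ramsey`. -/
def StronglyRamseyCardIn (N κ : ZFSet) : Prop :=
  ∀ A ∈ N.toSet, A ⊆ κ →
    ∃ M ∈ N.toSet, A ∈ M ∧ IsTransModel M ∧ κ ∈ M ∧
      (∃ f ∈ N.toSet, IsZFunc κ f ∧ SurjOnto f κ M) ∧
      (∀ f ∈ N.toSet, ∀ γ ∈ κ, IsZFunc γ f → (∀ a ∈ γ, fapp f a ∈ M) → f ∈ M) ∧
      ∃ U ∈ N.toSet, IsMUltrafilter κ M U ∧ WeaklyAmenable κ M U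

/-- `N ⊨ κ is super Ramsey`. -/
def SuperRamseyCardIn (N κ : ZFSet) : Prop :=
  ∀ A ∈ N.toSet, A ⊆ κ →
    ∃ M ∈ N.toSet, A ∈ M ∧ IsTransModel M ∧ κ ∈ M ∧
      (∃ f ∈ N.toSet, IsZFunc κ f ∧ SurjOnto f κ M) ∧
      (∀ f ∈ N.toSet, ∀ γ ∈ κ, IsZFunc γ f → (∀ a ∈ γ, fapp f a ∈ M) → f ∈ M) ∧
      ElemSub M.toSet (HclassIn N κ) ∧
      ∃ U ∈ N.toSet, IsMUltrafilter κ M U ∧ WeaklyAmenable κ M U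

/-! ### ω-special models -/

/-- A weak `κ`-model `M` is `ω`-special: it is the union of a chain
`M₀ ≺ M₁ ≺ ⋯` of elementary substructures of `M` with each `Mₙ ∈ M` and `|Mₙ|^M = κ`. -/
def OmegaSpecial (κ M : ZFSet) : Prop :=
  ∃ s : ℕ → ZFSet,
    (∀ n, s n ∈ M) ∧
    (∀ n, (s n).toSet ⊆ (s (n + 1)).toSet) ∧
    (∀ n, ElemSub (s n).toSet M.toSet) ∧
    (∀ n, ∃ f ∈ M.toSet, IsBij f κ (s n)) ∧
    (∀ x, x ∈ M ↔ ∃ n, x ∈ s n)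

/-! ### Iterated ultrapowers and α-iterability -/

/-- `U` is an `α`-iterable `M`-ultrafilter on `κ`: there is a coherent system of transitive
models `Mod β` (`β ≤ α`), with commuting elementary embeddings `e β γ : Mod β → Mod γ`,
critical sequence `cr β` and ultrafilter sequence `Us β`, starting at `(M, κ, U)`, where each
successor step is given by an ultrapower and each limit step is a (collapsed) direct limit. -/
def IsAlphaIterable (κ M U : ZFSet) (α : Ordinal) : Prop :=
  ∃ (Mod : Ordinal → ZFSet) (cr : Ordinal → ZFSet) (Us : Ordinal → ZFSet)
    (e : Ordinal → Ordinal → ZFSet → ZFSet),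
    Mod 0 = M ∧ cr 0 = κ ∧ Us 0 = U ∧
    (∀ β ≤ α, (Mod β).IsTransitive) ∧
    (∀ β ≤ α, ∀ x ∈ Mod β, e β β x = x) ∧
    (∀ β γ ρ : Ordinal, β ≤ γ → γ ≤ ρ → ρ ≤ α →
      ∀ x ∈ Mod β, e γ ρ (e β γ x) = e β ρ x) ∧
    (∀ β γ : Ordinal, β ≤ γ → γ ≤ α →
      (∀ x ∈ Mod β, e β γ x ∈ Mod γ) ∧
      ∀ (φ : Fml) (v : ℕ → ZFSet), (∀ n, v n ∈ Mod β) →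
        (Sat (Mod β).toSet φ v ↔ Sat (Mod γ).toSet φ (fun n => e β γ (v n)))) ∧
    (∀ β : Ordinal, β + 1 ≤ α →
      IsUltrapowerEmb (cr β) (Mod β) (Us β) (Mod (β + 1)) (e β (β + 1)) ∧
      cr (β + 1) = e β (β + 1) (cr β) ∧
      (∀ A, A ∈ Us (β + 1) ↔
        ∃ X ∈ (Mod β).toSet, X ∩ Us β ∈ Mod β ∧ A ∈ e β (β + 1) (X ∩ Us β))) ∧
    (∀ lam : Ordinal, lam ≤ α → lam ≠ 0 → (∀ β < lam, β + 1 < lam) →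
      (∀ x ∈ Mod lam, ∃ β < lam, ∃ y ∈ (Mod β).toSet, e β lam y = x) ∧
      cr lam = e 0 lam κ ∧
      (∀ A, A ∈ Us lam ↔ ∃ β < lam, ∃ B, B ∈ Us β ∧ e β lam B = A))

/-- `N ⊨ κ is α-iterable`: every `A ⊆ κ` in `N` belongs to a weak `κ`-model `M ∈ N` for
which there is a weakly amenable `α`-iterable `M`-ultrafilter `U ∈ N` on `κ`. -/
def AlphaIterableCardIn (N κ : ZFSet) (α : Ordinal) : Prop :=
  ∀ A ∈ N.toSet, A ⊆ κ →
    ∃ M ∈ N.toSet, A ∈ M ∧ IsTransModel M ∧ κ ∈ M ∧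
      (∃ f ∈ N.toSet, IsZFunc κ f ∧ SurjOnto f κ M) ∧
      ∃ U ∈ N.toSet, IsMUltrafilter κ M U ∧ WeaklyAmenable κ M U ∧
        IsAlphaIterable κ M U α

/-! ### Forcing -/

/-- `R` codes a partial order (of forcing conditions) on `P`: `pair p q ∈ R` means `p ≤ q`. -/
def IsPoset (P R : ZFSet) : Prop :=
  (∀ p ∈ R, ∃ a ∈ P, ∃ b ∈ P, p = ZFSet.pair a b) ∧
  (∀ p ∈ P, ZFSet.pair p p ∈ R) ∧
  (∀ p ∈ P, ∀ q ∈ P, ∀ r ∈ P,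
    ZFSet.pair p q ∈ R → ZFSet.pair q r ∈ R → ZFSet.pair p r ∈ R)

/-- `G` is an `ℳ`-generic filter on the poset `(P, R)`. -/
def IsGenericFilter (ℳ P R : ZFSet) (G : Set ZFSet) : Prop :=
  G ⊆ P.toSet ∧ G.Nonempty ∧
  (∀ p ∈ G, ∀ q ∈ G, ∃ r ∈ G, ZFSet.pair r p ∈ R ∧ ZFSet.pair r q ∈ R) ∧
  (∀ p ∈ G, ∀ q ∈ P.toSet, ZFSet.pair p q ∈ R → q ∈ G) ∧
  ∀ Dset ∈ ℳ.toSet, Dset ⊆ P →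
    (∀ p ∈ P.toSet, ∃ q ∈ Dset.toSet, ZFSet.pair q p ∈ R) →
    ∃ q ∈ G, q ∈ Dset

/-- `ℳ'` is the generic extension `ℳ[G]`: the least transitive ZFC⁻-model containing `ℳ`
and (a set coding) `G`, with the same ordinals as `ℳ`. -/
def IsGenericExt (ℳ ℳ' : ZFSet) (G : Set ZFSet) : Prop :=
  IsTransModel ℳ' ∧ ℳ ⊆ ℳ' ∧ (∃ g ∈ ℳ'.toSet, g.toSet = G) ∧
  SameOrdinals ℳ.toSet ℳ'.toSet ∧
  ∀ N', IsTransModel N' → ℳ ⊆ N' → (∃ g ∈ N'.toSet, g.toSet = G) → ℳ' ⊆ N'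

/-- `f ∈ D` is a cofinal map from `γ` into the ordinal `α`. -/
def CofinalMapIn (D : Set ZFSet) (γ α f : ZFSet) : Prop :=
  f ∈ D ∧ IsZFunc γ f ∧ MapsInto f γ α ∧
  ∀ b ∈ α, ∃ a ∈ γ, b ∈ fapp f a ∨ b = fapp f a

/-- `γ` is the cofinality of the ordinal `α` as computed in `D`. -/
def IsCofIn (D : Set ZFSet) (α γ : ZFSet) : Prop :=
  IsOrd γ ∧ (∃ f, CofinalMapIn D γ α f) ∧ ∀ γ' ∈ γ, ¬ ∃ f, CofinalMapIn D γ' α f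

/-- The pair `ℳ ⊆ ℳ'` preserves all cofinalities. -/
def PreservesCofinalities (ℳ ℳ' : ZFSet) : Prop :=
  ∀ α ∈ ℳ.toSet, IsOrd α → ∀ γ, (IsCofIn ℳ.toSet α γ ↔ IsCofIn ℳ'.toSet α γ)

set_option linter.all false

universe u

section

/-! ### Definability framework -/

/-- Transitive nonempty class. -/
def TrC (D : Set ZFSet.{u}) : Prop := (∀ x ∈ D, ∀ y ∈ x, y ∈ D) ∧ D.Nonempty

/-- prepend an element to a sequence -/
def cons {α : Type*} (x : α) (v : ℕ → α) : ℕ → α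
  | 0 => x
  | n + 1 => v n

/-- uniform first-order definability (with parameters) over a family of transitive classes -/
def Df (𝒟 : Set (Set ZFSet.{u})) (R : Set ZFSet.{u} → (ℕ → ZFSet.{u}) → Prop) : Prop :=
  ∀ (S : Set ℕ) (ι : ℕ → ℕ), Sᶜ.Infinite → (∀ n, ι n ∈ S) →
    ∃ (φ : Fml) (F : Set ℕ) (w : ℕ → ZFSet.{u}), F.Finite ∧ Disjoint F S ∧
      (∀ D ∈ 𝒟, ∀ n ∈ F, w n ∈ D) ∧
      ∀ D ∈ 𝒟, TrC D → ∀ v : ℕ → ZFSet.{u}, (∀ n, v n ∈ D) → (∀ n ∈ F, v n = w n) →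
        (Sat D φ v ↔ R D (fun n => v (ι n)))

/-- definable terms, given by definable subsets of the class -/
structure DT (𝒟 : Set (Set ZFSet.{u})) (t : Set ZFSet.{u} → (ℕ → ZFSet.{u}) → ZFSet.{u}) :
    Prop where
  mem : Df 𝒟 (fun D v => v 0 ∈ t D (fun i => v (i + 1)))
  sub : ∀ D ∈ 𝒟, TrC D → ∀ v : ℕ → ZFSet.{u}, (∀ n, v n ∈ D) → ∀ z ∈ t D v, z ∈ D

section rules

variable {𝒟 : Set (Set ZFSet.{u})}
variable {P Q : Set ZFSet.{u} → (ℕ → ZFSet.{u}) → Prop}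
variable {R : Set ZFSet.{u} → ZFSet.{u} → (ℕ → ZFSet.{u}) → Prop}
variable {r s t : Set ZFSet.{u} → (ℕ → ZFSet.{u}) → ZFSet.{u}}

theorem Df.congr (h : Df 𝒟 P)
    (e : ∀ D ∈ 𝒟, TrC D → ∀ v : ℕ → ZFSet.{u}, (∀ n, v n ∈ D) → (P D v ↔ Q D v)) :
    Df 𝒟 Q := by
  intro S ι hS hι
  obtain ⟨φ, F, w, h1, h2, h3, h4⟩ := h S ι hS hι
  exact ⟨φ, F, w, h1, h2, h3, fun D hD hT v hv hF =>
    (h4 D hD hT v hv hF).trans (e D hD hT _ fun n => hv _)⟩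

theorem Df.not (h : Df 𝒟 P) : Df 𝒟 (fun D v => ¬ P D v) := by
  intro S ι hS hι
  obtain ⟨φ, F, w, h1, h2, h3, h4⟩ := h S ι hS hι
  exact ⟨.neg φ, F, w, h1, h2, h3, fun D hD hT v hv hF => not_congr (h4 D hD hT v hv hF)⟩

theorem Df.imp (h : Df 𝒟 P) (h' : Df 𝒟 Q) : Df 𝒟 (fun D v => P D v → Q D v) := by
  intro S ι hS hι
  obtain ⟨φ, F, w, h1, h2, h3, h4⟩ := h S ι hS hι
  obtain ⟨φ', F', w', h1', h2', h3', h4'⟩ := h' (S ∪ F) ι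
    (by rw [Set.compl_union]; exact hS.sdiff h1) (fun n => Or.inl (hι n))
  rw [Set.disjoint_left] at h2 h2'
  refine ⟨.impl φ φ', F ∪ F', fun n => if n ∈ F then w n else w' n, h1.union h1', ?_, ?_, ?_⟩
  · rw [Set.disjoint_left]
    rintro n (hn | hn) hS
    · exact h2 hn hS
    · exact h2' hn (Or.inl hS)
  · intro D hD n hn
    by_cases hF : n ∈ F
    · simp [hF]; exact h3 D hD n hF
    · simp only [hF, if_false]; exact h3' D hD n (hn.resolve_left hF)
  · intro D hD hT v hv hF
    refine imp_congr (h4 D hD hT v hv fun n hn => ?_) (h4' D hD hT v hv fun n hn => ?_)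
    · exact (hF n (Or.inl hn)).trans (if_pos hn)
    · exact (hF n (Or.inr hn)).trans (if_neg fun h => h2' hn (Or.inr h))

theorem Df.all (h : Df 𝒟 (fun D v => R D (v 0) (fun i => v (i + 1)))) :
    Df 𝒟 (fun D v => ∀ x ∈ D, R D x v) := by
  intro S ι hS hι
  obtain ⟨m, hm⟩ := hS.nonempty
  obtain ⟨φ, F, w, h1, h2, h3, h4⟩ := h (insert m S) (cons m ι)
    (by
      have : (insert m S)ᶜ = Sᶜ \ {m} := by ext; simp; tauto
      rw [this]; exact hS.sdiff (Set.finite_singleton m))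
    (by rintro (_ | n); exacts [Or.inl rfl, Or.inr (hι n)])
  have hιm : ∀ n, ι n ≠ m := fun n e => hm (e ▸ hι n)
  rw [Set.disjoint_left] at h2
  refine ⟨.all m φ, F, w, h1, ?_, h3, ?_⟩
  · rw [Set.disjoint_left]; exact fun n hn hS => h2 hn (Or.inr hS)
  · intro D hD hT v hv hF
    refine forall₂_congr fun x hx => ?_
    rw [h4 D hD hT]
    · simp only [cons, Function.update_self, ne_eq, hιm, not_false_eq_true,
        Function.update_of_ne]
    · intro n
      by_cases hn : n = m
      · subst hn; simpa using hx
      · simpa [hn] using hv n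
    · intro n hn
      have : n ≠ m := fun e => h2 hn (Or.inl e)
      simpa [this] using hF n hn

theorem Df.and (h : Df 𝒟 P) (h' : Df 𝒟 Q) : Df 𝒟 (fun D v => P D v ∧ Q D v) :=
  (h.imp h'.not).not.congr fun _ _ _ _ _ => by tauto

theorem Df.or (h : Df 𝒟 P) (h' : Df 𝒟 Q) : Df 𝒟 (fun D v => P D v ∨ Q D v) :=
  (h.not.imp h').congr fun _ _ _ _ _ => by tauto

theorem Df.iff (h : Df 𝒟 P) (h' : Df 𝒟 Q) : Df 𝒟 (fun D v => P D v ↔ Q D v) :=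
  ((h.imp h').and (h'.imp h)).congr fun _ _ _ _ _ => by tauto

theorem Df.ex (h : Df 𝒟 (fun D v => R D (v 0) (fun i => v (i + 1)))) :
    Df 𝒟 (fun D v => ∃ x ∈ D, R D x v) :=
  (Df.all (R := fun D x v => ¬ R D x v) h.not).not.congr fun _ _ _ _ _ => by push Not; rfl

theorem Df.shift (f : ℕ → ℕ) (h : Df 𝒟 P) : Df 𝒟 (fun D v => P D (fun i => v (f i))) := by
  intro S ι hS hι
  exact h S (fun n => ι (f n)) hS (fun n => hι _)

theorem Df.var_mem (i j : ℕ) : Df 𝒟 (fun _ v => v i ∈ v j) := by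
  intro S ι hS hι
  exact ⟨.mem (ι i) (ι j), ∅, fun _ => ∅, Set.finite_empty, by simp, by simp,
    fun D hD hT v hv hF => Iff.rfl⟩

theorem DT.var (i : ℕ) : DT 𝒟 (fun _ v => v i) :=
  ⟨Df.var_mem 0 (i + 1), fun _ _ hT _ hv _ hz => hT.1 _ (hv i) _ hz⟩

theorem DT.const {p : ZFSet.{u}} (hp : ∀ D ∈ 𝒟, p ∈ D) : DT 𝒟 (fun _ _ => p) := by
  refine ⟨?_, fun D hD hT _ _ _ hz => hT.1 _ (hp D hD) _ hz⟩
  intro S ι hS hι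
  obtain ⟨m, hm⟩ := hS.nonempty
  exact ⟨.mem (ι 0) m, {m}, fun _ => p, Set.finite_singleton m, by simpa using hm,
    fun D hD _ _ => hp D hD, fun D hD hT v hv hF => by simp [Sat, hF m rfl]⟩

theorem DT.constM {M p : ZFSet.{u}} (hp : p ∈ M) : DT {M.toSet} (fun _ _ => p) :=
  DT.const (by rintro D rfl; exact hp)

theorem DT.shift (f : ℕ → ℕ) (h : DT 𝒟 t) : DT 𝒟 (fun D v => t D (fun i => v (f i))) := by
  refine ⟨?_, fun D hD hT v hv => h.sub D hD hT _ fun n => hv _⟩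
  exact (h.mem.shift (fun n => Nat.casesOn n 0 (fun k => f k + 1)))

theorem DT.succ (h : DT 𝒟 t) : DT 𝒟 (fun D v => t D (fun i => v (i + 1))) :=
  h.shift (· + 1)

theorem Df.ball (ht : DT 𝒟 t) (h : Df 𝒟 (fun D v => R D (v 0) (fun i => v (i + 1)))) :
    Df 𝒟 (fun D v => ∀ x ∈ t D v, R D x v) :=
  (Df.all (R := fun D x v => x ∈ t D v → R D x v) (ht.mem.imp h)).congr
    fun D hD hT v hv => ⟨fun H x hx => H x (ht.sub D hD hT v hv x hx) hx, fun H x _ hx => H x hx⟩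

theorem Df.bex (ht : DT 𝒟 t) (h : Df 𝒟 (fun D v => R D (v 0) (fun i => v (i + 1)))) :
    Df 𝒟 (fun D v => ∃ x ∈ t D v, R D x v) :=
  (Df.ball (R := fun D x v => ¬ R D x v) ht h.not).not.congr fun _ _ _ _ _ => by push Not; rfl

theorem Df.allM {M : ZFSet.{u}} (h : Df {M.toSet} (fun D v => R D (v 0) (fun i => v (i + 1)))) :
    Df {M.toSet} (fun D v => ∀ x ∈ M, R D x v) :=
  (Df.all h).congr (by rintro D rfl _ v _; rfl)

theorem Df.exM {M : ZFSet.{u}} (h : Df {M.toSet} (fun D v => R D (v 0) (fun i => v (i + 1)))) :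
    Df {M.toSet} (fun D v => ∃ x ∈ M, R D x v) :=
  (Df.ex h).congr (by rintro D rfl _ v _; rfl)

theorem Df.eq (hs : DT 𝒟 s) (ht : DT 𝒟 t) : Df 𝒟 (fun D v => s D v = t D v) := by
  refine ((Df.ball (R := fun D x v => x ∈ t D v) hs ht.mem).and
    (Df.ball (R := fun D x v => x ∈ s D v) ht hs.mem)).congr ?_
  intro D _ _ v _
  constructor
  · rintro ⟨h1, h2⟩; ext z; exact ⟨h1 z, h2 z⟩
  · intro h; rw [h]; exact ⟨fun _ h => h, fun _ h => h⟩

theorem Df.mem (hs : DT 𝒟 s) (ht : DT 𝒟 t) : Df 𝒟 (fun D v => s D v ∈ t D v) := by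
  refine (Df.bex (R := fun D x v => x = s D v) ht (Df.eq (DT.var 0) hs.succ)).congr ?_
  intro D _ _ v _; simp

theorem Df.subset (hs : DT 𝒟 s) (ht : DT 𝒟 t) : Df 𝒟 (fun D v => s D v ⊆ t D v) :=
  Df.ball (R := fun D x v => x ∈ t D v) hs ht.mem

theorem Df.nmem (hs : DT 𝒟 s) (ht : DT 𝒟 t) : Df 𝒟 (fun D v => s D v ∉ t D v) :=
  (Df.mem hs ht).not

theorem Df.ne (hs : DT 𝒟 s) (ht : DT 𝒟 t) : Df 𝒟 (fun D v => s D v ≠ t D v) :=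
  (Df.eq hs ht).not

theorem Df.true_ : Df 𝒟 (fun _ _ => True) :=
  ((Df.var_mem 0 0).imp (Df.var_mem 0 0)).congr fun _ _ _ _ _ => by simp

theorem Df.prop (p : Prop) : Df 𝒟 (fun _ _ => p) := by
  by_cases h : p
  · exact Df.true_.congr fun _ _ _ _ _ => by simp [h]
  · exact Df.true_.not.congr fun _ _ _ _ _ => by simp [h]

/-- `a = {s, t}` -/
theorem Df.eq_upair (hr : DT 𝒟 r) (hs : DT 𝒟 s) (ht : DT 𝒟 t) :
    Df 𝒟 (fun D v => r D v = {s D v, t D v}) := by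
  refine ((Df.mem hs hr).and ((Df.mem ht hr).and (Df.ball (R := fun D x v => x = s D v ∨ x = t D v)
    hr ((Df.eq (DT.var 0) hs.succ).or (Df.eq (DT.var 0) ht.succ))))).congr ?_
  intro D _ _ v _
  constructor
  · rintro ⟨h1, h2, h3⟩
    ext z
    rw [ZFSet.mem_pair]
    exact ⟨h3 z, by rintro (rfl | rfl) <;> assumption⟩
  · intro h; rw [h]; simp

theorem Df.eq_pair (hr : DT 𝒟 r) (hs : DT 𝒟 s) (ht : DT 𝒟 t) :
    Df 𝒟 (fun D v => r D v = ZFSet.pair (s D v) (t D v)) := by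
  have e1 : Df 𝒟 (fun D v => v 0 = {s D (fun i => v (i+1)), s D (fun i => v (i+1))}) :=
    Df.eq_upair (DT.var 0) hs.succ hs.succ
  have e2 : Df 𝒟 (fun D v => v 0 = {s D (fun i => v (i+1)), t D (fun i => v (i+1))}) :=
    Df.eq_upair (DT.var 0) hs.succ ht.succ
  refine ((Df.bex (R := fun D x v => x = {s D v, s D v}) hr e1).and
    ((Df.bex (R := fun D x v => x = {s D v, t D v}) hr e2).and
    (Df.ball (R := fun D x v => x = {s D v, s D v} ∨ x = {s D v, t D v}) hr (e1.or e2)))).congr ?_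
  intro D _ _ v _
  have hss : ({s D v, s D v} : ZFSet) = {s D v} := by ext; simp
  simp only [hss, ZFSet.pair]
  constructor
  · rintro ⟨⟨x, h1, rfl⟩, ⟨y, h2, rfl⟩, h3⟩
    ext z
    rw [ZFSet.mem_pair]
    exact ⟨h3 z, by rintro (rfl | rfl) <;> assumption⟩
  · intro h; rw [h]; simp

theorem Df.pair_mem (hs : DT 𝒟 s) (ht : DT 𝒟 t) (hr : DT 𝒟 r) :
    Df 𝒟 (fun D v => ZFSet.pair (s D v) (t D v) ∈ r D v) := by
  refine (Df.bex (R := fun D x v => x = ZFSet.pair (s D v) (t D v)) hr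
    (Df.eq_pair (DT.var 0) hs.succ ht.succ)).congr ?_
  intro D _ _ v _; simp

theorem DT.sUnion (ht : DT 𝒟 t) : DT 𝒟 (fun D v => (⋃₀ (t D v) : ZFSet)) := by
  refine ⟨?_, ?_⟩
  · refine (Df.bex (t := fun D v => t D (fun i => v (i+1))) (R := fun D x v => v 0 ∈ x) ht.succ
      (Df.var_mem _ _)).congr ?_
    intro D _ _ v _; simp
  · intro D hD hT v hv z hz
    obtain ⟨y, hy, hz⟩ := ZFSet.mem_sUnion.1 hz
    exact hT.1 _ (ht.sub D hD hT v hv y hy) z hz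

theorem DT.sep (ht : DT 𝒟 t) (h : Df 𝒟 (fun D v => R D (v 0) (fun i => v (i + 1)))) :
    DT 𝒟 (fun D v => ZFSet.sep (fun x => R D x v) (t D v)) := by
  refine ⟨(ht.mem.and h).congr fun D _ _ v _ => by simp, ?_⟩
  intro D hD hT v hv z hz
  exact ht.sub D hD hT v hv z (ZFSet.mem_sep.1 hz).1

theorem DT.inter (hs : DT 𝒟 s) (ht : DT 𝒟 t) : DT 𝒟 (fun D v => s D v ∩ t D v) := by
  refine ⟨(hs.mem.and ht.mem).congr fun D _ _ v _ => by simp, ?_⟩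
  intro D hD hT v hv z hz
  exact ht.sub D hD hT v hv z (ZFSet.mem_inter.1 hz).2

theorem DT.union (hs : DT 𝒟 s) (ht : DT 𝒟 t) : DT 𝒟 (fun D v => s D v ∪ t D v) := by
  refine ⟨(hs.mem.or ht.mem).congr fun D _ _ v _ => by simp, ?_⟩
  intro D hD hT v hv z hz
  exact (ZFSet.mem_union.1 hz).elim (hs.sub D hD hT v hv z) (ht.sub D hD hT v hv z)

theorem DT.empty : DT 𝒟 (fun _ _ => (∅ : ZFSet.{u})) :=
  ⟨(Df.prop False).congr fun D _ _ v _ => by simp, fun D hD hT v hv z hz => by simp at hz⟩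

theorem DT.fapp (hs : DT 𝒟 s) (ht : DT 𝒟 t) : DT 𝒟 (fun D v => fapp (s D v) (t D v)) :=
  DT.sUnion (DT.sep (R := fun D x v => ZFSet.pair (t D v) x ∈ s D v) hs.sUnion.sUnion
    (Df.pair_mem ht.succ (DT.var 0) hs.succ))

theorem DT.congr (hs : DT 𝒟 s) (e : ∀ D ∈ 𝒟, TrC D → ∀ v : ℕ → ZFSet.{u},
    (∀ n, v n ∈ D) → s D v = t D v) : DT 𝒟 t :=
  ⟨hs.mem.congr fun D hD hT v hv => by rw [e D hD hT _ fun n => hv _],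
    fun D hD hT v hv => e D hD hT v hv ▸ hs.sub D hD hT v hv⟩

theorem DT.tail (hs : DT 𝒟 s) (ht : DT 𝒟 t) : DT 𝒟 (fun D v => tailSet (s D v) (t D v)) :=
  DT.sep (R := fun D x v => x ∉ t D v) hs (Df.mem (DT.var 0) ht.succ).not

theorem DT.compl (hs : DT 𝒟 s) (ht : DT 𝒟 t) : DT 𝒟 (fun D v => compl (s D v) (t D v)) :=
  DT.sep (R := fun D x v => x ∉ t D v) hs (Df.mem (DT.var 0) ht.succ).not

theorem Df.sat (φ : Fml) : ∀ (τ : ℕ → Set ZFSet.{u} → (ℕ → ZFSet.{u}) → ZFSet.{u}),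
    (∀ n, DT 𝒟 (τ n)) → Df 𝒟 (fun D v => Sat D φ (fun n => τ n D v)) := by
  induction φ with
  | mem i j => intro τ hτ; exact Df.mem (hτ i) (hτ j)
  | eq i j => intro τ hτ; exact Df.eq (hτ i) (hτ j)
  | impl φ ψ h1 h2 => intro τ hτ; exact (h1 τ hτ).imp (h2 τ hτ)
  | neg φ h1 => intro τ hτ; exact (h1 τ hτ).not
  | all m φ h1 =>
    intro τ hτ
    refine Df.all (R := fun D x v => Sat D φ (Function.update (fun n => τ n D v) m x)) ?_
    have := h1 (fun n D v => if n = m then v 0 else τ n D (fun i => v (i+1))) (fun n => by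
      by_cases h : n = m
      · simp only [h, if_true]; exact DT.var 0
      · simp only [h, if_false]; exact (hτ n).succ)
    refine this.congr fun D _ _ v _ => ?_
    have : (fun n => if n = m then v 0 else τ n D (fun i => v (i+1))) =
      Function.update (fun n => τ n D fun i => v (i + 1)) m (v 0) := by
      ext1 n; by_cases h : n = m <;> simp [h]
    rw [this]

end rules

end

section

/-! ### Set-coded functions -/

theorem fapp_eq {f a b : ZFSet.{u}} (h : ZFSet.pair a b ∈ f)
    (hu : ∀ c, ZFSet.pair a c ∈ f → c = b) : fapp f a = b := by
  ext z
  simp only [fapp, ZFSet.mem_sUnion, ZFSet.mem_sep]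
  constructor
  · rintro ⟨c, ⟨_, hc⟩, hz⟩; rwa [hu c hc] at hz
  · intro hz
    exact ⟨b, ⟨⟨{a, b}, ⟨_, h, by simp [ZFSet.pair]⟩, by simp⟩, h⟩, hz⟩

theorem IsZFunc.pair_mem {d f a : ZFSet.{u}} (h : IsZFunc d f) (ha : a ∈ d) :
    ZFSet.pair a (fapp f a) ∈ f := by
  obtain ⟨b, hb, hu⟩ := h.2 a ha
  rw [fapp_eq hb hu]; exact hb

theorem IsZFunc.eq {d f a b : ZFSet.{u}} (h : IsZFunc d f) (hp : ZFSet.pair a b ∈ f) :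
    fapp f a = b := by
  obtain ⟨a', ha, b', e⟩ := h.1 _ hp
  obtain ⟨rfl, rfl⟩ := ZFSet.pair_inj.1 e
  exact (h.2 a ha).unique (h.pair_mem ha) hp

theorem IsZFunc.dom {d f a b : ZFSet.{u}} (h : IsZFunc d f) (hp : ZFSet.pair a b ∈ f) :
    a ∈ d := by
  obtain ⟨a', ha, b', e⟩ := h.1 _ hp
  obtain ⟨rfl, rfl⟩ := ZFSet.pair_inj.1 e
  exact ha

@[simp] theorem memTS {x M : ZFSet.{u}} : x ∈ M.toSet ↔ x ∈ M := Iff.rfl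

instance smallTS (d : ZFSet.{u}) : Small.{u} d.toSet :=
  inferInstanceAs (Small.{u} d)

/-- image of a set under an external function -/
def img (d : ZFSet.{u}) (F : ZFSet.{u} → ZFSet.{u}) : ZFSet.{u} :=
  ZFSet.range (fun a : Shrink.{u} d.toSet => F ((equivShrink d.toSet).symm a).1)

theorem mem_img {d y : ZFSet.{u}} {F : ZFSet.{u} → ZFSet.{u}} :
    y ∈ img d F ↔ ∃ x ∈ d, F x = y := by
  simp only [img, ZFSet.mem_range, Set.mem_range]
  constructor
  · rintro ⟨a, rfl⟩; exact ⟨_, ((equivShrink d.toSet).symm a).2, rfl⟩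
  · rintro ⟨x, hx, rfl⟩; exact ⟨equivShrink d.toSet ⟨x, hx⟩, by simp⟩

/-- external function coded as a set -/
def lam (d : ZFSet.{u}) (F : ZFSet.{u} → ZFSet.{u}) : ZFSet.{u} :=
  img d (fun a => ZFSet.pair a (F a))

theorem mem_lam {d p : ZFSet.{u}} {F : ZFSet.{u} → ZFSet.{u}} :
    p ∈ lam d F ↔ ∃ x ∈ d, ZFSet.pair x (F x) = p := mem_img

theorem pair_mem_lam {d a b : ZFSet.{u}} {F : ZFSet.{u} → ZFSet.{u}} :
    ZFSet.pair a b ∈ lam d F ↔ a ∈ d ∧ F a = b := by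
  rw [mem_lam]
  constructor
  · rintro ⟨x, hx, e⟩
    obtain ⟨rfl, rfl⟩ := ZFSet.pair_inj.1 e
    exact ⟨hx, rfl⟩
  · rintro ⟨h, rfl⟩; exact ⟨a, h, rfl⟩

theorem isZFunc_lam (d : ZFSet.{u}) (F : ZFSet.{u} → ZFSet.{u}) : IsZFunc d (lam d F) := by
  refine ⟨fun p hp => ?_, fun a ha => ⟨F a, pair_mem_lam.2 ⟨ha, rfl⟩, fun b hb => ?_⟩⟩
  · obtain ⟨x, hx, rfl⟩ := mem_lam.1 hp
    exact ⟨x, hx, _, rfl⟩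
  · exact (pair_mem_lam.1 hb).2.symm

theorem fapp_lam {d a : ZFSet.{u}} {F : ZFSet.{u} → ZFSet.{u}} (ha : a ∈ d) :
    fapp (lam d F) a = F a :=
  (isZFunc_lam d F).eq (pair_mem_lam.2 ⟨ha, rfl⟩)

theorem IsZFunc.eq_lam {d f : ZFSet.{u}} (h : IsZFunc d f) : f = lam d (fapp f) := by
  ext p
  rw [mem_lam]
  constructor
  · intro hp
    obtain ⟨a, ha, b, rfl⟩ := h.1 p hp
    exact ⟨a, ha, by rw [h.eq hp]⟩
  · rintro ⟨a, ha, rfl⟩; exact h.pair_mem ha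

theorem IsZFunc.ext {d f g : ZFSet.{u}} (h : IsZFunc d f) (h' : IsZFunc d g)
    (e : ∀ a ∈ d, fapp f a = fapp g a) : f = g := by
  rw [h.eq_lam, h'.eq_lam]
  ext p
  simp only [mem_lam]
  exact exists_congr fun a => and_congr_right fun ha => by rw [e a ha]

theorem mem_UU_of_pair {f a b : ZFSet.{u}} (h : ZFSet.pair a b ∈ f) :
    b ∈ (⋃₀ (⋃₀ f : ZFSet) : ZFSet) ∧ a ∈ (⋃₀ (⋃₀ f : ZFSet) : ZFSet) := by
  constructor <;> rw [ZFSet.mem_sUnion]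
  · exact ⟨{a, b}, ZFSet.mem_sUnion.2 ⟨_, h, by simp [ZFSet.pair]⟩, by simp⟩
  · exact ⟨{a, b}, ZFSet.mem_sUnion.2 ⟨_, h, by simp [ZFSet.pair]⟩, by simp⟩

theorem isZFunc_iff {d f : ZFSet.{u}} : IsZFunc d f ↔
    (∀ p ∈ f, ∃ a ∈ d, ∃ b ∈ (⋃₀ (⋃₀ f : ZFSet) : ZFSet), p = ZFSet.pair a b) ∧
    ∀ a ∈ d, ∃ b ∈ (⋃₀ (⋃₀ f : ZFSet) : ZFSet), ZFSet.pair a b ∈ f ∧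
      ∀ c ∈ (⋃₀ (⋃₀ f : ZFSet) : ZFSet), ZFSet.pair a c ∈ f → c = b := by
  constructor
  · rintro ⟨h1, h2⟩
    refine ⟨fun p hp => ?_, fun a ha => ?_⟩
    · obtain ⟨a, ha, b, rfl⟩ := h1 p hp
      exact ⟨a, ha, b, (mem_UU_of_pair hp).1, rfl⟩
    · obtain ⟨b, hb, hu⟩ := h2 a ha
      exact ⟨b, (mem_UU_of_pair hb).1, hb, fun c _ hc => hu c hc⟩
  · rintro ⟨h1, h2⟩
    refine ⟨fun p hp => ?_, fun a ha => ?_⟩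
    · obtain ⟨a, ha, b, _, rfl⟩ := h1 p hp
      exact ⟨a, ha, b, rfl⟩
    · obtain ⟨b, _, hb, hu⟩ := h2 a ha
      exact ⟨b, hb, fun c hc => hu c (mem_UU_of_pair hc).1 hc⟩

theorem Df.isZFunc {𝒟 : Set (Set ZFSet.{u})}
    {s t : Set ZFSet.{u} → (ℕ → ZFSet.{u}) → ZFSet.{u}} (hs : DT 𝒟 s) (ht : DT 𝒟 t) :
    Df 𝒟 (fun D v => IsZFunc (s D v) (t D v)) := by
  have : Df 𝒟 (fun _ v => IsZFunc (v 0) (v 1)) := by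
    simp only [isZFunc_iff]
    (repeat' first | assumption | exact DT.constM (by assumption) | exact DT.var _ | exact DT.empty | apply DT.fapp | apply DT.union | apply DT.inter | apply DT.sUnion | apply DT.tail | apply DT.compl | apply DT.sep | apply DT.constM | apply Df.pair_mem | apply Df.eq_pair | apply Df.mem | apply Df.eq | apply Df.subset | apply Df.and | apply Df.or | apply Df.iff | apply Df.not | apply Df.imp | apply Df.allM | apply Df.exM | apply Df.ball | apply Df.bex | apply Df.all | apply Df.ex | exact Df.prop _)
  simp only [isZFunc_iff]
  have h1 := hs.succ
  have h2 := ht.succ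
  have h3 := hs.succ.succ
  have h4 := ht.succ.succ
  have h5 := ht.succ.succ.succ
  (repeat' first | assumption | exact DT.constM (by assumption) | exact DT.var _ | exact DT.empty | apply DT.fapp | apply DT.union | apply DT.inter | apply DT.sUnion | apply DT.tail | apply DT.compl | apply DT.sep | apply DT.constM | apply Df.pair_mem | apply Df.eq_pair | apply Df.mem | apply Df.eq | apply Df.subset | apply Df.and | apply Df.or | apply Df.iff | apply Df.not | apply Df.imp | apply Df.allM | apply Df.exM | apply Df.ball | apply Df.bex | apply Df.all | apply Df.ex | exact Df.prop _)

/-! ### Basic closure properties of transitive models -/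

section model

variable {M : ZFSet.{u}}

theorem IsTransModel.tr (hM : IsTransModel M) {x y : ZFSet.{u}} (hx : x ∈ M) (hy : y ∈ x) :
    y ∈ M := hM.1 x hx hy

theorem IsTransModel.trC (hM : IsTransModel M) : TrC M.toSet :=
  ⟨fun _ hx _ hy => hM.tr hx hy, ⟨_, hM.2.1⟩⟩

theorem IsTransModel.upair (hM : IsTransModel M) {x y : ZFSet.{u}} (hx : x ∈ M) (hy : y ∈ M) :
    ({x, y} : ZFSet.{u}) ∈ M := hM.2.2.1 x hx y hy

theorem IsTransModel.sing (hM : IsTransModel M) {x : ZFSet.{u}} (hx : x ∈ M) :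
    ({x} : ZFSet.{u}) ∈ M := by
  have : ({x} : ZFSet.{u}) = {x, x} := by ext; simp
  rw [this]; exact hM.upair hx hx

theorem IsTransModel.pair (hM : IsTransModel M) {x y : ZFSet.{u}} (hx : x ∈ M) (hy : y ∈ M) :
    ZFSet.pair x y ∈ M := hM.upair (hM.sing hx) (hM.upair hx hy)

theorem IsTransModel.of_pair (hM : IsTransModel M) {x y : ZFSet.{u}} (h : ZFSet.pair x y ∈ M) :
    x ∈ M ∧ y ∈ M := by
  have : ({x, y} : ZFSet) ∈ M := hM.tr h (by simp [ZFSet.pair])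
  exact ⟨hM.tr this (by simp), hM.tr this (by simp)⟩

theorem IsTransModel.sU (hM : IsTransModel M) {x : ZFSet.{u}} (hx : x ∈ M) :
    (⋃₀ x : ZFSet.{u}) ∈ M := hM.2.2.2.1 x hx

theorem IsTransModel.union (hM : IsTransModel M) {x y : ZFSet.{u}} (hx : x ∈ M) (hy : y ∈ M) :
    x ∪ y ∈ M := by
  have : x ∪ y = (⋃₀ ({x, y} : ZFSet) : ZFSet) := by ext; simp
  rw [this]; exact hM.sU (hM.upair hx hy)

theorem IsTransModel.omega (hM : IsTransModel M) : ZFSet.omega ∈ M := hM.2.1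

theorem IsTransModel.empty (hM : IsTransModel M) : (∅ : ZFSet.{u}) ∈ M :=
  hM.tr hM.omega ZFSet.omega_zero

theorem IsTransModel.sep (hM : IsTransModel M) {P : ZFSet.{u} → Prop} {a : ZFSet.{u}}
    (h : Df {M.toSet} (fun _ v => P (v 0))) (ha : a ∈ M) : ZFSet.sep P a ∈ M := by
  obtain ⟨φ, F, w, h1, h2, h3, h4⟩ := h {n | n % 2 = 0} (fun n => 2 * n)
    (Set.infinite_of_injective_forall_mem (f := fun n => 2 * n + 1)
      (fun a b h => by simpa using h) (fun n => by simp)) (fun n => by simp)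
  rw [Set.disjoint_left] at h2
  obtain ⟨b, hb, hb'⟩ := hM.2.2.2.2.1 φ (fun n => if n ∈ F then w n else a)
    (fun n => by
      by_cases hn : n ∈ F
      · simpa [hn] using h3 _ rfl n hn
      · simpa [hn] using ha) a ha
  have : ZFSet.sep P a = b := by
    ext x
    rw [hb', ZFSet.mem_sep]
    refine and_congr_right fun hx => ?_
    rw [h4 _ rfl hM.trC]
    · simp
    · intro n
      by_cases hn : n = 0
      · subst hn; simpa using hM.tr ha hx
      · by_cases hF : n ∈ F
        · simpa [hn, hF] using h3 _ rfl n hF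
        · simpa [hn, hF] using ha
    · intro n hn
      have : n ≠ 0 := by rintro rfl; exact h2 hn (by simp)
      simp [this, hn]
  rw [this]; exact hb

theorem IsTransModel.coll (hM : IsTransModel M) {P : ZFSet.{u} → ZFSet.{u} → Prop} {a : ZFSet.{u}}
    (h : Df {M.toSet} (fun _ v => P (v 0) (v 1))) (ha : a ∈ M)
    (hP : ∀ x ∈ a, ∃ y ∈ M, P x y) : ∃ b ∈ M, ∀ x ∈ a, ∃ y ∈ b, P x y := by
  obtain ⟨φ, F, w, h1, h2, h3, h4⟩ := h {n | n = 0 ∨ n % 2 = 1}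
    (fun n => if n = 0 then 0 else 2 * n - 1)
    (Set.infinite_of_injective_forall_mem (f := fun n => 2 * n + 2)
      (fun a b h => by simpa using h) (fun n => by simp))
      (fun n => by by_cases h : n = 0 <;> simp [h]; omega)
  rw [Set.disjoint_left] at h2
  have h00 : 0 ∉ F := fun h => h2 h (by simp)
  have h11 : 1 ∉ F := fun h => h2 h (by simp)
  set v : ℕ → ZFSet := (fun n => if n ∈ F then w n else a) with hv
  have hvM : ∀ n, v n ∈ M := fun n => by
      by_cases hn : n ∈ F
      · simpa [hv, hn] using h3 _ rfl n hn
      · simpa [hv, hn] using ha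
  have key : ∀ x ∈ a, ∀ y ∈ M, (Sat M.toSet φ (Function.update (Function.update v 0 x) 1 y) ↔
      P x y) := by
    intro x hx y hy
    rw [h4 _ rfl hM.trC]
    · simp
    · intro n
      by_cases hn : n = 1
      · subst hn; simpa using hy
      by_cases hn' : n = 0
      · subst hn'; simpa using hM.tr ha hx
      simpa [hn, hn'] using hvM n
    · intro n hn
      have e1 : n ≠ 1 := by rintro rfl; exact h11 hn
      have e2 : n ≠ 0 := by rintro rfl; exact h00 hn
      simp [e1, e2, hv, hn]
  obtain ⟨b, hb, hb'⟩ := hM.2.2.2.2.2.1 φ v hvM a ha (by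
    intro x hx
    obtain ⟨y, hy, h⟩ := hP x hx
    exact ⟨y, hy, (key x hx y hy).2 h⟩)
  refine ⟨b, hb, fun x hx => ?_⟩
  obtain ⟨y, hy, h⟩ := hb' x hx
  exact ⟨y, hy, (key x hx y (hM.tr hb hy)).1 h⟩

theorem IsTransModel.fapp (hM : IsTransModel M) {f a : ZFSet.{u}} (hf : f ∈ M) (ha : a ∈ M) :
    fapp f a ∈ M :=
  hM.sU (hM.sep (P := fun b => ZFSet.pair a b ∈ f) (by (repeat' first | assumption | exact DT.constM (by assumption) | exact DT.var _ | exact DT.empty | apply DT.fapp | apply DT.union | apply DT.inter | apply DT.sUnion | apply DT.tail | apply DT.compl | apply DT.sep | apply DT.constM | apply Df.pair_mem | apply Df.eq_pair | apply Df.mem | apply Df.eq | apply Df.subset | apply Df.and | apply Df.or | apply Df.iff | apply Df.not | apply Df.imp | apply Df.allM | apply Df.exM | apply Df.ball | apply Df.bex | apply Df.all | apply Df.ex | exact Df.prop _)) (hM.sU (hM.sU hf)))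

theorem IsTransModel.inter (hM : IsTransModel M) {x y : ZFSet.{u}} (hx : x ∈ M) (hy : y ∈ M) :
    x ∩ y ∈ M := hM.sep (P := fun z => z ∈ y) (by (repeat' first | assumption | exact DT.constM (by assumption) | exact DT.var _ | exact DT.empty | apply DT.fapp | apply DT.union | apply DT.inter | apply DT.sUnion | apply DT.tail | apply DT.compl | apply DT.sep | apply DT.constM | apply Df.pair_mem | apply Df.eq_pair | apply Df.mem | apply Df.eq | apply Df.subset | apply Df.and | apply Df.or | apply Df.iff | apply Df.not | apply Df.imp | apply Df.allM | apply Df.exM | apply Df.ball | apply Df.bex | apply Df.all | apply Df.ex | exact Df.prop _)) hx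

theorem IsTransModel.compl (hM : IsTransModel M) {x y : ZFSet.{u}} (hx : x ∈ M) (hy : y ∈ M) :
    compl x y ∈ M := hM.sep (P := fun z => z ∉ y) (by (repeat' first | assumption | exact DT.constM (by assumption) | exact DT.var _ | exact DT.empty | apply DT.fapp | apply DT.union | apply DT.inter | apply DT.sUnion | apply DT.tail | apply DT.compl | apply DT.sep | apply DT.constM | apply Df.pair_mem | apply Df.eq_pair | apply Df.mem | apply Df.eq | apply Df.subset | apply Df.and | apply Df.or | apply Df.iff | apply Df.not | apply Df.imp | apply Df.allM | apply Df.exM | apply Df.ball | apply Df.bex | apply Df.all | apply Df.ex | exact Df.prop _)) hx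

theorem IsTransModel.tail (hM : IsTransModel M) {x y : ZFSet.{u}} (hx : x ∈ M) (hy : y ∈ M) :
    tailSet x y ∈ M := hM.compl hx hy

theorem IsTransModel.img (hM : IsTransModel M) {a : ZFSet.{u}} {F : ZFSet.{u} → ZFSet.{u}}
    (h : Df {M.toSet} (fun _ v => v 1 = F (v 0))) (ha : a ∈ M)
    (hF : ∀ x ∈ a, F x ∈ M) : img a F ∈ M := by
  obtain ⟨b, hb, hb'⟩ := hM.coll (P := fun x y => y = F x) h ha
    (fun x hx => ⟨_, hF x hx, rfl⟩)
  have : MPaper.img a F = ZFSet.sep (fun y => ∃ x ∈ a, y = F x) b := by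
    ext y
    rw [mem_img, ZFSet.mem_sep]
    constructor
    · rintro ⟨x, hx, rfl⟩
      obtain ⟨y, hy, e⟩ := hb' x hx
      exact ⟨e ▸ hy, x, hx, rfl⟩
    · rintro ⟨_, x, hx, e⟩; exact ⟨x, hx, e.symm⟩
  rw [this]
  refine hM.sep ?_ hb
  have h' : Df {M.toSet} (fun _ v => v 1 = F (v 0)) := h
  apply Df.bex (DT.constM ha)
  exact h'

theorem IsTransModel.lam (hM : IsTransModel M) {a : ZFSet.{u}} {F : ZFSet.{u} → ZFSet.{u}}
    (h : Df {M.toSet} (fun _ v => v 1 = F (v 0))) (ha : a ∈ M)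
    (hF : ∀ x ∈ a, F x ∈ M) : lam a F ∈ M := by
  refine hM.img (F := fun x => ZFSet.pair x (F x)) ?_ ha
    (fun x hx => hM.pair (hM.tr ha hx) (hF x hx))
  have : Df {M.toSet} (fun _ v => ∃ y ∈ M, v 1 = ZFSet.pair (v 0) y ∧ y = F (v 0)) := by
    apply Df.exM
    apply Df.and
    · (repeat' first | assumption | exact DT.constM (by assumption) | exact DT.var _ | exact DT.empty | apply DT.fapp | apply DT.union | apply DT.inter | apply DT.sUnion | apply DT.tail | apply DT.compl | apply DT.sep | apply DT.constM | apply Df.pair_mem | apply Df.eq_pair | apply Df.mem | apply Df.eq | apply Df.subset | apply Df.and | apply Df.or | apply Df.iff | apply Df.not | apply Df.imp | apply Df.allM | apply Df.exM | apply Df.ball | apply Df.bex | apply Df.all | apply Df.ex | exact Df.prop _)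
    · exact h.shift (fun n => if n = 0 then 1 else 0)
  refine this.congr ?_
  rintro D rfl hT v hv
  constructor
  · rintro ⟨y, hy, e, rfl⟩; exact e
  · intro e
    refine ⟨F (v 0), ?_, e, rfl⟩
    have : v 1 ∈ M := hv 1
    rw [e] at this
    exact (hM.of_pair this).2

theorem IsTransModel.prod (hM : IsTransModel M) {a b : ZFSet.{u}} (ha : a ∈ M) (hb : b ∈ M) :
    a.prod b ∈ M := by
  have h1 : ∀ x ∈ a, MPaper.img b (fun y => ZFSet.pair x y) ∈ M := fun x hx => by
    have hx' := hM.tr ha hx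
    refine hM.img (by (repeat' first | assumption | exact DT.constM (by assumption) | exact DT.var _ | exact DT.empty | apply DT.fapp | apply DT.union | apply DT.inter | apply DT.sUnion | apply DT.tail | apply DT.compl | apply DT.sep | apply DT.constM | apply Df.pair_mem | apply Df.eq_pair | apply Df.mem | apply Df.eq | apply Df.subset | apply Df.and | apply Df.or | apply Df.iff | apply Df.not | apply Df.imp | apply Df.allM | apply Df.exM | apply Df.ball | apply Df.bex | apply Df.all | apply Df.ex | exact Df.prop _)) hb (fun y hy => hM.pair hx' (hM.tr hb hy))
  have h2 : MPaper.img a (fun x => MPaper.img b (fun y => ZFSet.pair x y)) ∈ M := by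
    refine hM.img ?_ ha h1
    have : Df {M.toSet} (fun _ v => (∀ z ∈ v 1, ∃ y ∈ b, z = ZFSet.pair (v 0) y) ∧
      ∀ y ∈ b, ZFSet.pair (v 0) y ∈ v 1) := by (repeat' first | assumption | exact DT.constM (by assumption) | exact DT.var _ | exact DT.empty | apply DT.fapp | apply DT.union | apply DT.inter | apply DT.sUnion | apply DT.tail | apply DT.compl | apply DT.sep | apply DT.constM | apply Df.pair_mem | apply Df.eq_pair | apply Df.mem | apply Df.eq | apply Df.subset | apply Df.and | apply Df.or | apply Df.iff | apply Df.not | apply Df.imp | apply Df.allM | apply Df.exM | apply Df.ball | apply Df.bex | apply Df.all | apply Df.ex | exact Df.prop _)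
    refine this.congr ?_
    rintro D rfl hT v hv
    constructor
    · rintro ⟨h1, h2⟩
      ext z
      rw [mem_img]
      constructor
      · intro hz; obtain ⟨y, hy, rfl⟩ := h1 z hz; exact ⟨y, hy, rfl⟩
      · rintro ⟨y, hy, rfl⟩; exact h2 y hy
    · intro e; rw [e]; simp only [mem_img]
      exact ⟨fun z ⟨y, hy, e⟩ => ⟨y, hy, e.symm⟩, fun y hy => ⟨y, hy, rfl⟩⟩
  have : a.prod b = (⋃₀ (MPaper.img a (fun x => MPaper.img b (fun y => ZFSet.pair x y))) : ZFSet) := by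
    ext z
    simp only [ZFSet.mem_prod, ZFSet.mem_sUnion, mem_img]
    constructor
    · rintro ⟨x, hx, y, hy, rfl⟩; exact ⟨_, ⟨x, hx, rfl⟩, mem_img.2 ⟨y, hy, rfl⟩⟩
    · rintro ⟨_, ⟨x, hx, rfl⟩, h⟩
      obtain ⟨y, hy, rfl⟩ := mem_img.1 h
      exact ⟨x, hx, y, hy, rfl⟩
  rw [this]; exact hM.sU h2

theorem IsTransModel.choice (hM : IsTransModel M) {a : ZFSet.{u}}
    {P : ZFSet.{u} → ZFSet.{u} → Prop}
    (h : Df {M.toSet} (fun _ v => P (v 0) (v 1))) (ha : a ∈ M)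
    (hP : ∀ x ∈ a, ∃ y ∈ M, P x y) :
    ∃ f ∈ M, IsZFunc a f ∧ ∀ x ∈ a, P x (MPaper.fapp f x) := by
  obtain ⟨b, hb, hb'⟩ := hM.coll h ha hP
  obtain ⟨r, hr, -, h2, -, h4, h5⟩ := hM.2.2.2.2.2.2 b hb
  have hm : ∀ x ∈ a, ∃ y ∈ b, P x y ∧ ∀ y' ∈ b, P x y' → ZFSet.pair y' y ∉ r := by
    intro x hx
    obtain ⟨y, hy, h⟩ := h5 {y | y ∈ b ∧ P x y} (fun y hy => hy.1) (hb' x hx)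
    exact ⟨y, hy.1, hy.2, fun y' hy' hp => h y' ⟨hy', hp⟩⟩
  choose! F hF using hm
  refine ⟨MPaper.lam a F, ?_, isZFunc_lam _ _, fun x hx => ?_⟩
  · have e : MPaper.lam a F = MPaper.lam a (fun x => if x ∈ a then F x else ∅) := by
      ext p; simp only [mem_lam]
      exact exists_congr fun x => and_congr_right fun hx => by simp [hx]
    rw [e]
    refine hM.lam ?_ ha (fun x hx => by simpa [hx] using hM.tr hb (hF x hx).1)
    have hQ : Df {M.toSet} (fun _ v => ∀ y' ∈ b, P (v 0) y' → ZFSet.pair y' (v 1) ∉ r) := by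
      apply Df.ball (DT.constM hb)
      apply Df.imp
      · exact h.shift (fun n => if n = 0 then 1 else 0)
      · (repeat' first | assumption | exact DT.constM (by assumption) | exact DT.var _ | exact DT.empty | apply DT.fapp | apply DT.union | apply DT.inter | apply DT.sUnion | apply DT.tail | apply DT.compl | apply DT.sep | apply DT.constM | apply Df.pair_mem | apply Df.eq_pair | apply Df.mem | apply Df.eq | apply Df.subset | apply Df.and | apply Df.or | apply Df.iff | apply Df.not | apply Df.imp | apply Df.allM | apply Df.exM | apply Df.ball | apply Df.bex | apply Df.all | apply Df.ex | exact Df.prop _)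
    have : Df {M.toSet} (fun _ v => (v 0 ∈ a ∧ v 1 ∈ b ∧ P (v 0) (v 1) ∧
      ∀ y' ∈ b, P (v 0) y' → ZFSet.pair y' (v 1) ∉ r) ∨ v 0 ∉ a ∧ v 1 = ∅) := by
      (repeat' first | assumption | exact DT.constM (by assumption) | exact DT.var _ | exact DT.empty | apply DT.fapp | apply DT.union | apply DT.inter | apply DT.sUnion | apply DT.tail | apply DT.compl | apply DT.sep | apply DT.constM | apply Df.pair_mem | apply Df.eq_pair | apply Df.mem | apply Df.eq | apply Df.subset | apply Df.and | apply Df.or | apply Df.iff | apply Df.not | apply Df.imp | apply Df.allM | apply Df.exM | apply Df.ball | apply Df.bex | apply Df.all | apply Df.ex | exact Df.prop _)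
    refine this.congr ?_
    rintro D rfl hT v hv
    by_cases hx : v 0 ∈ a
    · simp only [hx, true_and, not_true, false_and, or_false, if_true]
      constructor
      · rintro ⟨k1, k2, k3⟩
        obtain ⟨l1, l2, l3⟩ := hF _ hx
        rcases h2 _ k1 _ l1 with e | e | e
        · exact e
        · exact absurd e (l3 _ k1 k2)
        · exact absurd e (k3 _ l1 l2)
      · intro e; rw [e]; exact hF _ hx
    · simp [hx]
  · rw [fapp_lam hx]; exact (hF x hx).2.1

end model

end

section

/-! ### Mostowski collapse inside transitive models -/

/-- relation on `X` coded by `E` -/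
def mrel (X E q p : ZFSet.{u}) : Prop := q ∈ X ∧ p ∈ X ∧ ZFSet.pair q p ∈ E

/-- the Mostowski collapse -/
def mcol {X E : ZFSet.{u}} (wf : WellFounded (mrel X E)) : ZFSet.{u} → ZFSet.{u} :=
  wf.fix (fun p ih => img (ZFSet.sep (fun q => mrel X E q p) X)
    (fun q => if h : mrel X E q p then ih q h else ∅))

theorem mem_mcol {X E : ZFSet.{u}} (wf : WellFounded (mrel X E)) {p z : ZFSet.{u}} :
    z ∈ mcol wf p ↔ ∃ q, mrel X E q p ∧ mcol wf q = z := by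
  have : mcol wf p = img (ZFSet.sep (fun q => mrel X E q p) X)
    (fun q => if h : mrel X E q p then mcol wf q else ∅) := by
    rw [mcol, WellFounded.fix_eq]
  rw [this, mem_img]
  constructor
  · rintro ⟨q, hq, e⟩
    have := (ZFSet.mem_sep.1 hq).2
    rw [dif_pos this] at e
    exact ⟨q, this, e⟩
  · rintro ⟨q, hq, e⟩
    exact ⟨q, ZFSet.mem_sep.2 ⟨hq.1, hq⟩, by rw [dif_pos hq, e]⟩

/-- partial collapses -/
def MGood (X E f : ZFSet.{u}) : Prop :=
  ∀ p ∈ f, ∃ q ∈ X, ∃ z ∈ (⋃₀ (⋃₀ f : ZFSet) : ZFSet), p = ZFSet.pair q z ∧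
    (∀ q' ∈ X, ZFSet.pair q' q ∈ E → ∃ z' ∈ z, ZFSet.pair q' z' ∈ f) ∧
    (∀ z' ∈ z, ∃ q' ∈ X, ZFSet.pair q' q ∈ E ∧ ZFSet.pair q' z' ∈ f)

theorem MGood.eq {X E f : ZFSet.{u}} (wf : WellFounded (mrel X E)) (h : MGood X E f) :
    ∀ q z, ZFSet.pair q z ∈ f → z = mcol wf q := by
  intro q
  induction q using wf.induction with
  | _ q ih =>
    intro z hz
    obtain ⟨q1, hq, z1, -, e, h1, h2⟩ := h _ hz
    obtain ⟨rfl, rfl⟩ := ZFSet.pair_inj.1 e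
    ext w
    rw [mem_mcol]
    constructor
    · intro hw
      obtain ⟨q', hq', hE, hf⟩ := h2 w hw
      exact ⟨q', ⟨hq', hq, hE⟩, (ih q' ⟨hq', hq, hE⟩ w hf).symm⟩
    · rintro ⟨q', hr, rfl⟩
      obtain ⟨z', hz', hf⟩ := h1 q' hr.1 hr.2.2
      rw [← ih q' hr z' hf]; exact hz'

theorem MGood.sUnion {X E b : ZFSet.{u}} (h : ∀ f ∈ b, MGood X E f) :
    MGood X E (⋃₀ b : ZFSet) := by
  intro p hp
  obtain ⟨f, hf, hpf⟩ := ZFSet.mem_sUnion.1 hp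
  obtain ⟨q, hq, z, hz, rfl, h1, h2⟩ := h f hf p hpf
  refine ⟨q, hq, z, (mem_UU_of_pair hp).1, rfl, fun q' hq' hE => ?_, fun z' hz' => ?_⟩
  · obtain ⟨z', hz', h⟩ := h1 q' hq' hE
    exact ⟨z', hz', ZFSet.mem_sUnion.2 ⟨f, hf, h⟩⟩
  · obtain ⟨q', hq', hE, h⟩ := h2 z' hz'
    exact ⟨q', hq', hE, ZFSet.mem_sUnion.2 ⟨f, hf, h⟩⟩

theorem df_mgood {M X E : ZFSet.{u}} (hX : X ∈ M) (hE : E ∈ M)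
    {t : Set ZFSet.{u} → (ℕ → ZFSet.{u}) → ZFSet.{u}} (ht : DT {M.toSet} t) :
    Df {M.toSet} (fun D v => MGood X E (t D v)) := by
  have h1 := ht.succ
  have h2 := ht.succ.succ
  have h3 := ht.succ.succ.succ
  have h4 := ht.succ.succ.succ.succ
  have h5 := ht.succ.succ.succ.succ.succ
  unfold MGood
  (repeat' first | assumption | exact DT.constM (by assumption) | exact DT.var _ | exact DT.empty | apply DT.fapp | apply DT.union | apply DT.inter | apply DT.sUnion | apply DT.tail | apply DT.compl | apply DT.sep | apply DT.constM | apply Df.pair_mem | apply Df.eq_pair | apply Df.mem | apply Df.eq | apply Df.subset | apply Df.and | apply Df.or | apply Df.iff | apply Df.not | apply Df.imp | apply Df.allM | apply Df.exM | apply Df.ball | apply Df.bex | apply Df.all | apply Df.ex | exact Df.prop _)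

theorem mostowski {M X E : ZFSet.{u}} (hM : IsTransModel M) (hX : X ∈ M) (hE : E ∈ M)
    (wf : WellFounded (mrel X E)) : lam X (mcol wf) ∈ M := by
  have hdf : Df {M.toSet} (fun _ v => MGood X E (v 1) ∧ ∃ z ∈ M, ZFSet.pair (v 0) z ∈ v 1) :=
    (df_mgood hX hE (DT.var 1)).and (by (repeat' first | assumption | exact DT.constM (by assumption) | exact DT.var _ | exact DT.empty | apply DT.fapp | apply DT.union | apply DT.inter | apply DT.sUnion | apply DT.tail | apply DT.compl | apply DT.sep | apply DT.constM | apply Df.pair_mem | apply Df.eq_pair | apply Df.mem | apply Df.eq | apply Df.subset | apply Df.and | apply Df.or | apply Df.iff | apply Df.not | apply Df.imp | apply Df.allM | apply Df.exM | apply Df.ball | apply Df.bex | apply Df.all | apply Df.ex | exact Df.prop _))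
  have hdf0 : Df {M.toSet} (fun _ v => MGood X E (v 0)) := df_mgood hX hE (DT.var 0)
  have comb : ∀ a ∈ M, (∀ q ∈ a, ∃ f ∈ M, MGood X E f ∧ ∃ z ∈ M, ZFSet.pair q z ∈ f) →
      ∃ g ∈ M, MGood X E g ∧ ∀ q ∈ a, ∃ z ∈ M, ZFSet.pair q z ∈ g := by
    intro a ha h
    obtain ⟨b, hb, hb'⟩ := hM.coll (P := fun q f => MGood X E f ∧ ∃ z ∈ M, ZFSet.pair q z ∈ f)
      hdf ha h
    refine ⟨⋃₀ (ZFSet.sep (fun f => MGood X E f) b), hM.sU (hM.sep hdf0 hb),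
      MGood.sUnion fun f hf => (ZFSet.mem_sep.1 hf).2, fun q hq => ?_⟩
    obtain ⟨f, hf, hg, z, hz, hp⟩ := hb' q hq
    exact ⟨z, hz, ZFSet.mem_sUnion.2 ⟨f, ZFSet.mem_sep.2 ⟨hf, hg⟩, hp⟩⟩
  have main : ∀ p, p ∈ X → ∃ f ∈ M, MGood X E f ∧ ∃ z ∈ M, ZFSet.pair p z ∈ f := by
    intro p
    induction p using wf.induction with
    | _ p ih =>
      intro hp
      have hpM := hM.tr hX hp
      obtain ⟨g, hg, hgood, hgq⟩ := comb (ZFSet.sep (fun q => ZFSet.pair q p ∈ E) X)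
        (hM.sep (by (repeat' first | assumption | exact DT.constM (by assumption) | exact DT.var _ | exact DT.empty | apply DT.fapp | apply DT.union | apply DT.inter | apply DT.sUnion | apply DT.tail | apply DT.compl | apply DT.sep | apply DT.constM | apply Df.pair_mem | apply Df.eq_pair | apply Df.mem | apply Df.eq | apply Df.subset | apply Df.and | apply Df.or | apply Df.iff | apply Df.not | apply Df.imp | apply Df.allM | apply Df.exM | apply Df.ball | apply Df.bex | apply Df.all | apply Df.ex | exact Df.prop _)) hX) (fun q hq => by
          obtain ⟨h1, h2⟩ := ZFSet.mem_sep.1 hq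
          exact ih q ⟨h1, hp, h2⟩ h1)
      have hz : ZFSet.sep (fun z' => ∃ q ∈ X, ZFSet.pair q p ∈ E ∧ ZFSet.pair q z' ∈ g)
        (⋃₀ (⋃₀ g : ZFSet) : ZFSet) ∈ M := hM.sep (by (repeat' first | assumption | exact DT.constM (by assumption) | exact DT.var _ | exact DT.empty | apply DT.fapp | apply DT.union | apply DT.inter | apply DT.sUnion | apply DT.tail | apply DT.compl | apply DT.sep | apply DT.constM | apply Df.pair_mem | apply Df.eq_pair | apply Df.mem | apply Df.eq | apply Df.subset | apply Df.and | apply Df.or | apply Df.iff | apply Df.not | apply Df.imp | apply Df.allM | apply Df.exM | apply Df.ball | apply Df.bex | apply Df.all | apply Df.ex | exact Df.prop _)) (hM.sU (hM.sU hg))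
      set z := ZFSet.sep (fun z' => ∃ q ∈ X, ZFSet.pair q p ∈ E ∧ ZFSet.pair q z' ∈ g)
        (⋃₀ (⋃₀ g : ZFSet) : ZFSet) with hzdef
      refine ⟨g ∪ {ZFSet.pair p z}, hM.union hg (hM.sing (hM.pair hpM hz)), ?_, z, hz, by simp⟩
      intro r hr
      rcases ZFSet.mem_union.1 hr with hr' | hr'
      · obtain ⟨q, hq, w, hw, rfl, h1, h2⟩ := hgood r hr'
        refine ⟨q, hq, w, (mem_UU_of_pair hr).1, rfl, fun q' hq' hE => ?_, fun z' hz' => ?_⟩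
        · obtain ⟨z', hz', h⟩ := h1 q' hq' hE
          exact ⟨z', hz', ZFSet.mem_union.2 (Or.inl h)⟩
        · obtain ⟨q', hq', hE, h⟩ := h2 z' hz'
          exact ⟨q', hq', hE, ZFSet.mem_union.2 (Or.inl h)⟩
      · rw [ZFSet.mem_singleton] at hr'
        subst hr'
        refine ⟨p, hp, z, (mem_UU_of_pair hr).1, rfl, fun q' hq' hE => ?_, fun z' hz' => ?_⟩
        · obtain ⟨z', _, h⟩ := hgq q' (ZFSet.mem_sep.2 ⟨hq', hE⟩)
          exact ⟨z', ZFSet.mem_sep.2 ⟨(mem_UU_of_pair h).1, q', hq', hE, h⟩,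
            ZFSet.mem_union.2 (Or.inl h)⟩
        · obtain ⟨q', hq', hE, h⟩ := (ZFSet.mem_sep.1 hz').2
          exact ⟨q', hq', hE, ZFSet.mem_union.2 (Or.inl h)⟩
  obtain ⟨g, hg, hgood, hgq⟩ := comb X hX main
  have : lam X (mcol wf) = g := by
    ext p
    rw [mem_lam]
    constructor
    · rintro ⟨q, hq, rfl⟩
      obtain ⟨z, _, hz⟩ := hgq q hq
      rwa [← hgood.eq wf q z hz]
    · intro hp
      obtain ⟨q, hq, z, _, rfl, _⟩ := hgood p hp
      exact ⟨q, hq, by rw [hgood.eq wf q z hp]⟩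
  rw [this]; exact hg

/-! ### Ordinals, infinite cardinals -/

theorem IsOrd.ord {x : ZFSet.{u}} (h : IsOrd x) : x.IsOrdinal :=
  ZFSet.isOrdinal_iff_forall_mem_isTransitive.2 h

theorem isOrd_iff {x : ZFSet.{u}} : IsOrd x ↔ x.IsOrdinal :=
  ZFSet.isOrdinal_iff_forall_mem_isTransitive.symm

theorem zcard_mono {x y : ZFSet.{u}} (h : x ⊆ y) : zcard x ≤ zcard y :=
  Cardinal.mk_le_mk_of_subset (fun _ hz => h hz)

theorem zcard_img_le (d : ZFSet.{u}) (F : ZFSet.{u} → ZFSet.{u}) : zcard (img d F) ≤ zcard d := by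
  have : Function.Surjective (fun a : d.toSet => (⟨F a.1, mem_img.2 ⟨a.1, a.2, rfl⟩⟩ : (img d F).toSet)) := by
    rintro ⟨y, hy⟩
    obtain ⟨x, hx, rfl⟩ := mem_img.1 hy
    exact ⟨⟨x, hx⟩, rfl⟩
  exact Cardinal.mk_le_of_surjective this

/-- infinite cardinal -/
def IC (κ : ZFSet.{u}) : Prop := IsCard κ ∧ Cardinal.aleph0 ≤ zcard κ

theorem zcard_insert_le (x y : ZFSet.{u}) : zcard (insert x y) ≤ zcard y + 1 := by
  have : (insert x y : ZFSet).toSet = insert x y.toSet := by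
    ext z; exact ZFSet.mem_insert_iff
  rw [zcard, this]
  exact Cardinal.mk_insert_le

theorem IC.ord {κ : ZFSet.{u}} (h : IC κ) : κ.IsOrdinal := h.1.1.ord

theorem IC.mem_of_card_lt {κ α : ZFSet.{u}} (h : IC κ) (ho : α.IsOrdinal)
    (hc : zcard α < zcard κ) : α ∈ κ := by
  rcases ho.mem_trichotomous h.ord with h1 | rfl | h1
  · exact h1
  · exact absurd hc (lt_irrefl _)
  · exact absurd (zcard_mono (ho.subset_of_mem h1)) (not_le.2 hc)

theorem IC.succ_mem {κ α : ZFSet.{u}} (h : IC κ) (hα : α ∈ κ) : insert α α ∈ κ := by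
  refine h.mem_of_card_lt (ZFSet.isOrdinal_succ (h.ord.mem hα)) ?_
  exact (zcard_insert_le α α).trans_lt (Cardinal.add_lt_of_lt h.2 (h.1.2 α hα)
    (Cardinal.one_lt_aleph0.trans_le h.2))

end

section

/-! ### Gödel pairing and coding -/

/-- the Gödel well-ordering of pairs of ordinals -/
def GLess (a b c d : ZFSet.{u}) : Prop :=
  a ∪ b ∈ c ∪ d ∨ (a ∪ b = c ∪ d ∧ (a ∈ c ∨ (a = c ∧ b ∈ d)))

/-- the Gödel well-ordering of `κ × κ` as a set -/
def gE (κ : ZFSet.{u}) : ZFSet.{u} :=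
  ZFSet.sep (fun p => ∃ x ∈ κ.prod κ, ∃ y ∈ κ.prod κ, p = ZFSet.pair x y ∧
    ∃ a ∈ κ, ∃ b ∈ κ, ∃ c ∈ κ, ∃ d ∈ κ, x = ZFSet.pair a b ∧ y = ZFSet.pair c d ∧ GLess a b c d)
    ((κ.prod κ).prod (κ.prod κ))

theorem mrel_gE {κ q p : ZFSet.{u}} : mrel (κ.prod κ) (gE κ) q p ↔
    ∃ a ∈ κ, ∃ b ∈ κ, ∃ c ∈ κ, ∃ d ∈ κ, q = ZFSet.pair a b ∧ p = ZFSet.pair c d ∧ GLess a b c d := by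
  constructor
  · rintro ⟨_, _, h⟩
    obtain ⟨_, x, _, y, _, e, h⟩ := ZFSet.mem_sep.1 h
    obtain ⟨rfl, rfl⟩ := ZFSet.pair_inj.1 e
    exact h
  · rintro ⟨a, ha, b, hb, c, hc, d, hd, rfl, rfl, h⟩
    have h1 : ZFSet.pair a b ∈ κ.prod κ := ZFSet.pair_mem_prod.2 ⟨ha, hb⟩
    have h2 : ZFSet.pair c d ∈ κ.prod κ := ZFSet.pair_mem_prod.2 ⟨hc, hd⟩
    exact ⟨h1, h2, ZFSet.mem_sep.2 ⟨ZFSet.pair_mem_prod.2 ⟨h1, h2⟩, _, h1, _, h2, rfl,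
      a, ha, b, hb, c, hc, d, hd, rfl, rfl, h⟩⟩

theorem gE_mem {M κ : ZFSet.{u}} (hM : IsTransModel M) (hκ : κ ∈ M) : gE κ ∈ M := by
  have h1 := hM.prod hκ hκ
  refine hM.sep ?_ (hM.prod h1 h1)
  unfold GLess
  (repeat' first | assumption | exact DT.constM (by assumption) | exact DT.var _ | exact DT.empty | apply DT.fapp | apply DT.union | apply DT.inter | apply DT.sUnion | apply DT.tail | apply DT.compl | apply DT.sep | apply DT.constM | apply Df.pair_mem | apply Df.eq_pair | apply Df.mem | apply Df.eq | apply Df.subset | apply Df.and | apply Df.or | apply Df.iff | apply Df.not | apply Df.imp | apply Df.allM | apply Df.exM | apply Df.ball | apply Df.bex | apply Df.all | apply Df.ex | exact Df.prop _)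

theorem wf_gE (κ : ZFSet.{u}) : WellFounded (mrel (κ.prod κ) (gE κ)) := by
  let fst : ZFSet.{u} → ZFSet.{u} := fun p => if h : ∃ a b, p = ZFSet.pair a b then h.choose else ∅
  let snd : ZFSet.{u} → ZFSet.{u} := fun p => if h : ∃ b a, p = ZFSet.pair a b then h.choose else ∅
  have hfst : ∀ a b, fst (ZFSet.pair a b) = a := fun a b => by
    have h : ∃ a' b', ZFSet.pair a b = ZFSet.pair a' b' := ⟨a, b, rfl⟩
    have : fst (ZFSet.pair a b) = h.choose := dif_pos h
    rw [this]
    exact (ZFSet.pair_inj.1 h.choose_spec.choose_spec).1.symm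
  have hsnd : ∀ a b, snd (ZFSet.pair a b) = b := fun a b => by
    have h : ∃ b' a', ZFSet.pair a b = ZFSet.pair a' b' := ⟨b, a, rfl⟩
    have : snd (ZFSet.pair a b) = h.choose := dif_pos h
    rw [this]
    exact (ZFSet.pair_inj.1 h.choose_spec.choose_spec).2.symm
  have wf := (WellFounded.prod_lex (ZFSet.mem_wf.{u})
    (WellFounded.prod_lex (ZFSet.mem_wf.{u}) (ZFSet.mem_wf.{u})))
  refine Subrelation.wf ?_ (InvImage.wf (fun p => (fst p ∪ snd p, fst p, snd p)) wf)
  intro q p h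
  obtain ⟨a, ha, b, hb, c, hc, d, hd, rfl, rfl, h1⟩ := mrel_gE.1 h
  simp only [InvImage, hfst, hsnd, Prod.lex_def]
  exact h1

/-- the Gödel pairing function on `κ` -/
def gp (κ : ZFSet.{u}) : ZFSet.{u} → ZFSet.{u} := mcol (wf_gE κ)

theorem gp_mem {M κ : ZFSet.{u}} (hM : IsTransModel M) (hκ : κ ∈ M) :
    lam (κ.prod κ) (gp κ) ∈ M :=
  mostowski hM (hM.prod hκ hκ) (gE_mem hM hκ) _

theorem IC.union_mem {κ a b : ZFSet.{u}} (h : IC κ) (ha : a ∈ κ) (hb : b ∈ κ) : a ∪ b ∈ κ := by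
  have e : a ∪ b = a ∨ a ∪ b = b := by
    rcases (h.ord.mem ha).mem_trichotomous (h.ord.mem hb) with h1 | rfl | h1
    · right
      have := (h.ord.mem hb).subset_of_mem h1
      ext z; simp only [ZFSet.mem_union]; exact ⟨fun h => h.elim (@this z) id, Or.inr⟩
    · left; ext z; simp
    · left
      have := (h.ord.mem ha).subset_of_mem h1
      ext z; simp only [ZFSet.mem_union]; exact ⟨fun h => h.elim id (@this z), Or.inl⟩
  rcases e with e | e <;> rw [e] <;> assumption

theorem GLess_total {κ a b c d : ZFSet.{u}} (h : IC κ) (ha : a ∈ κ) (hb : b ∈ κ) (hc : c ∈ κ)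
    (hd : d ∈ κ) : GLess a b c d ∨ (a = c ∧ b = d) ∨ GLess c d a b := by
  have tri : ∀ {x y : ZFSet.{u}}, x ∈ κ → y ∈ κ → x ∈ y ∨ x = y ∨ y ∈ x := fun hx hy =>
    (h.ord.mem hx).mem_trichotomous (h.ord.mem hy)
  have h1 := tri (h.union_mem ha hb) (h.union_mem hc hd)
  have h2 := tri ha hc
  have h3 := tri hb hd
  unfold GLess
  grind

theorem GLess_trans {κ a b c d e f : ZFSet.{u}} (h : IC κ) (he : e ∈ κ) (hf : f ∈ κ)
    (h1 : GLess a b c d) (h2 : GLess c d e f) : GLess a b e f := by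
  have t1 : ∀ x y, x ∈ y → y ∈ e ∪ f → x ∈ e ∪ f := fun x y hx hy =>
    (h.ord.mem (h.union_mem he hf)).mem_trans hx hy
  have t2 : ∀ x y, x ∈ y → y ∈ e → x ∈ e := fun x y hx hy => (h.ord.mem he).mem_trans hx hy
  have t3 : ∀ x y, x ∈ y → y ∈ f → x ∈ f := fun x y hx hy => (h.ord.mem hf).mem_trans hx hy
  unfold GLess at *
  grind

theorem gp_inj {κ a b c d : ZFSet.{u}} (h : IC κ) (ha : a ∈ κ) (hb : b ∈ κ) (hc : c ∈ κ)
    (hd : d ∈ κ) (e : gp κ (ZFSet.pair a b) = gp κ (ZFSet.pair c d)) : a = c ∧ b = d := by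
  rcases GLess_total h ha hb hc hd with h1 | h1 | h1
  · have : gp κ (ZFSet.pair a b) ∈ gp κ (ZFSet.pair c d) :=
      (mem_mcol _).2 ⟨_, mrel_gE.2 ⟨a, ha, b, hb, c, hc, d, hd, rfl, rfl, h1⟩, rfl⟩
    rw [e] at this
    exact absurd this (ZFSet.mem_irrefl _)
  · exact h1
  · have : gp κ (ZFSet.pair c d) ∈ gp κ (ZFSet.pair a b) :=
      (mem_mcol _).2 ⟨_, mrel_gE.2 ⟨c, hc, d, hd, a, ha, b, hb, rfl, rfl, h1⟩, rfl⟩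
    rw [e] at this
    exact absurd this (ZFSet.mem_irrefl _)

theorem gp_trans {κ p : ZFSet.{u}} (h : IC κ) : (gp κ p).IsTransitive := by
  intro z hz w hw
  obtain ⟨q, hq, rfl⟩ := (mem_mcol _).1 hz
  obtain ⟨r, hr, rfl⟩ := (mem_mcol _).1 hw
  obtain ⟨a, ha, b, hb, c, hc, d, hd, rfl, rfl, h1⟩ := mrel_gE.1 hr
  obtain ⟨c', hc', d', hd', e, he, f, hf, e1, rfl, h2⟩ := mrel_gE.1 hq
  obtain ⟨rfl, rfl⟩ := ZFSet.pair_inj.1 e1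
  exact (mem_mcol _).2 ⟨_, mrel_gE.2 ⟨a, ha, b, hb, e, he, f, hf, rfl, rfl,
    GLess_trans h he hf h1 h2⟩, rfl⟩

theorem gp_ord {κ p : ZFSet.{u}} (h : IC κ) : (gp κ p).IsOrdinal := by
  refine ZFSet.isOrdinal_iff_forall_mem_isTransitive.2 ⟨gp_trans h, fun y hy => ?_⟩
  obtain ⟨q, hq, rfl⟩ := (mem_mcol _).1 hy
  exact gp_trans h

theorem zcard_prod (a b : ZFSet.{u}) : zcard (a.prod b) ≤ zcard a * zcard b := by
  have : Function.Surjective (fun p : a.toSet × b.toSet =>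
      (⟨ZFSet.pair p.1.1 p.2.1, ZFSet.pair_mem_prod.2 ⟨p.1.2, p.2.2⟩⟩ : (a.prod b).toSet)) := by
    rintro ⟨y, hy⟩
    obtain ⟨x, hx, z, hz, rfl⟩ := ZFSet.mem_prod.1 hy
    exact ⟨(⟨x, hx⟩, ⟨z, hz⟩), rfl⟩
  have := Cardinal.mk_le_of_surjective this
  rwa [Cardinal.mk_prod, Cardinal.lift_id, Cardinal.lift_id] at this

theorem gp_lt {κ a b : ZFSet.{u}} (h : IC κ) (ha : a ∈ κ) (hb : b ∈ κ) :
    gp κ (ZFSet.pair a b) ∈ κ := by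
  refine h.mem_of_card_lt (gp_ord h) ?_
  have hm := h.union_mem ha hb
  have hs := h.succ_mem hm
  set s : ZFSet := insert (a ∪ b) (a ∪ b) with hsdef
  have hso := h.ord.mem hs
  have hc := h.1.2 s hs
  have hsub : gp κ (ZFSet.pair a b) ⊆ img (s.prod s) (gp κ) := by
    intro z hz
    obtain ⟨q, hq, rfl⟩ := (mem_mcol _).1 hz
    refine mem_img.2 ⟨q, ?_, rfl⟩
    obtain ⟨c, hc, d, hd, a', ha', b', hb', rfl, e1, h1⟩ := mrel_gE.1 hq
    obtain ⟨rfl, rfl⟩ := ZFSet.pair_inj.1 e1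
    have hu : c ∪ d ∈ s := by
      rcases h1 with h1 | ⟨h1, _⟩
      · exact ZFSet.mem_insert_iff.2 (Or.inr h1)
      · exact ZFSet.mem_insert_iff.2 (Or.inl h1)
    have aux : ∀ x, x ∈ κ → x ⊆ c ∪ d → x ∈ s := by
      intro x hx hxs
      rcases (h.ord.mem hx).subset_iff_eq_or_mem (h.ord.mem (h.union_mem hc hd)) |>.1 hxs with e | e
      · rw [e]; exact hu
      · exact hso.mem_trans e hu
    exact ZFSet.pair_mem_prod.2 ⟨aux c hc (fun z hz => ZFSet.mem_union.2 (Or.inl hz)),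
      aux d hd (fun z hz => ZFSet.mem_union.2 (Or.inr hz))⟩
  calc zcard (gp κ (ZFSet.pair a b)) ≤ _ := zcard_mono hsub
    _ ≤ _ := zcard_img_le _ _
    _ ≤ _ := zcard_prod _ _
    _ < _ := Cardinal.mul_lt_of_lt h.2 hc hc

/-- the code of a family `h : κ → V` -/
def code (κ : ZFSet.{u}) (h : ZFSet.{u} → ZFSet.{u}) : ZFSet.{u} :=
  ZFSet.sep (fun z => ∃ ξ ∈ κ, ∃ η ∈ κ, h ξ ∈ h η ∧
    ∃ p ∈ κ.prod κ, p = ZFSet.pair ξ η ∧ ZFSet.pair p z ∈ lam (κ.prod κ) (gp κ)) κ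

theorem code_sub {κ : ZFSet.{u}} {h : ZFSet.{u} → ZFSet.{u}} : code κ h ⊆ κ :=
  fun _ hz => (ZFSet.mem_sep.1 hz).1

theorem gp_mem_code {κ ξ η : ZFSet.{u}} {h : ZFSet.{u} → ZFSet.{u}} (hκ : IC κ) (hξ : ξ ∈ κ)
    (hη : η ∈ κ) : gp κ (ZFSet.pair ξ η) ∈ code κ h ↔ h ξ ∈ h η := by
  constructor
  · intro hz
    obtain ⟨_, ξ', hξ', η', hη', h1, p, hp, rfl, h2⟩ := ZFSet.mem_sep.1 hz
    obtain ⟨rfl, rfl⟩ := gp_inj hκ hξ' hη' hξ hη (pair_mem_lam.1 h2).2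
    exact h1
  · intro h1
    have : ZFSet.pair ξ η ∈ κ.prod κ := ZFSet.pair_mem_prod.2 ⟨hξ, hη⟩
    exact ZFSet.mem_sep.2 ⟨gp_lt hκ hξ hη, ξ, hξ, η, hη, h1, _, this, rfl,
      pair_mem_lam.2 ⟨this, rfl⟩⟩

theorem code_mem {M κ f : ZFSet.{u}} (hM : IsTransModel M) (hκ : κ ∈ M) (hf : f ∈ M) :
    code κ (fapp f) ∈ M := by
  have h1 := hM.prod hκ hκ
  have h2 := gp_mem hM hκ
  refine hM.sep ?_ hκ
  (repeat' first | assumption | exact DT.constM (by assumption) | exact DT.var _ | exact DT.empty | apply DT.fapp | apply DT.union | apply DT.inter | apply DT.sUnion | apply DT.tail | apply DT.compl | apply DT.sep | apply DT.constM | apply Df.pair_mem | apply Df.eq_pair | apply Df.mem | apply Df.eq | apply Df.subset | apply Df.and | apply Df.or | apply Df.iff | apply Df.not | apply Df.imp | apply Df.allM | apply Df.exM | apply Df.ball | apply Df.bex | apply Df.all | apply Df.ex | exact Df.prop _)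

theorem decode {M κ : ZFSet.{u}} {h : ZFSet.{u} → ZFSet.{u}} (hM : IsTransModel M) (hκ : κ ∈ M)
    (hc : IC κ) (ht : ∀ ξ ∈ κ, ∀ z ∈ h ξ, ∃ η ∈ κ, h η = z) (hA : code κ h ∈ M) :
    ∀ ξ ∈ κ, h ξ ∈ M := by
  have h1 := hM.prod hκ hκ
  have h2 := gp_mem hM hκ
  set E := ZFSet.sep (fun p => ∃ z ∈ code κ h, ZFSet.pair p z ∈ lam (κ.prod κ) (gp κ)) (κ.prod κ)
    with hE
  have hEM : E ∈ M := hM.sep (by (repeat' first | assumption | exact DT.constM (by assumption) | exact DT.var _ | exact DT.empty | apply DT.fapp | apply DT.union | apply DT.inter | apply DT.sUnion | apply DT.tail | apply DT.compl | apply DT.sep | apply DT.constM | apply Df.pair_mem | apply Df.eq_pair | apply Df.mem | apply Df.eq | apply Df.subset | apply Df.and | apply Df.or | apply Df.iff | apply Df.not | apply Df.imp | apply Df.allM | apply Df.exM | apply Df.ball | apply Df.bex | apply Df.all | apply Df.ex | exact Df.prop _)) h1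
  have hrel : ∀ ξ η, mrel κ E ξ η ↔ ξ ∈ κ ∧ η ∈ κ ∧ h ξ ∈ h η := by
    intro ξ η
    refine and_congr_right fun hξ => and_congr_right fun hη => ?_
    have hp : ZFSet.pair ξ η ∈ κ.prod κ := ZFSet.pair_mem_prod.2 ⟨hξ, hη⟩
    rw [← gp_mem_code hc hξ hη, hE, ZFSet.mem_sep]
    constructor
    · rintro ⟨_, z, hz, h⟩
      rwa [(pair_mem_lam.1 h).2]
    · intro hz
      exact ⟨hp, _, hz, pair_mem_lam.2 ⟨hp, rfl⟩⟩
  have wf : WellFounded (mrel κ E) :=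
    Subrelation.wf (fun {a b} hab => ((hrel a b).1 hab).2.2) (InvImage.wf h ZFSet.mem_wf)
  have key : ∀ ξ, ξ ∈ κ → mcol wf ξ = h ξ := by
    intro ξ
    induction ξ using wf.induction with
    | _ ξ ih =>
      intro hξ
      ext z
      rw [mem_mcol]
      constructor
      · rintro ⟨η, hη, rfl⟩
        rw [ih η hη hη.1]; exact ((hrel _ _).1 hη).2.2
      · intro hz
        obtain ⟨η, hη, rfl⟩ := ht ξ hξ z hz
        have := (hrel _ _).2 ⟨hη, hξ, hz⟩
        exact ⟨η, this, ih η this hη⟩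
  intro ξ hξ
  have := mostowski hM hκ hEM wf
  rw [← key ξ hξ]
  exact (hM.of_pair (hM.tr this (pair_mem_lam.2 ⟨hξ, rfl⟩))).2

/-- every element of `M` belongs to a transitive set in `M` which has size at most `κ` in `M` -/
def Nice (κ M : ZFSet.{u}) : Prop := ∀ x ∈ M, ∃ t ∈ M, x ∈ t ∧ t.IsTransitive ∧
  ∃ f ∈ M, IsZFunc κ f ∧ SurjOnto f κ t

theorem Nice.sub {κ M N : ZFSet.{u}} (hc : IC κ) (hM : IsTransModel M) (hκ : κ ∈ M)
    (hn : Nice κ M) (hN : IsTransModel N) (hκN : κ ∈ N)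
    (hP : ∀ A ∈ M, A ⊆ κ → A ∈ N) : M ⊆ N := by
  intro x hx
  obtain ⟨t, ht, hxt, htr, f, hf, hfun, hs⟩ := hn x hx
  obtain ⟨ξ, hξ, rfl⟩ := hs.2 x hxt
  refine decode hN hκN hc (fun ξ hξ z hz => hs.2 z ?_) (hP _ (code_mem hM hκ hf) code_sub) ξ hξ
  exact htr _ (hs.1 ξ hξ) hz

end

section

/-! ### Ultrafilters: basic facts -/

/-- the finite ordinals -/
def nn : ℕ → ZFSet.{u}
  | 0 => ∅
  | n + 1 => insert (nn n) (nn n)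

theorem nn_eq (n : ℕ) : ZFSet.mk (PSet.ofNat.{u} n) = nn n := by
  induction n with
  | zero => rfl
  | succ n ih => rw [nn, ← ih]; rfl

theorem mem_omega {x : ZFSet.{u}} : x ∈ ZFSet.omega ↔ ∃ n, nn n = x := by
  constructor
  · induction x using Quotient.inductionOn with
    | _ x =>
      rintro ⟨⟨n⟩, hn⟩
      exact ⟨n, by rw [← nn_eq]; exact (ZFSet.sound hn).symm⟩
  · rintro ⟨n, rfl⟩
    induction n with
    | zero => exact ZFSet.omega_zero
    | succ n ih => exact ZFSet.omega_succ ih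

theorem nn_omega (n : ℕ) : nn.{u} n ∈ ZFSet.omega := mem_omega.2 ⟨n, rfl⟩

theorem nn_lt {m n : ℕ} (h : m < n) : nn.{u} m ∈ nn n := by
  induction n with
  | zero => omega
  | succ n ih =>
    rcases Nat.lt_succ_iff_lt_or_eq.1 h with h | rfl
    · exact ZFSet.mem_insert_of_mem _ (ih h)
    · exact ZFSet.mem_insert _ _

theorem nn_inj : Function.Injective nn.{u} := by
  intro m n h
  rcases lt_trichotomy m n with h1 | h1 | h1
  · have := nn_lt.{u} h1; rw [h] at this; exact absurd this (ZFSet.mem_irrefl _)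
  · exact h1
  · have := nn_lt.{u} h1; rw [h] at this; exact absurd this (ZFSet.mem_irrefl _)

theorem nn_ord (n : ℕ) : (nn.{u} n).IsOrdinal := by
  induction n with
  | zero => exact ZFSet.isOrdinal_empty
  | succ n ih => exact ZFSet.isOrdinal_succ ih

theorem mem_nn {n : ℕ} {x : ZFSet.{u}} (h : x ∈ nn n) : ∃ m < n, nn m = x := by
  induction n with
  | zero => exact absurd h (ZFSet.notMem_empty _)
  | succ n ih =>
    rcases ZFSet.mem_insert_iff.1 h with h | h
    · exact ⟨n, by omega, h.symm⟩
    · obtain ⟨m, hm, e⟩ := ih h; exact ⟨m, by omega, e⟩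

theorem omega_ord : ZFSet.omega.{u}.IsOrdinal := by
  refine ZFSet.isOrdinal_iff_forall_mem_isTransitive.2 ⟨?_, ?_⟩
  · intro x hx y hy
    obtain ⟨n, rfl⟩ := mem_omega.1 hx
    obtain ⟨m, _, rfl⟩ := mem_nn hy
    exact nn_omega m
  · intro x hx
    obtain ⟨n, rfl⟩ := mem_omega.1 hx
    exact (nn_ord n).isTransitive

theorem aleph0_le_omega : Cardinal.aleph0 ≤ zcard ZFSet.omega.{u} := by
  have : Function.Injective (fun n : ULift.{u+1} ℕ => (⟨nn n.down, nn_omega n.down⟩ : ZFSet.omega.{u}.toSet)) := by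
    rintro ⟨m⟩ ⟨n⟩ h
    exact congrArg _ (nn_inj (congrArg Subtype.val h))
  have := Cardinal.mk_le_of_injective this
  rw [Cardinal.mk_uLift, Cardinal.mk_nat, Cardinal.lift_aleph0] at this
  exact this

theorem IC.empty_mem {κ : ZFSet.{u}} (h : IC κ) : ∅ ∈ κ := by
  refine h.mem_of_card_lt ZFSet.isOrdinal_empty ?_
  refine lt_of_lt_of_le ?_ h.2
  have : zcard (∅ : ZFSet.{u}) = 0 := by
    rw [zcard, Cardinal.mk_eq_zero_iff]
    exact ⟨fun x => absurd x.2 (ZFSet.notMem_empty _)⟩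
  rw [this]; exact Cardinal.aleph0_pos

/-- a transitive model with a weakly amenable `ω₁`-intersecting ultrafilter -/
structure GU (κ M U : ZFSet.{u}) : Prop where
  ic : IC κ
  hM : IsTransModel M
  hκ : κ ∈ M
  uf : IsMUltrafilter κ M U
  wa : WeaklyAmenable κ M U
  oi : OmegaOneIntersecting U

section
variable {κ M U : ZFSet.{u}}

theorem GU.memM (g : GU κ M U) {A : ZFSet.{u}} (h : A ∈ U) : A ∈ M := (g.uf.1 A h).1
theorem GU.sub (g : GU κ M U) {A : ZFSet.{u}} (h : A ∈ U) : A ⊆ κ := (g.uf.1 A h).2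
theorem GU.tail (g : GU κ M U) {a : ZFSet.{u}} (h : a ∈ κ) : tailSet κ a ∈ U := g.uf.2.1 a h
theorem GU.nempty (g : GU κ M U) : ∅ ∉ U := g.uf.2.2.1
theorem GU.inter (g : GU κ M U) {A B : ZFSet.{u}} (h : A ∈ U) (h' : B ∈ U) : A ∩ B ∈ U :=
  g.uf.2.2.2.1 A h B h'
theorem GU.mono (g : GU κ M U) {A B : ZFSet.{u}} (h : A ∈ U) (hB : B ∈ M) (hs : B ⊆ κ)
    (h' : A ⊆ B) : B ∈ U := g.uf.2.2.2.2.1 A h B hB hs h'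
theorem GU.ultra (g : GU κ M U) {B : ZFSet.{u}} (hB : B ∈ M) (hs : B ⊆ κ) :
    B ∈ U ∨ compl κ B ∈ U := g.uf.2.2.2.2.2.1 B hB hs
theorem GU.normal (g : GU κ M U) {f : ZFSet.{u}} (hf : f ∈ M) (h : IsZFunc κ f)
    (h' : ZFSet.sep (fun ξ => fapp f ξ ∈ ξ) κ ∈ U) :
    ∃ γ ∈ κ, ZFSet.sep (fun ξ => fapp f ξ = γ) κ ∈ U := g.uf.2.2.2.2.2.2 f hf h h'

theorem GU.ex (g : GU κ M U) {A : ZFSet.{u}} (h : A ∈ U) : ∃ x ∈ κ, x ∈ A := by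
  by_contra hn
  push Not at hn
  have : A = ∅ := by
    ext z
    constructor
    · intro hz; exact absurd hz (hn z (g.sub h hz))
    · intro hz; exact absurd hz (ZFSet.notMem_empty _)
  exact g.nempty (this ▸ h)

theorem sep_sub {P : ZFSet.{u} → Prop} : ZFSet.sep P κ ⊆ κ := fun _ h => (ZFSet.mem_sep.1 h).1

/-- monotonicity for separated sets -/
theorem GU.imp (g : GU κ M U) {P Q : ZFSet.{u} → Prop} (h : ZFSet.sep P κ ∈ U)
    (hQ : ZFSet.sep Q κ ∈ M) (hPQ : ∀ ξ ∈ κ, P ξ → Q ξ) : ZFSet.sep Q κ ∈ U :=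
  g.mono h hQ sep_sub (fun z hz => ZFSet.mem_sep.2
    ⟨(ZFSet.mem_sep.1 hz).1, hPQ z (ZFSet.mem_sep.1 hz).1 (ZFSet.mem_sep.1 hz).2⟩)

theorem GU.and (g : GU κ M U) {P Q : ZFSet.{u} → Prop} (h : ZFSet.sep P κ ∈ U)
    (h' : ZFSet.sep Q κ ∈ U) : ZFSet.sep (fun ξ => P ξ ∧ Q ξ) κ ∈ U := by
  have : ZFSet.sep (fun ξ => P ξ ∧ Q ξ) κ = ZFSet.sep P κ ∩ ZFSet.sep Q κ := by
    ext z; simp; tauto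
  rw [this]; exact g.inter h h'

theorem GU.not_iff (g : GU κ M U) {P : ZFSet.{u} → Prop} (hP : ZFSet.sep P κ ∈ M) :
    ZFSet.sep (fun ξ => ¬ P ξ) κ ∈ U ↔ ZFSet.sep P κ ∉ U := by
  constructor
  · intro h h'
    obtain ⟨x, _, hx⟩ := g.ex (g.and h h')
    exact (ZFSet.mem_sep.1 hx).2.1 (ZFSet.mem_sep.1 hx).2.2
  · intro h
    have := (g.ultra hP sep_sub).resolve_left h
    convert this using 1
    ext z; simp only [compl, ZFSet.mem_sep]; tauto

theorem GU.ex2 (g : GU κ M U) {P Q : ZFSet.{u} → Prop} (h : ZFSet.sep P κ ∈ U)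
    (h' : ZFSet.sep Q κ ∈ U) : ∃ ξ ∈ κ, P ξ ∧ Q ξ := by
  obtain ⟨x, hx, h⟩ := g.ex (g.and h h')
  exact ⟨x, hx, (ZFSet.mem_sep.1 h).2⟩

theorem GU.sep_self (g : GU κ M U) {P : ZFSet.{u} → Prop} (h : ∀ ξ ∈ κ, P ξ) :
    ZFSet.sep P κ ∈ U := by
  have := g.tail g.ic.empty_mem
  have e : tailSet κ ∅ = ZFSet.sep P κ := by
    ext z; simp [tailSet]; intro hz; exact h z hz
  rwa [e] at this

theorem GU.omega_mem (g : GU κ M U) : ZFSet.omega ∈ κ := by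
  rcases omega_ord.mem_trichotomous g.ic.ord with h | h | h
  · exact h
  · exfalso
    obtain ⟨x, hx⟩ := g.oi (fun n => tailSet κ (nn n)) (fun n => g.tail (h ▸ nn_omega n))
    have := (ZFSet.mem_sep.1 (hx 0)).1
    rw [← h] at this
    obtain ⟨n, rfl⟩ := mem_omega.1 this
    exact (ZFSet.mem_sep.1 (hx (n+1))).2 (nn_lt (by omega))
  · exfalso
    obtain ⟨n, rfl⟩ := mem_omega.1 h
    have h1 := g.ic.2
    have : ∀ n, zcard (nn.{u} n) < Cardinal.aleph0 := by
      intro n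
      induction n with
      | zero => 
        have : zcard (∅ : ZFSet.{u}) = 0 := by
          rw [zcard, Cardinal.mk_eq_zero_iff]
          exact ⟨fun x => absurd x.2 (ZFSet.notMem_empty _)⟩
        rw [nn, this]; exact Cardinal.aleph0_pos
      | succ n ih => exact (zcard_insert_le _ _).trans_lt
                        (Cardinal.add_lt_aleph0 ih Cardinal.one_lt_aleph0)
    exact absurd h1 (not_le.2 (this n))

theorem GU.complete (g : GU κ M U) {γ f : ZFSet.{u}} (hγ : γ ∈ κ) (hf : f ∈ M)
    (h : ∀ a ∈ γ, fapp f a ∈ U) : ZFSet.sep (fun ξ => ∀ a ∈ γ, ξ ∈ fapp f a) κ ∈ U := by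
  have hκ := g.hκ
  have hγM := g.hM.tr hκ hγ
  have he := g.hM.empty
  have hB : ZFSet.sep (fun ξ => ∀ a ∈ γ, ξ ∈ fapp f a) κ ∈ M := g.hM.sep (by (repeat' first | assumption | exact DT.constM (by assumption) | exact DT.var _ | exact DT.empty | apply DT.fapp | apply DT.union | apply DT.inter | apply DT.sUnion | apply DT.tail | apply DT.compl | apply DT.sep | apply DT.constM | apply Df.pair_mem | apply Df.eq_pair | apply Df.mem | apply Df.eq | apply Df.subset | apply Df.and | apply Df.or | apply Df.iff | apply Df.not | apply Df.imp | apply Df.allM | apply Df.exM | apply Df.ball | apply Df.bex | apply Df.all | apply Df.ex | exact Df.prop _)) hκ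
  by_contra hn
  have hc := (g.not_iff hB).2 hn
  obtain ⟨r, hr, hrf, hr'⟩ := g.hM.choice (a := κ)
    (P := fun ξ a => (∃ b ∈ γ, ξ ∉ fapp f b) → a ∈ γ ∧ ξ ∉ fapp f a) (by (repeat' first | assumption | exact DT.constM (by assumption) | exact DT.var _ | exact DT.empty | apply DT.fapp | apply DT.union | apply DT.inter | apply DT.sUnion | apply DT.tail | apply DT.compl | apply DT.sep | apply DT.constM | apply Df.pair_mem | apply Df.eq_pair | apply Df.mem | apply Df.eq | apply Df.subset | apply Df.and | apply Df.or | apply Df.iff | apply Df.not | apply Df.imp | apply Df.allM | apply Df.exM | apply Df.ball | apply Df.bex | apply Df.all | apply Df.ex | exact Df.prop _)) hκ (by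
      intro ξ hξ
      by_cases H : ∃ b ∈ γ, ξ ∉ fapp f b
      · obtain ⟨b, hb, hb'⟩ := H
        exact ⟨b, g.hM.tr hγM hb, fun _ => ⟨hb, hb'⟩⟩
      · exact ⟨∅, he, fun h => absurd h H⟩)
  have h1 := g.and hc (g.tail hγ)
  have hS : ZFSet.sep (fun ξ => fapp r ξ ∈ ξ) κ ∈ M := g.hM.sep (by (repeat' first | assumption | exact DT.constM (by assumption) | exact DT.var _ | exact DT.empty | apply DT.fapp | apply DT.union | apply DT.inter | apply DT.sUnion | apply DT.tail | apply DT.compl | apply DT.sep | apply DT.constM | apply Df.pair_mem | apply Df.eq_pair | apply Df.mem | apply Df.eq | apply Df.subset | apply Df.and | apply Df.or | apply Df.iff | apply Df.not | apply Df.imp | apply Df.allM | apply Df.exM | apply Df.ball | apply Df.bex | apply Df.all | apply Df.ex | exact Df.prop _)) hκ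
  obtain ⟨a, ha, hU⟩ := g.normal hr hrf (g.imp h1 hS (by
    rintro ξ hξ ⟨h1, h2⟩
    push Not at h1
    exact ((g.ic.ord.mem hξ).notMem_iff_subset (g.ic.ord.mem hγ)).1 h2 (hr' ξ hξ h1).1))
  obtain ⟨ξ, hξ, h3, h4⟩ := g.ex2 hc hU
  push Not at h3
  have h5 := hr' ξ hξ h3
  rw [h4] at h5
  have h6 := h a h5.1
  have h7 := g.inter (g.inter hc hU) h6
  obtain ⟨ζ, hζ, h8⟩ := g.ex h7
  obtain ⟨h8, h9⟩ := ZFSet.mem_inter.1 h8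
  obtain ⟨h8, h10⟩ := ZFSet.mem_inter.1 h8
  have h8 := (ZFSet.mem_sep.1 h8).2
  push Not at h8
  have h11 := hr' ζ hζ h8
  rw [(ZFSet.mem_sep.1 h10).2] at h11
  exact h11.2 h9

end

/-- code for a binary relation on `κ` -/
def codeR (κ : ZFSet.{u}) (R : ZFSet.{u} → ZFSet.{u} → Prop) : ZFSet.{u} :=
  ZFSet.sep (fun z => ∃ ξ ∈ κ, ∃ η ∈ κ, R ξ η ∧ gp κ (ZFSet.pair ξ η) = z) κ

theorem codeR_decode {κ M : ZFSet.{u}} {R : ZFSet.{u} → ZFSet.{u} → Prop} (hM : IsTransModel M)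
    (hc : IC κ) (hκ : κ ∈ M) (hA : codeR κ R ∈ M) :
    ∃ E ∈ M, ∀ ξ ∈ κ, ∀ η ∈ κ, (ZFSet.pair ξ η ∈ E ↔ R ξ η) := by
  have h1 := hM.prod hκ hκ
  have h2 := gp_mem hM hκ
  obtain ⟨A, hAe⟩ : ∃ A, A = codeR κ R := ⟨_, rfl⟩
  rw [← hAe] at hA
  obtain ⟨G, hG⟩ : ∃ G, G = lam (κ.prod κ) (gp κ) := ⟨_, rfl⟩
  rw [← hG] at h2
  refine ⟨ZFSet.sep (fun p => ∃ z ∈ A, ZFSet.pair p z ∈ G) (κ.prod κ),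
    hM.sep (by (repeat' first | assumption | exact DT.constM (by assumption) | exact DT.var _ | exact DT.empty | apply DT.fapp | apply DT.union | apply DT.inter | apply DT.sUnion | apply DT.tail | apply DT.compl | apply DT.sep | apply DT.constM | apply Df.pair_mem | apply Df.eq_pair | apply Df.mem | apply Df.eq | apply Df.subset | apply Df.and | apply Df.or | apply Df.iff | apply Df.not | apply Df.imp | apply Df.allM | apply Df.exM | apply Df.ball | apply Df.bex | apply Df.all | apply Df.ex | exact Df.prop _)) h1, fun ξ hξ η hη => ?_⟩
  have hp : ZFSet.pair ξ η ∈ κ.prod κ := ZFSet.pair_mem_prod.2 ⟨hξ, hη⟩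
  subst hAe hG
  rw [ZFSet.mem_sep]
  constructor
  · rintro ⟨_, z, hz, h⟩
    obtain ⟨_, ξ', hξ', η', hη', hR, e⟩ := ZFSet.mem_sep.1 hz
    have e2 := (pair_mem_lam.1 h).2
    obtain ⟨rfl, rfl⟩ := gp_inj hc hξ' hη' hξ hη (e.trans e2.symm)
    exact hR
  · intro hR
    exact ⟨hp, gp κ (ZFSet.pair ξ η), ZFSet.mem_sep.2 ⟨gp_lt hc hξ hη, ξ, hξ, η, hη, hR, rfl⟩,
      pair_mem_lam.2 ⟨hp, rfl⟩⟩

theorem ic_of_wsr {κ : ZFSet.{u}} (h : IsWeaklySuperRamseyCard κ) : IC κ := by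
  refine ⟨h.1, ?_⟩
  obtain ⟨M, hM, _⟩ := h.2 ∅ (ZFSet.empty_subset _)
  rw [← hM.2.2]
  exact aleph0_le_omega.trans (zcard_mono (hM.1.1.subset_of_mem hM.1.2.1))

theorem wsr_gu {κ A : ZFSet.{u}} (h : IsWeaklySuperRamseyCard κ) (hA : A ⊆ κ) :
    ∃ M U, GU κ M U ∧ A ∈ M ∧ zcard M = zcard κ ∧ ElemSub M.toSet (Hclass κ) := by
  obtain ⟨M, hM, he, hAM, U, h1, h2, h3⟩ := h.2 A hA
  exact ⟨M, U, ⟨ic_of_wsr h, hM.1, hM.2.1, h1, h2, h3⟩, hAM, hM.2.2, he⟩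

theorem wsr_rel {κ : ZFSet.{u}} (h : IsWeaklySuperRamseyCard κ)
    (R : ZFSet.{u} → ZFSet.{u} → Prop) :
    ∃ M U, GU κ M U ∧ ∃ E ∈ M, ∀ ξ ∈ κ, ∀ η ∈ κ, (ZFSet.pair ξ η ∈ E ↔ R ξ η) := by
  obtain ⟨M, U, g, hA, _⟩ := wsr_gu h (A := codeR κ R) sep_sub
  exact ⟨M, U, g, codeR_decode g.hM g.ic g.hκ hA⟩

theorem wsr_regular {κ : ZFSet.{u}} (h : IsWeaklySuperRamseyCard κ) {γ : ZFSet.{u}} (hγ : γ ∈ κ)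
    (F : ZFSet.{u} → ZFSet.{u}) (hF : ∀ a ∈ γ, F a ∈ κ) : ∃ β ∈ κ, ∀ a ∈ γ, F a ∈ β := by
  obtain ⟨M, U, g, E, hE, hR⟩ := wsr_rel h (fun a b => b ∈ F a)
  have hκ := g.hκ
  have hsub : γ ⊆ κ := g.ic.ord.subset_of_mem hγ
  have hγM := g.hM.tr hκ hγ
  have hf : lam γ (fun a => ZFSet.sep (fun ξ => ZFSet.pair a ξ ∉ E) κ) ∈ M :=
    g.hM.lam (by (repeat' first | assumption | exact DT.constM (by assumption) | exact DT.var _ | exact DT.empty | apply DT.fapp | apply DT.union | apply DT.inter | apply DT.sUnion | apply DT.tail | apply DT.compl | apply DT.sep | apply DT.constM | apply Df.pair_mem | apply Df.eq_pair | apply Df.mem | apply Df.eq | apply Df.subset | apply Df.and | apply Df.or | apply Df.iff | apply Df.not | apply Df.imp | apply Df.allM | apply Df.exM | apply Df.ball | apply Df.bex | apply Df.all | apply Df.ex | exact Df.prop _)) hγM (fun a ha => by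
      have := g.hM.tr hγM ha
      exact g.hM.sep (by (repeat' first | assumption | exact DT.constM (by assumption) | exact DT.var _ | exact DT.empty | apply DT.fapp | apply DT.union | apply DT.inter | apply DT.sUnion | apply DT.tail | apply DT.compl | apply DT.sep | apply DT.constM | apply Df.pair_mem | apply Df.eq_pair | apply Df.mem | apply Df.eq | apply Df.subset | apply Df.and | apply Df.or | apply Df.iff | apply Df.not | apply Df.imp | apply Df.allM | apply Df.exM | apply Df.ball | apply Df.bex | apply Df.all | apply Df.ex | exact Df.prop _)) hκ)
  have h1 := g.complete hγ hf (fun a ha => by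
    rw [fapp_lam ha]
    convert g.tail (hF a ha) using 1
    ext z
    simp only [tailSet, ZFSet.mem_sep]
    refine and_congr_right fun hz => ?_
    rw [hR a (hsub ha) z hz])
  obtain ⟨ξ, hξ, h2⟩ := g.ex h1
  refine ⟨_, g.ic.succ_mem hξ, fun a ha => ?_⟩
  have h3 := (ZFSet.mem_sep.1 h2).2 a ha
  rw [fapp_lam ha, ZFSet.mem_sep, hR a (hsub ha) ξ hξ] at h3
  have h4 := ((g.ic.ord.mem hξ).notMem_iff_subset (g.ic.ord.mem (hF a ha))).1 h3.2
  rw [(g.ic.ord.mem (hF a ha)).subset_iff_eq_or_mem (g.ic.ord.mem hξ)] at h4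
  exact ZFSet.mem_insert_iff.2 h4

theorem wsr_strong {κ : ZFSet.{u}} (h : IsWeaklySuperRamseyCard κ) {γ : ZFSet.{u}} (hγ : γ ∈ κ)
    (G : ZFSet.{u} → ZFSet.{u}) (hG : ∀ ξ ∈ κ, G ξ ⊆ γ) : ∃ ξ ∈ κ, ∃ η ∈ κ, ξ ≠ η ∧ G ξ = G η := by
  obtain ⟨M, U, g, E, hE, hR⟩ := wsr_rel h (fun a ξ => a ∈ G ξ)
  have hκ := g.hκ
  have hsub : γ ⊆ κ := g.ic.ord.subset_of_mem hγ
  have hγM := g.hM.tr hκ hγ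
  set B : ZFSet → ZFSet := fun a => ZFSet.sep (fun ξ => ZFSet.pair a ξ ∈ E) κ with hB
  have hBM : ∀ a ∈ κ, B a ∈ M := fun a ha => by
      have := g.hM.tr hκ ha
      exact g.hM.sep (by (repeat' first | assumption | exact DT.constM (by assumption) | exact DT.var _ | exact DT.empty | apply DT.fapp | apply DT.union | apply DT.inter | apply DT.sUnion | apply DT.tail | apply DT.compl | apply DT.sep | apply DT.constM | apply Df.pair_mem | apply Df.eq_pair | apply Df.mem | apply Df.eq | apply Df.subset | apply Df.and | apply Df.or | apply Df.iff | apply Df.not | apply Df.imp | apply Df.allM | apply Df.exM | apply Df.ball | apply Df.bex | apply Df.all | apply Df.ex | exact Df.prop _)) hκ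
  have hf : lam κ B ∈ M := g.hM.lam (by (repeat' first | assumption | exact DT.constM (by assumption) | exact DT.var _ | exact DT.empty | apply DT.fapp | apply DT.union | apply DT.inter | apply DT.sUnion | apply DT.tail | apply DT.compl | apply DT.sep | apply DT.constM | apply Df.pair_mem | apply Df.eq_pair | apply Df.mem | apply Df.eq | apply Df.subset | apply Df.and | apply Df.or | apply Df.iff | apply Df.not | apply Df.imp | apply Df.allM | apply Df.exM | apply Df.ball | apply Df.bex | apply Df.all | apply Df.ex | exact Df.prop _)) hκ hBM
  have hX : img κ B ∈ M := g.hM.img (by (repeat' first | assumption | exact DT.constM (by assumption) | exact DT.var _ | exact DT.empty | apply DT.fapp | apply DT.union | apply DT.inter | apply DT.sUnion | apply DT.tail | apply DT.compl | apply DT.sep | apply DT.constM | apply Df.pair_mem | apply Df.eq_pair | apply Df.mem | apply Df.eq | apply Df.subset | apply Df.and | apply Df.or | apply Df.iff | apply Df.not | apply Df.imp | apply Df.allM | apply Df.exM | apply Df.ball | apply Df.bex | apply Df.all | apply Df.ex | exact Df.prop _)) hκ hBM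
  have hW := g.wa _ hX ⟨_, hf, isZFunc_lam _ _, fun y hy => by
    obtain ⟨x, hx, rfl⟩ := mem_img.1 hy
    exact ⟨x, hx, fapp_lam hx⟩⟩
  obtain ⟨W, hWe⟩ : ∃ W, W = img κ B ∩ U := ⟨_, rfl⟩
  rw [← hWe] at hW
  have hWm : ∀ a ∈ γ, (B a ∈ W ↔ B a ∈ U) := fun a ha => by
    rw [hWe, ZFSet.mem_inter]
    exact ⟨fun h => h.2, fun h => ⟨mem_img.2 ⟨a, hsub ha, rfl⟩, h⟩⟩
  set C : ZFSet → ZFSet := fun a => ZFSet.sep (fun ξ => ZFSet.pair a ξ ∈ E ↔ B a ∈ W) κ with hC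
  have hCM : ∀ a ∈ γ, C a ∈ M := fun a ha => by
      have := g.hM.tr hκ (hsub ha)
      exact g.hM.sep (by (repeat' first | assumption | exact DT.constM (by assumption) | exact DT.var _ | exact DT.empty | apply DT.fapp | apply DT.union | apply DT.inter | apply DT.sUnion | apply DT.tail | apply DT.compl | apply DT.sep | apply DT.constM | apply Df.pair_mem | apply Df.eq_pair | apply Df.mem | apply Df.eq | apply Df.subset | apply Df.and | apply Df.or | apply Df.iff | apply Df.not | apply Df.imp | apply Df.allM | apply Df.exM | apply Df.ball | apply Df.bex | apply Df.all | apply Df.ex | exact Df.prop _)) hκ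
  have hf' : lam γ C ∈ M := g.hM.lam (by (repeat' first | assumption | exact DT.constM (by assumption) | exact DT.var _ | exact DT.empty | apply DT.fapp | apply DT.union | apply DT.inter | apply DT.sUnion | apply DT.tail | apply DT.compl | apply DT.sep | apply DT.constM | apply Df.pair_mem | apply Df.eq_pair | apply Df.mem | apply Df.eq | apply Df.subset | apply Df.and | apply Df.or | apply Df.iff | apply Df.not | apply Df.imp | apply Df.allM | apply Df.exM | apply Df.ball | apply Df.bex | apply Df.all | apply Df.ex | exact Df.prop _)) hγM hCM
  have h1 := g.complete hγ hf' (fun a ha => by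
    rw [fapp_lam ha]
    by_cases hu : B a ∈ U
    · exact g.imp hu (hCM a ha) (fun ξ hξ h => by rw [hWm a ha]; exact iff_of_true h hu)
    · have hu' := (g.not_iff (hBM a (hsub ha))).2 hu
      exact g.imp hu' (hCM a ha) (fun ξ hξ h => by rw [hWm a ha]; exact iff_of_false h hu))
  have key : ∀ ξ ∈ κ, (∀ a ∈ γ, ξ ∈ fapp (lam γ C) a) → G ξ = ZFSet.sep (fun a => B a ∈ W) γ := by
    intro ξ hξ H
    ext a
    rw [ZFSet.mem_sep]
    constructor
    · intro ha
      have ha' := hG ξ hξ ha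
      have := H a ha'
      rw [fapp_lam ha', hC, ZFSet.mem_sep, hR a (hsub ha') ξ hξ] at this
      exact ⟨ha', this.2.1 ha⟩
    · rintro ⟨ha', ha⟩
      have := H a ha'
      rw [fapp_lam ha', hC, ZFSet.mem_sep, hR a (hsub ha') ξ hξ] at this
      exact this.2.2 ha
  obtain ⟨ξ, hξ, h2⟩ := g.ex h1
  obtain ⟨η, hη, h3⟩ := g.ex (g.inter h1 (g.tail (g.ic.succ_mem hξ)))
  obtain ⟨h3, h4⟩ := ZFSet.mem_inter.1 h3
  refine ⟨ξ, hξ, η, hη, ?_, (key ξ hξ (ZFSet.mem_sep.1 h2).2).trans (key η hη (ZFSet.mem_sep.1 h3).2).symm⟩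
  rintro rfl
  exact (ZFSet.mem_sep.1 h4).2 (ZFSet.mem_insert _ _)

end

section

/-! ### `V_κ` and `H_{κ⁺}` -/

theorem zcard_eq (x : ZFSet.{u}) : zcard x = Cardinal.lift.{u+1} (ZFSet.card x) :=
  ZFSet.cardinalMk_coe_sort

theorem exists_ord_card {κ x : ZFSet.{u}} (h : IC κ) (hx : zcard x < zcard κ) :
    ∃ γ ∈ κ, zcard γ = zcard x := by
  have e : zcard (ZFSet.card x).ord.toZFSet = zcard x := by
    rw [zcard_eq, zcard_eq, Ordinal.card_toZFSet, Cardinal.card_ord]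
  exact ⟨_, h.mem_of_card_lt (ZFSet.isOrdinal_toZFSet _) (e ▸ hx), e⟩

theorem zcard_powerset (x : ZFSet.{u}) : zcard x.powerset = 2 ^ zcard x := by
  rw [zcard_eq, zcard_eq, ZFSet.card_powerset, Cardinal.lift_two_power]

theorem wsr_pow {κ x : ZFSet.{u}} (h : IsWeaklySuperRamseyCard κ) (hx : zcard x < zcard κ) :
    zcard x.powerset < zcard κ := by
  obtain ⟨γ, hγ, e⟩ := exists_ord_card (ic_of_wsr h) hx
  rw [zcard_powerset, ← e, ← zcard_powerset]
  by_contra hn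
  obtain ⟨f⟩ := Cardinal.le_def _ _ |>.1 (not_lt.1 hn)
  obtain ⟨ξ, hξ, η, hη, hne, he⟩ := wsr_strong h hγ
    (fun ξ => if hξ : ξ ∈ κ then (f ⟨ξ, hξ⟩).1 else ∅) (fun ξ hξ => by
      rw [dif_pos hξ]; exact ZFSet.mem_powerset.1 (f ⟨ξ, hξ⟩).2)
  simp only [dif_pos hξ, dif_pos hη] at he
  exact hne (congrArg Subtype.val (f.injective (Subtype.ext he)))

theorem vN_sub {α : ZFSet.{u}} (ho : α.IsOrdinal) :
    (V_ α.rank).toSet ⊆ ⋃ β ∈ α.toSet, (V_ β.rank).powerset.toSet := by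
  intro x hx
  obtain ⟨a, ha, hxa⟩ := ZFSet.mem_vonNeumann'.1 hx
  simp only [Set.mem_iUnion]
  have e := ho.toZFSet_rank_eq
  refine ⟨a.toZFSet, ?_, ?_⟩
  · show a.toZFSet ∈ α
    rw [← e]; exact Ordinal.toZFSet_mem_toZFSet_iff.2 ha
  · show x ∈ (V_ a.toZFSet.rank).powerset
    rw [ZFSet.mem_powerset, Ordinal.rank_toZFSet]; exact hxa

theorem biUnion_le {α : ZFSet.{u}} {F : ZFSet.{u} → ZFSet.{u}} {c : Cardinal.{u+1}}
    (hF : ∀ β ∈ α, zcard (F β) ≤ c) :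
    Cardinal.mk (⋃ β ∈ α.toSet, (F β).toSet : Set ZFSet.{u}) ≤ zcard α * c := by
  have h := Cardinal.mk_biUnion_le (fun β : ZFSet.{u} => (F β).toSet) α.toSet
  have h2 : (⨆ x : α.toSet, Cardinal.mk (F x.1).toSet) ≤ c := ciSup_le' (fun β => hF β.1 β.2)
  have h3 : zcard α * (⨆ x : α.toSet, Cardinal.mk (F x.1).toSet) ≤ zcard α * c := by gcongr
  exact h.trans h3

theorem wsr_vlt {κ : ZFSet.{u}} (h : IsWeaklySuperRamseyCard κ) :
    ∀ α ∈ κ, zcard (V_ α.rank) < zcard κ := by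
  have ic := ic_of_wsr h
  intro α
  induction α using ZFSet.inductionOn with
  | _ α ih =>
    intro hα
    have hm : ∀ β ∈ α, β ∈ κ := fun β hβ => ic.ord.mem_trans hβ hα
    have h1 : ∀ β, ∃ γ, β ∈ α → γ ∈ κ ∧ zcard γ = zcard (V_ β.rank).powerset := by
      intro β
      by_cases hβ : β ∈ α
      · obtain ⟨γ, h1, h2⟩ := exists_ord_card ic (wsr_pow h (ih β hβ (hm β hβ)))
        exact ⟨γ, fun _ => ⟨h1, h2⟩⟩
      · exact ⟨∅, fun h => absurd h hβ⟩
    choose F hF using h1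
    obtain ⟨ρ, hρ, hb⟩ := wsr_regular h hα F (fun a ha => (hF a ha).1)
    refine lt_of_le_of_lt ((Cardinal.mk_le_mk_of_subset (vN_sub (ic.ord.mem hα))).trans
      (biUnion_le (c := zcard ρ) ?_)) (Cardinal.mul_lt_of_lt ic.2 (ic.1.2 α hα) (ic.1.2 ρ hρ))
    intro β hβ
    rw [← (hF β hβ).2]
    exact zcard_mono ((ic.ord.mem hρ).subset_of_mem (hb β hβ))

theorem IC.mul_self {κ : ZFSet.{u}} (h : IC κ) : zcard κ * zcard κ = zcard κ :=
  Cardinal.mul_eq_self h.2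

theorem wsr_vk {κ : ZFSet.{u}} (h : IsWeaklySuperRamseyCard κ) :
    zcard (V_ κ.rank) ≤ zcard κ := by
  have ic := ic_of_wsr h
  refine (Cardinal.mk_le_mk_of_subset (vN_sub ic.ord)).trans
      ((biUnion_le (c := zcard κ) ?_).trans ic.mul_self.le)
  exact fun β hβ => (wsr_pow h (wsr_vlt h β hβ)).le

theorem mem_H {κ x : ZFSet.{u}} :
    x ∈ Hclass κ ↔ zcard x ≤ zcard κ ∧ ∀ y ∈ x, y ∈ Hclass κ := by
  show HeredLE κ x ↔ _
  rw [HeredLE, WellFounded.fix_eq]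
  rfl

theorem H_of_trans {κ t : ZFSet.{u}} (ht : t.IsTransitive) (hc : zcard t ≤ zcard κ) :
    t ∈ Hclass κ := by
  have : ∀ x, x ⊆ t → x ∈ Hclass κ := by
    intro x
    induction x using ZFSet.inductionOn with
    | _ x ih =>
      intro hx
      exact mem_H.2 ⟨(zcard_mono hx).trans hc, fun y hy => ih y hy (ht y (hx hy))⟩
  exact this t (fun _ h => h)

theorem H_sub {κ x y : ZFSet.{u}} (hx : x ∈ Hclass κ) (h : y ⊆ x) : y ∈ Hclass κ :=
  mem_H.2 ⟨(zcard_mono h).trans (mem_H.1 hx).1, fun z hz => (mem_H.1 hx).2 z (h hz)⟩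

theorem trC_H (κ : ZFSet.{u}) : TrC (Hclass κ) :=
  ⟨fun _ hx => (mem_H.1 hx).2, ⟨∅, H_of_trans ZFSet.isTransitive_empty
    (zcard_mono (ZFSet.empty_subset _))⟩⟩

theorem IC.one_le {κ : ZFSet.{u}} (h : IC κ) : 1 ≤ zcard κ := Cardinal.one_le_aleph0.trans h.2

theorem H_sUnion {κ x : ZFSet.{u}} (ic : IC κ) (hx : x ∈ Hclass κ) : (⋃₀ x : ZFSet) ∈ Hclass κ := by
  refine mem_H.2 ⟨?_, fun y hy => ?_⟩
  · have : (⋃₀ x : ZFSet).toSet ⊆ ⋃ β ∈ x.toSet, β.toSet := by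
      intro z hz
      obtain ⟨y, hy, hz⟩ := ZFSet.mem_sUnion.1 hz
      simp only [Set.mem_iUnion]
      exact ⟨y, hy, hz⟩
    refine (Cardinal.mk_le_mk_of_subset this).trans ((biUnion_le (F := fun y => y) (c := zcard κ)
      (fun β hβ => (mem_H.1 ((mem_H.1 hx).2 β hβ)).1)).trans ?_)
    exact (mul_le_mul_left (mem_H.1 hx).1 _).trans ic.mul_self.le
  · obtain ⟨z, hz, hy⟩ := ZFSet.mem_sUnion.1 hy
    exact (mem_H.1 ((mem_H.1 hx).2 z hz)).2 y hy

theorem H_insert {κ x y : ZFSet.{u}} (ic : IC κ) (hx : x ∈ Hclass κ) (hy : y ∈ Hclass κ) :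
    insert x y ∈ Hclass κ := by
  refine mem_H.2 ⟨(zcard_insert_le _ _).trans ?_, fun z hz => ?_⟩
  · exact (add_le_add (mem_H.1 hy).1 ic.one_le).trans (Cardinal.add_eq_self ic.2).le
  · rcases ZFSet.mem_insert_iff.1 hz with rfl | hz
    · exact hx
    · exact (mem_H.1 hy).2 z hz

theorem H_empty {κ : ZFSet.{u}} : ∅ ∈ Hclass κ := H_of_trans ZFSet.isTransitive_empty
    (zcard_mono (ZFSet.empty_subset _))

theorem H_sing {κ x : ZFSet.{u}} (ic : IC κ) (hx : x ∈ Hclass κ) : {x} ∈ Hclass κ := by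
  have := H_insert ic hx H_empty
  have e : (insert x ∅ : ZFSet) = {x} := by ext; simp
  rwa [e] at this

theorem H_upair {κ x y : ZFSet.{u}} (ic : IC κ) (hx : x ∈ Hclass κ) (hy : y ∈ Hclass κ) :
    {x, y} ∈ Hclass κ := H_insert ic hx (H_sing ic hy)

theorem H_pair {κ x y : ZFSet.{u}} (ic : IC κ) (hx : x ∈ Hclass κ) (hy : y ∈ Hclass κ) :
    ZFSet.pair x y ∈ Hclass κ := H_upair ic (H_sing ic hx) (H_upair ic hx hy)

theorem H_img {κ d : ZFSet.{u}} {F : ZFSet.{u} → ZFSet.{u}} (hd : zcard d ≤ zcard κ)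
    (h : ∀ x ∈ d, F x ∈ Hclass κ) : img d F ∈ Hclass κ := by
  refine mem_H.2 ⟨(zcard_img_le _ _).trans hd, fun y hy => ?_⟩
  obtain ⟨x, hx, rfl⟩ := mem_img.1 hy
  exact h x hx

theorem H_lam {κ d : ZFSet.{u}} {F : ZFSet.{u} → ZFSet.{u}} (ic : IC κ) (hd : d ∈ Hclass κ)
    (h : ∀ x ∈ d, F x ∈ Hclass κ) : lam d F ∈ Hclass κ :=
  H_img (mem_H.1 hd).1 (fun x hx => H_pair ic ((mem_H.1 hd).2 x hx) (h x hx))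

theorem H_union {κ x y : ZFSet.{u}} (ic : IC κ) (hx : x ∈ Hclass κ) (hy : y ∈ Hclass κ) :
    x ∪ y ∈ Hclass κ := by
  have : x ∪ y = (⋃₀ ({x, y} : ZFSet) : ZFSet) := by ext; simp
  rw [this]; exact H_sUnion ic (H_upair ic hx hy)

theorem H_kappa {κ : ZFSet.{u}} (ic : IC κ) : κ ∈ Hclass κ :=
  H_of_trans ic.ord.isTransitive le_rfl

theorem H_V {κ : ZFSet.{u}} (h : IsWeaklySuperRamseyCard κ) : V_ κ.rank ∈ Hclass κ :=
  H_of_trans (ZFSet.isTransitive_vonNeumann _) (wsr_vk h)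

theorem H_tc {κ : ZFSet.{u}} (ic : IC κ) : ∀ x ∈ Hclass κ, ∃ t ∈ Hclass κ, t.IsTransitive ∧ x ∈ t := by
  intro x
  induction x using ZFSet.inductionOn with
  | _ x ih =>
    intro hx
    have : ∀ y, ∃ t, y ∈ x → t ∈ Hclass κ ∧ t.IsTransitive ∧ y ∈ t := by
      intro y
      by_cases hy : y ∈ x
      · obtain ⟨t, h⟩ := ih y hy ((mem_H.1 hx).2 y hy)
        exact ⟨t, fun _ => h⟩
      · exact ⟨∅, fun h => absurd h hy⟩
    choose T hT using this
    have h1 : (⋃₀ (img x T) : ZFSet) ∈ Hclass κ :=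
      H_sUnion ic (H_img (mem_H.1 hx).1 (fun y hy => (hT y hy).1))
    refine ⟨insert x (⋃₀ (img x T) : ZFSet), H_insert ic hx h1, ?_, ZFSet.mem_insert _ _⟩
    intro z hz w hw
    refine ZFSet.mem_insert_of_mem _ (ZFSet.mem_sUnion.2 ?_)
    rcases ZFSet.mem_insert_iff.1 hz with rfl | hz
    · exact ⟨T w, mem_img.2 ⟨w, hw, rfl⟩, (hT w hw).2.2⟩
    · obtain ⟨t, ht, hz⟩ := ZFSet.mem_sUnion.1 hz
      obtain ⟨y, hy, rfl⟩ := mem_img.1 ht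
      exact ⟨_, ht, (hT y hy).2.1 z hz hw⟩

theorem surj_of_card {κ t x : ZFSet.{u}} (hx : x ∈ t) (hc : zcard t ≤ zcard κ) :
    ∃ F : ZFSet.{u} → ZFSet.{u}, (∀ ξ ∈ κ, F ξ ∈ t) ∧ ∀ y ∈ t, ∃ ξ ∈ κ, F ξ = y := by
  obtain ⟨f⟩ := Cardinal.le_def _ _ |>.1 hc
  have : Nonempty t.toSet := ⟨⟨x, hx⟩⟩
  refine ⟨fun ξ => if h : ξ ∈ κ then (Function.invFun f ⟨ξ, h⟩).1 else ∅, ?_, ?_⟩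
  · intro ξ hξ; beta_reduce; rw [dif_pos hξ]; exact (Function.invFun f ⟨ξ, hξ⟩).2
  · intro y hy
    have hm : (f ⟨y, hy⟩).1 ∈ κ := (f ⟨y, hy⟩).2
    refine ⟨(f ⟨y, hy⟩).1, hm, ?_⟩
    beta_reduce
    rw [dif_pos hm]
    exact congrArg Subtype.val (Function.leftInverse_invFun f.injective ⟨y, hy⟩)

/-- every element of `H_{κ⁺}` is coded by a subset of `κ` -/
theorem H_code {κ x : ZFSet.{u}} (ic : IC κ) (hx : x ∈ Hclass κ) :
    ∃ A, A ⊆ κ ∧ ∀ M, IsTransModel M → κ ∈ M → A ∈ M → x ∈ M := by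
  obtain ⟨t, htH, ht, hxt⟩ := H_tc ic x hx
  obtain ⟨F, h1, h2⟩ := surj_of_card hxt (mem_H.1 htH).1
  refine ⟨code κ F, code_sub, fun M hM hκ hA => ?_⟩
  obtain ⟨ξ, hξ, rfl⟩ := h2 x hxt
  exact decode hM hκ ic (fun ξ hξ z hz => h2 z (ht _ (h1 ξ hξ) hz)) hA ξ hξ

theorem elem_iff {𝒟 : Set (Set ZFSet.{u})} {D E : Set ZFSet.{u}} (he : ElemSub D E) (hD : D ∈ 𝒟)
    (hE : E ∈ 𝒟) (tD : TrC D) (tE : TrC E)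
    {R : Set ZFSet.{u} → (ℕ → ZFSet.{u}) → Prop} (hR : Df 𝒟 R) (v : ℕ → ZFSet.{u})
    (hv : ∀ n, v n ∈ D) : R D v ↔ R E v := by
  obtain ⟨φ, F, w, h1, h2, h3, h4⟩ := hR {n | n % 2 = 0} (fun n => 2 * n)
    (Set.infinite_of_injective_forall_mem (f := fun n => 2 * n + 1)
      (fun a b h => by simpa using h) (fun n => by simp)) (fun n => by simp)
  let v' : ℕ → ZFSet.{u} := fun n => if n ∈ F then w n else v (n / 2)
  have hv' : ∀ n, v' n ∈ D := by
    intro n; simp only [v']; split_ifs with h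
    · exact h3 D hD n h
    · exact hv _
  have hF : ∀ n ∈ F, v' n = w n := fun n hn => if_pos hn
  have e : (fun n => v' (2 * n)) = v := by
    funext n
    have : 2 * n ∉ F := fun h => Set.disjoint_left.1 h2 h (by simp)
    simp only [v', if_neg this]
    congr 1; omega
  have a := h4 D hD tD v' hv' hF
  have b := h4 E hE tE v' (fun n => he.1 (hv' n)) hF
  rw [e] at a b
  rw [← a, ← b]
  exact he.2 φ v' hv'

/-- the data for a Ramsey measure -/
structure GP (κ M U : ZFSet.{u}) : Prop extends GU κ M U where
  hV : V_ κ.rank ∈ M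
  nice : Nice κ M

/-- an elementary submodel with a measure -/
structure GE (κ M U : ZFSet.{u}) : Prop extends GP κ M U where
  card : zcard M = zcard κ
  el : ElemSub M.toSet (Hclass κ)

/-- the family used for elementarity -/
def fam (κ M : ZFSet.{u}) : Set (Set ZFSet.{u}) := {M.toSet, Hclass κ}

theorem dt_const {κ M p : ZFSet.{u}} (el : ElemSub M.toSet (Hclass κ)) (h : p ∈ M) :
    DT (fam κ M) (fun _ _ => p) := by
  refine DT.const ?_
  rintro D (rfl | rfl)
  · exact h
  · exact el.1 h

theorem elem_fam {κ M : ZFSet.{u}} (hM : IsTransModel M) (el : ElemSub M.toSet (Hclass κ))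
    {R : Set ZFSet.{u} → (ℕ → ZFSet.{u}) → Prop} (hR : Df (fam κ M) R) (v : ℕ → ZFSet.{u})
    (hv : ∀ n, v n ∈ M) : R M.toSet v ↔ R (Hclass κ) v :=
  elem_iff el (Or.inl rfl) (Or.inr rfl) hM.trC (trC_H κ) hR v hv

theorem exists_GE {κ x : ZFSet.{u}} (h : IsWeaklySuperRamseyCard κ) (hx : x ∈ Hclass κ) :
    ∃ M U, GE κ M U ∧ x ∈ M := by
  have ic := ic_of_wsr h
  obtain ⟨A, hA, hA'⟩ := H_code ic (H_pair ic hx (H_V h))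
  obtain ⟨M, U, g, hAM, hc, el⟩ := wsr_gu h hA
  obtain ⟨h1, h2⟩ := g.hM.of_pair (hA' M g.hM g.hκ hAM)
  refine ⟨M, U, ⟨⟨g, h2, ?_⟩, hc, el⟩, h1⟩
  intro y hy
  have hk := dt_const el g.hκ
  have key := elem_fam g.hM el (R := fun D v => ∃ t ∈ D, v 0 ∈ t ∧ (∀ a ∈ t, a ⊆ t) ∧
    ∃ f ∈ D, IsZFunc κ f ∧ (∀ a ∈ κ, fapp f a ∈ t) ∧ ∀ b ∈ t, ∃ a ∈ κ, fapp f a = b) (by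
      refine Df.ex (Df.and (Df.mem (DT.var 1) (DT.var 0)) (Df.and (by (repeat' first | assumption | exact DT.constM (by assumption) | exact DT.var _ | exact DT.empty | apply DT.fapp | apply DT.union | apply DT.inter | apply DT.sUnion | apply DT.tail | apply DT.compl | apply DT.sep | apply DT.constM | apply Df.pair_mem | apply Df.eq_pair | apply Df.mem | apply Df.eq | apply Df.subset | apply Df.and | apply Df.or | apply Df.iff | apply Df.not | apply Df.imp | apply Df.allM | apply Df.exM | apply Df.ball | apply Df.bex | apply Df.all | apply Df.ex | exact Df.prop _)) (Df.ex (Df.and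
        (Df.isZFunc hk (DT.var 0)) (by (repeat' first | assumption | exact DT.constM (by assumption) | exact DT.var _ | exact DT.empty | apply DT.fapp | apply DT.union | apply DT.inter | apply DT.sUnion | apply DT.tail | apply DT.compl | apply DT.sep | apply DT.constM | apply Df.pair_mem | apply Df.eq_pair | apply Df.mem | apply Df.eq | apply Df.subset | apply Df.and | apply Df.or | apply Df.iff | apply Df.not | apply Df.imp | apply Df.allM | apply Df.exM | apply Df.ball | apply Df.bex | apply Df.all | apply Df.ex | exact Df.prop _))))))) (fun _ => y) (fun _ => hy)
  obtain ⟨t, ht, h3, h4, f, hf, h5, h6, h7⟩ := key.2 (by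
    obtain ⟨t, htH, ht, hxt⟩ := H_tc ic y (el.1 hy)
    obtain ⟨F, h1, h2⟩ := surj_of_card hxt (mem_H.1 htH).1
    refine ⟨t, htH, hxt, ht, lam κ F, H_lam ic (H_kappa ic) (fun ξ hξ => (mem_H.1 htH).2 _ (h1 ξ hξ)),
      isZFunc_lam _ _, fun a ha => by rw [fapp_lam ha]; exact h1 a ha, fun b hb => ?_⟩
    obtain ⟨a, ha, e⟩ := h2 b hb
    exact ⟨a, ha, by rw [fapp_lam ha]; exact e⟩)
  exact ⟨t, ht, h3, h4, f, hf, h5, h6, h7⟩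

end

section

/-! ### Łoś maps -/

/-- finite assignments -/
def vc (l : List ZFSet.{u}) : ℕ → ZFSet.{u} := fun n => l.getD n (l.headD ∅)

theorem vc_all {P : ZFSet.{u} → Prop} {l : List ZFSet.{u}} (hl : l ≠ []) (h : ∀ x ∈ l, P x) :
    ∀ n, P (vc l n) := by
  intro n
  cases l with
  | nil => exact absurd rfl hl
  | cons a l =>
    simp only [vc, List.headD_cons, List.getD_eq_getElem?_getD]
    by_cases hn : n < (a :: l).length
    · rw [List.getElem?_eq_getElem hn]; exact h _ (List.getElem_mem hn)
    · rw [List.getElem?_eq_none (not_lt.1 hn)]; exact h a (by simp)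

theorem Df.formula {R : Set ZFSet.{u} → (ℕ → ZFSet.{u}) → Prop} (h : Df Set.univ R) :
    ∃ φ : Fml, ∀ D, TrC D → ∀ v : ℕ → ZFSet.{u}, (∀ n, v n ∈ D) →
      (Sat D φ (fun n => v (n / 2)) ↔ R D v) := by
  obtain ⟨φ, F, w, h1, h2, h3, h4⟩ := h {n | n % 2 = 0} (fun n => 2 * n)
    (Set.infinite_of_injective_forall_mem (f := fun n => 2 * n + 1)
      (fun a b h => by simpa using h) (fun n => by simp)) (fun n => by simp)
  refine ⟨φ, fun D hD v hv => ?_⟩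
  have e : (fun n => v (2 * n / 2)) = v := by
    funext n; congr 1; omega
  have := h4 D trivial hD (fun n => v (n / 2)) (fun n => hv _)
    (fun n hn => absurd (h3 ∅ trivial n hn) (Set.notMem_empty _))
  rw [this]; beta_reduce; rw [e]

/-- An abstract ultrapower with its Łoś theorem -/
structure Los (κ M U N : ZFSet.{u}) (π : ZFSet.{u} → ZFSet.{u}) : Prop where
  tr : N.IsTransitive
  mem : ∀ f ∈ M, IsZFunc κ f → π f ∈ N
  surj : ∀ a ∈ N, ∃ f ∈ M, IsZFunc κ f ∧ π f = a
  los : ∀ (φ : Fml) (v : ℕ → ZFSet.{u}), (∀ n, v n ∈ M ∧ IsZFunc κ (v n)) →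
    (Sat N.toSet φ (fun n => π (v n)) ↔
      ZFSet.sep (fun ξ => Sat M.toSet φ (fun n => fapp (v n) ξ)) κ ∈ U)

section
variable {κ M U N : ZFSet.{u}} {π : ZFSet.{u} → ZFSet.{u}}

theorem df_sat {φ : Fml} {t : ℕ → (ℕ → ZFSet.{u}) → ZFSet.{u}}
    (h : ∀ n, DT {M.toSet} (fun _ v => t n v)) :
    Df {M.toSet} (fun _ v => Sat M.toSet φ (fun n => t n v)) := by
  refine (Df.sat φ (fun n _ v => t n v) h).congr ?_
  rintro D rfl _ v hv
  rfl

theorem sep_sat (hM : IsTransModel M) (hκ : κ ∈ M) {φ : Fml} {v : ℕ → ZFSet.{u}}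
    (h : ∀ n, v n ∈ M) : ZFSet.sep (fun ξ => Sat M.toSet φ (fun n => fapp (v n) ξ)) κ ∈ M := by
  refine hM.sep (df_sat (fun n => ?_)) hκ
  have := h n
  (repeat' first | assumption | exact DT.constM (by assumption) | exact DT.var _ | exact DT.empty | apply DT.fapp | apply DT.union | apply DT.inter | apply DT.sUnion | apply DT.tail | apply DT.compl | apply DT.sep | apply DT.constM | apply Df.pair_mem | apply Df.eq_pair | apply Df.mem | apply Df.eq | apply Df.subset | apply Df.and | apply Df.or | apply Df.iff | apply Df.not | apply Df.imp | apply Df.allM | apply Df.exM | apply Df.ball | apply Df.bex | apply Df.all | apply Df.ex | exact Df.prop _)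

theorem los_of_emb {j : ZFSet.{u} → ZFSet.{u}} (hM : IsTransModel M) (hκ : κ ∈ M)
    (hU : κ ∈ U) (h : IsUltrapowerEmb κ M U N j) :
    Los κ M U N (fun f => fapp (j f) κ) := by
  obtain ⟨h1, h2, h3, h4, h5⟩ := h
  have tN : TrC N.toSet := ⟨fun x hx y hy => h1 x hx hy, ⟨_, h2 κ hκ⟩⟩
  have el : ∀ {R : Set ZFSet.{u} → (ℕ → ZFSet.{u}) → Prop}, Df Set.univ R → ∀ v : ℕ → ZFSet.{u},
      (∀ n, v n ∈ M) → (R M.toSet v ↔ R N.toSet (fun n => j (v n))) := by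
    intro R hR v hv
    obtain ⟨φ, hφ⟩ := hR.formula
    rw [← hφ _ hM.trC v hv, ← hφ _ tN (fun n => j (v n)) (fun n => h2 _ (hv n))]
    exact h3 φ _ (fun n => hv _)
  have hκj : κ ∈ j κ := (h5 κ hκ (fun _ h => h)).1 hU
  refine ⟨h1, ?_, ?_, ?_⟩
  · intro f hf hz
    have := (el (R := fun D v => ∀ ξ ∈ v 0, ∃ y ∈ D, y = fapp (v 1) ξ) (by (repeat' first | assumption | exact DT.constM (by assumption) | exact DT.var _ | exact DT.empty | apply DT.fapp | apply DT.union | apply DT.inter | apply DT.sUnion | apply DT.tail | apply DT.compl | apply DT.sep | apply DT.constM | apply Df.pair_mem | apply Df.eq_pair | apply Df.mem | apply Df.eq | apply Df.subset | apply Df.and | apply Df.or | apply Df.iff | apply Df.not | apply Df.imp | apply Df.allM | apply Df.exM | apply Df.ball | apply Df.bex | apply Df.all | apply Df.ex | exact Df.prop _)) (vc [κ, f])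
      (vc_all (P := (· ∈ M)) (by simp) (by simp [hκ, hf]))).1 (by
        intro ξ hξ
        exact ⟨_, hM.fapp hf (hM.tr hκ hξ), rfl⟩) κ hκj
    obtain ⟨y, hy, e⟩ := this
    have e' : y = fapp (j f) κ := e
    exact e' ▸ hy
  · intro a ha
    obtain ⟨f, hf, hz, -, e⟩ := h4 a ha
    exact ⟨f, hf, hz, e⟩
  · intro φ v hv
    have hA := sep_sat hM hκ (φ := φ) (fun n => (hv n).1)
    obtain ⟨A, hAe⟩ : ∃ A, A = ZFSet.sep (fun ξ => Sat M.toSet φ (fun n => fapp (v n) ξ)) κ := ⟨_, rfl⟩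
    rw [← hAe] at hA ⊢
    have hs : A ⊆ κ := by rw [hAe]; exact sep_sub
    rw [h5 A hA hs]
    have := (el (R := fun D w => ∀ ξ ∈ w 0, (ξ ∈ w 1 ↔ Sat D φ (fun n => fapp (w (n + 2)) ξ)))
      (by
        refine Df.ball (DT.var 0) (Df.iff (by (repeat' first | assumption | exact DT.constM (by assumption) | exact DT.var _ | exact DT.empty | apply DT.fapp | apply DT.union | apply DT.inter | apply DT.sUnion | apply DT.tail | apply DT.compl | apply DT.sep | apply DT.constM | apply Df.pair_mem | apply Df.eq_pair | apply Df.mem | apply Df.eq | apply Df.subset | apply Df.and | apply Df.or | apply Df.iff | apply Df.not | apply Df.imp | apply Df.allM | apply Df.exM | apply Df.ball | apply Df.bex | apply Df.all | apply Df.ex | exact Df.prop _)) (Df.sat φ _ (fun n => ?_)))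
        (repeat' first | assumption | exact DT.constM (by assumption) | exact DT.var _ | exact DT.empty | apply DT.fapp | apply DT.union | apply DT.inter | apply DT.sUnion | apply DT.tail | apply DT.compl | apply DT.sep | apply DT.constM | apply Df.pair_mem | apply Df.eq_pair | apply Df.mem | apply Df.eq | apply Df.subset | apply Df.and | apply Df.or | apply Df.iff | apply Df.not | apply Df.imp | apply Df.allM | apply Df.exM | apply Df.ball | apply Df.bex | apply Df.all | apply Df.ex | exact Df.prop _)) (cons κ (cons A v)) (by
          rintro (_ | _ | n)
          · exact hκ
          · exact hA
          · exact (hv n).1)).1 (by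
            intro ξ hξ
            show ξ ∈ A ↔ Sat M.toSet φ (fun n => fapp (v n) ξ)
            rw [hAe, ZFSet.mem_sep]
            exact ⟨fun h => h.2, fun h => ⟨hξ, h⟩⟩) κ hκj
    exact this.symm

/-- constant function -/
def kf (κ x : ZFSet.{u}) : ZFSet.{u} := lam κ (fun _ => x)
/-- identity function -/
def idf (κ : ZFSet.{u}) : ZFSet.{u} := lam κ (fun x => x)

theorem kf_mem (hM : IsTransModel M) (hκ : κ ∈ M) {x : ZFSet.{u}} (hx : x ∈ M) : kf κ x ∈ M :=
  hM.lam (by (repeat' first | assumption | exact DT.constM (by assumption) | exact DT.var _ | exact DT.empty | apply DT.fapp | apply DT.union | apply DT.inter | apply DT.sUnion | apply DT.tail | apply DT.compl | apply DT.sep | apply DT.constM | apply Df.pair_mem | apply Df.eq_pair | apply Df.mem | apply Df.eq | apply Df.subset | apply Df.and | apply Df.or | apply Df.iff | apply Df.not | apply Df.imp | apply Df.allM | apply Df.exM | apply Df.ball | apply Df.bex | apply Df.all | apply Df.ex | exact Df.prop _)) hκ (fun _ _ => hx)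
theorem idf_mem (hM : IsTransModel M) (hκ : κ ∈ M) : idf κ ∈ M :=
  hM.lam (by (repeat' first | assumption | exact DT.constM (by assumption) | exact DT.var _ | exact DT.empty | apply DT.fapp | apply DT.union | apply DT.inter | apply DT.sUnion | apply DT.tail | apply DT.compl | apply DT.sep | apply DT.constM | apply Df.pair_mem | apply Df.eq_pair | apply Df.mem | apply Df.eq | apply Df.subset | apply Df.and | apply Df.or | apply Df.iff | apply Df.not | apply Df.imp | apply Df.allM | apply Df.exM | apply Df.ball | apply Df.bex | apply Df.all | apply Df.ex | exact Df.prop _)) hκ (fun _ h => hM.tr hκ h)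
theorem kf_func (x : ZFSet.{u}) : IsZFunc κ (kf κ x) := isZFunc_lam _ _
theorem idf_func : IsZFunc κ (idf κ) := isZFunc_lam _ _
theorem kf_app {x ξ : ZFSet.{u}} (h : ξ ∈ κ) : fapp (kf κ x) ξ = x := fapp_lam h
theorem idf_app {ξ : ZFSet.{u}} (h : ξ ∈ κ) : fapp (idf κ) ξ = ξ := fapp_lam h

theorem sep_congr {P Q : ZFSet.{u} → Prop} (h : ∀ ξ ∈ κ, (P ξ ↔ Q ξ)) :
    ZFSet.sep P κ = ZFSet.sep Q κ := by
  ext x; rw [ZFSet.mem_sep, ZFSet.mem_sep]; exact and_congr_right (h x)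

theorem Los.trC (L : Los κ M U N π) (g : GU κ M U) : TrC N.toSet :=
  ⟨fun x hx y hy => L.tr x hx hy, ⟨_, L.mem _ (idf_mem g.hM g.hκ) idf_func⟩⟩

theorem Los.df (L : Los κ M U N π) (g : GU κ M U)
    {R : Set ZFSet.{u} → (ℕ → ZFSet.{u}) → Prop} (hR : Df Set.univ R) (v : ℕ → ZFSet.{u})
    (hv : ∀ n, v n ∈ M ∧ IsZFunc κ (v n)) :
    R N.toSet (fun n => π (v n)) ↔ ZFSet.sep (fun ξ => R M.toSet (fun n => fapp (v n) ξ)) κ ∈ U := by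
  obtain ⟨φ, hφ⟩ := hR.formula
  rw [← hφ _ (L.trC g) _ (fun n => L.mem _ (hv n).1 (hv n).2)]
  rw [L.los φ (fun n => v (n / 2)) (fun n => hv _)]
  rw [sep_congr (κ := κ)]
  intro ξ hξ
  exact hφ _ g.hM.trC _ (fun n => g.hM.fapp (hv n).1 (g.hM.tr g.hκ hξ))

/-- same, with explicit finite lists -/
theorem Los.dfl (L : Los κ M U N π) (g : GU κ M U) (l : List ZFSet.{u})
    (hv : ∀ x ∈ l, x ∈ M ∧ IsZFunc κ x) (hl : l ≠ [])
    {R : Set ZFSet.{u} → (ℕ → ZFSet.{u}) → Prop} (hR : Df Set.univ R)  :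
    R N.toSet (fun n => π (vc l n)) ↔ ZFSet.sep (fun ξ => R M.toSet (fun n => fapp (vc l n) ξ)) κ ∈ U :=
  L.df g hR _ (vc_all (P := fun x => x ∈ M ∧ IsZFunc κ x) hl hv)

theorem Los.mem_iff (L : Los κ M U N π) (g : GU κ M U) {f h : ZFSet.{u}} (hf : f ∈ M) (hf' : IsZFunc κ f)
    (hh : h ∈ M) (hh' : IsZFunc κ h) :
    π f ∈ π h ↔ ZFSet.sep (fun ξ => fapp f ξ ∈ fapp h ξ) κ ∈ U :=
  L.dfl g [f, h] (by simp [hf, hf', hh, hh']) (by simp)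
    (R := fun D v => v 0 ∈ v 1) (by (repeat' first | assumption | exact DT.constM (by assumption) | exact DT.var _ | exact DT.empty | apply DT.fapp | apply DT.union | apply DT.inter | apply DT.sUnion | apply DT.tail | apply DT.compl | apply DT.sep | apply DT.constM | apply Df.pair_mem | apply Df.eq_pair | apply Df.mem | apply Df.eq | apply Df.subset | apply Df.and | apply Df.or | apply Df.iff | apply Df.not | apply Df.imp | apply Df.allM | apply Df.exM | apply Df.ball | apply Df.bex | apply Df.all | apply Df.ex | exact Df.prop _))

theorem Los.eq_iff (L : Los κ M U N π) (g : GU κ M U) {f h : ZFSet.{u}} (hf : f ∈ M) (hf' : IsZFunc κ f)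
    (hh : h ∈ M) (hh' : IsZFunc κ h) :
    π f = π h ↔ ZFSet.sep (fun ξ => fapp f ξ = fapp h ξ) κ ∈ U :=
  L.dfl g [f, h] (by simp [hf, hf', hh, hh']) (by simp)
    (R := fun D v => v 0 = v 1) (by (repeat' first | assumption | exact DT.constM (by assumption) | exact DT.var _ | exact DT.empty | apply DT.fapp | apply DT.union | apply DT.inter | apply DT.sUnion | apply DT.tail | apply DT.compl | apply DT.sep | apply DT.constM | apply Df.pair_mem | apply Df.eq_pair | apply Df.mem | apply Df.eq | apply Df.subset | apply Df.and | apply Df.or | apply Df.iff | apply Df.not | apply Df.imp | apply Df.allM | apply Df.exM | apply Df.ball | apply Df.bex | apply Df.all | apply Df.ex | exact Df.prop _))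

theorem Los.kf_of_lt (L : Los κ M U N π) (g : GU κ M U) : ∀ γ ∈ κ, π (kf κ γ) = γ := by
  intro γ
  induction γ using ZFSet.inductionOn with
  | _ γ ih =>
    intro hγ
    have hγM := g.hM.tr g.hκ hγ
    ext z
    constructor
    · intro hz
      obtain ⟨f, hf, hff, rfl⟩ := L.surj z (L.tr _ (L.mem _ (kf_mem g.hM g.hκ hγM) (kf_func _)) hz)
      have h1 := (L.mem_iff g hf hff (kf_mem g.hM g.hκ hγM) (kf_func _)).1 hz
      rw [sep_congr (Q := fun ξ => fapp f ξ ∈ γ) (fun ξ hξ => by rw [kf_app hξ])] at h1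
      have h2 := g.and h1 (g.tail hγ)
      have h3 := g.imp h2 (Q := fun ξ => fapp f ξ ∈ ξ) (g.hM.sep (by (repeat' first | assumption | exact DT.constM (by assumption) | exact DT.var _ | exact DT.empty | apply DT.fapp | apply DT.union | apply DT.inter | apply DT.sUnion | apply DT.tail | apply DT.compl | apply DT.sep | apply DT.constM | apply Df.pair_mem | apply Df.eq_pair | apply Df.mem | apply Df.eq | apply Df.subset | apply Df.and | apply Df.or | apply Df.iff | apply Df.not | apply Df.imp | apply Df.allM | apply Df.exM | apply Df.ball | apply Df.bex | apply Df.all | apply Df.ex | exact Df.prop _)) g.hκ) (by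
        rintro ξ hξ ⟨h, h'⟩
        exact ((g.ic.ord.mem hξ).notMem_iff_subset (g.ic.ord.mem hγ)).1 h' h)
      obtain ⟨δ, hδ, h4⟩ := g.normal hf hff h3
      obtain ⟨ξ, hξ, h5, h6⟩ := g.ex2 h1 h4
      have hδγ : δ ∈ γ := h6 ▸ h5
      have hδM := g.hM.tr hγM hδγ
      have : π f = π (kf κ δ) := by
        rw [L.eq_iff g hf hff (kf_mem g.hM g.hκ hδM) (kf_func _)]
        rwa [sep_congr (Q := fun ξ => fapp f ξ = δ) (fun ξ hξ => by rw [kf_app hξ])]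
      rw [this, ih δ hδγ hδ]; exact hδγ
    · intro hz
      have hzM := g.hM.tr hγM hz
      rw [← ih z hz (g.ic.ord.mem_trans hz hγ)]
      rw [L.mem_iff g (kf_mem g.hM g.hκ hzM) (kf_func _) (kf_mem g.hM g.hκ hγM) (kf_func _)]
      exact g.sep_self (fun ξ hξ => by rw [kf_app hξ, kf_app hξ]; exact hz)

theorem Los.idf_eq (L : Los κ M U N π) (g : GU κ M U) : π (idf κ) = κ := by
  have hi := idf_mem g.hM g.hκ
  ext z
  constructor
  · intro hz
    obtain ⟨f, hf, hff, rfl⟩ := L.surj z (L.tr _ (L.mem _ hi idf_func) hz)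
    have h1 := (L.mem_iff g hf hff hi idf_func).1 hz
    rw [sep_congr (Q := fun ξ => fapp f ξ ∈ ξ) (fun ξ hξ => by rw [idf_app hξ])] at h1
    obtain ⟨δ, hδ, h4⟩ := g.normal hf hff h1
    have hδM := g.hM.tr g.hκ hδ
    have : π f = π (kf κ δ) := by
      rw [L.eq_iff g hf hff (kf_mem g.hM g.hκ hδM) (kf_func _)]
      rwa [sep_congr (Q := fun ξ => fapp f ξ = δ) (fun ξ hξ => by rw [kf_app hξ])]
    rw [this, L.kf_of_lt g δ hδ]; exact hδ
  · intro hz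
    have hzM := g.hM.tr g.hκ hz
    rw [← L.kf_of_lt g z hz, L.mem_iff g (kf_mem g.hM g.hκ hzM) (kf_func _) hi idf_func]
    refine g.imp (g.tail (g.ic.succ_mem hz)) (g.hM.sep ?_ g.hκ) ?_
    · have := kf_mem g.hM g.hκ hzM
      (repeat' first | assumption | exact DT.constM (by assumption) | exact DT.var _ | exact DT.empty | apply DT.fapp | apply DT.union | apply DT.inter | apply DT.sUnion | apply DT.tail | apply DT.compl | apply DT.sep | apply DT.constM | apply Df.pair_mem | apply Df.eq_pair | apply Df.mem | apply Df.eq | apply Df.subset | apply Df.and | apply Df.or | apply Df.iff | apply Df.not | apply Df.imp | apply Df.allM | apply Df.exM | apply Df.ball | apply Df.bex | apply Df.all | apply Df.ex | exact Df.prop _)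
    · intro ξ hξ h
      rw [kf_app hξ, idf_app hξ]
      rcases (g.ic.ord.mem hξ).mem_trichotomous (g.ic.ord.mem hz) with h' | h' | h'
      · exact absurd (ZFSet.mem_insert_of_mem _ h') h
      · exact absurd (h' ▸ ZFSet.mem_insert _ _) h
      · exact h'
end

end

section

/-! ### Existence of ultrapowers -/

section
variable {κ M U N : ZFSet.{u}} {π : ZFSet.{u} → ZFSet.{u}}

/-- the functions in `M` -/
def upX (κ M : ZFSet.{u}) : ZFSet.{u} := ZFSet.sep (fun f => IsZFunc κ f) M
/-- the membership relation of the ultrapower -/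
def upE (κ M U : ZFSet.{u}) : ZFSet.{u} :=
  ZFSet.sep (fun p => ∃ f h, p = ZFSet.pair f h ∧ ZFSet.sep (fun ξ => fapp f ξ ∈ fapp h ξ) κ ∈ U)
    ((upX κ M).prod (upX κ M))

theorem mrel_up {f h : ZFSet.{u}} : mrel (upX κ M) (upE κ M U) f h ↔
    f ∈ upX κ M ∧ h ∈ upX κ M ∧ ZFSet.sep (fun ξ => fapp f ξ ∈ fapp h ξ) κ ∈ U := by
  unfold mrel upE
  simp only [ZFSet.mem_sep, ZFSet.pair_mem_prod, ZFSet.pair_inj]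
  constructor
  · rintro h
    obtain ⟨h1, h2, -, f', g', ⟨rfl, rfl⟩, h3⟩ := h
    tauto
  · rintro ⟨h1, h2, h3⟩
    tauto

theorem wf_of_noseq {α : Type*} {r : α → α → Prop} (h : ∀ s : ℕ → α, ¬ ∀ n, r (s (n+1)) (s n)) :
    WellFounded r := by
  rw [wellFounded_iff_isEmpty_descending_chain]
  exact ⟨fun e => h e.1 e.2⟩

theorem no_seq (s : ℕ → ZFSet.{u}) : ¬ ∀ n, s (n+1) ∈ s n := by
  intro h
  have : ∀ x : ZFSet.{u}, ∀ n, s n ≠ x := by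
    intro x
    induction x using ZFSet.inductionOn with
    | _ x ih =>
      intro n e
      exact ih _ (e ▸ h n) (n+1) rfl
  exact this _ 0 rfl

theorem up_wf (g : GU κ M U) : WellFounded (mrel (upX κ M) (upE κ M U)) := by
  refine wf_of_noseq (fun s hs => ?_)
  obtain ⟨x, hx⟩ := g.oi (fun n => ZFSet.sep (fun ξ => fapp (s (n+1)) ξ ∈ fapp (s n) ξ) κ)
    (fun n => (mrel_up.1 (hs n)).2.2)
  exact no_seq (fun n => fapp (s n) x) (fun n => (ZFSet.mem_sep.1 (hx n)).2)

theorem df_eq_mem (hκ : κ ∈ M) {f h : ZFSet.{u}} (hf : f ∈ M) (hh : h ∈ M) (hM : IsTransModel M) :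
    ZFSet.sep (fun ξ => fapp f ξ ∈ fapp h ξ) κ ∈ M ∧ ZFSet.sep (fun ξ => fapp f ξ = fapp h ξ) κ ∈ M :=
  ⟨hM.sep (by (repeat' first | assumption | exact DT.constM (by assumption) | exact DT.var _ | exact DT.empty | apply DT.fapp | apply DT.union | apply DT.inter | apply DT.sUnion | apply DT.tail | apply DT.compl | apply DT.sep | apply DT.constM | apply Df.pair_mem | apply Df.eq_pair | apply Df.mem | apply Df.eq | apply Df.subset | apply Df.and | apply Df.or | apply Df.iff | apply Df.not | apply Df.imp | apply Df.allM | apply Df.exM | apply Df.ball | apply Df.bex | apply Df.all | apply Df.ex | exact Df.prop _)) hκ, hM.sep (by (repeat' first | assumption | exact DT.constM (by assumption) | exact DT.var _ | exact DT.empty | apply DT.fapp | apply DT.union | apply DT.inter | apply DT.sUnion | apply DT.tail | apply DT.compl | apply DT.sep | apply DT.constM | apply Df.pair_mem | apply Df.eq_pair | apply Df.mem | apply Df.eq | apply Df.subset | apply Df.and | apply Df.or | apply Df.iff | apply Df.not | apply Df.imp | apply Df.allM | apply Df.exM | apply Df.ball | apply Df.bex | apply Df.all | apply Df.ex | exact Df.prop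 _)) hκ⟩

theorem up_eq (g : GU κ M U) (wf : WellFounded (mrel (upX κ M) (upE κ M U))) :
    ∀ f ∈ upX κ M, ∀ h ∈ upX κ M, (mcol wf f = mcol wf h ↔
      ZFSet.sep (fun ξ => fapp f ξ = fapp h ξ) κ ∈ U) := by
  have hback : ∀ f ∈ upX κ M, ∀ h ∈ upX κ M, ZFSet.sep (fun ξ => fapp f ξ = fapp h ξ) κ ∈ U →
      ∀ z, z ∈ mcol wf f → z ∈ mcol wf h := by
    intro f hf h hh he z hz
    obtain ⟨q, hq, rfl⟩ := (mem_mcol wf).1 hz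
    obtain ⟨h1, h2, h3⟩ := mrel_up.1 hq
    refine (mem_mcol wf).2 ⟨q, mrel_up.2 ⟨h1, hh, ?_⟩, rfl⟩
    refine g.imp (g.and he h3) (df_eq_mem g.hκ (ZFSet.mem_sep.1 h1).1 (ZFSet.mem_sep.1 hh).1 g.hM).1 ?_
    rintro ξ hξ ⟨e, h⟩
    rwa [← e]
  have hsym : ∀ {f h : ZFSet.{u}}, ZFSet.sep (fun ξ => fapp f ξ = fapp h ξ) κ ∈ U →
      ZFSet.sep (fun ξ => fapp h ξ = fapp f ξ) κ ∈ U := by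
    intro f h he
    rwa [sep_congr (Q := fun ξ => fapp f ξ = fapp h ξ) (fun ξ _ => eq_comm)]
  intro f
  induction f using wf.induction with
  | _ f ih =>
    intro hf h hh
    have hfM := (ZFSet.mem_sep.1 hf).1
    have hhM := (ZFSet.mem_sep.1 hh).1
    constructor
    · intro e
      by_contra hn
      have h1 := (g.not_iff (df_eq_mem g.hκ hfM hhM g.hM).2).2 hn
      obtain ⟨c, hc, hcf, hcP⟩ := g.hM.choice (a := κ) (P := fun ξ y => fapp f ξ ≠ fapp h ξ →
        ((y ∈ fapp f ξ ∧ y ∉ fapp h ξ) ∨ (y ∈ fapp h ξ ∧ y ∉ fapp f ξ))) (by (repeat' first | assumption | exact DT.constM (by assumption) | exact DT.var _ | exact DT.empty | apply DT.fapp | apply DT.union | apply DT.inter | apply DT.sUnion | apply DT.tail | apply DT.compl | apply DT.sep | apply DT.constM | apply Df.pair_mem | apply Df.eq_pair | apply Df.mem | apply Df.eq | apply Df.subset | apply Df.and | apply Df.or | apply Df.iff | apply Df.not | apply Df.imp | apply Df.allM | apply Df.exM | apply Df.ball | apply Df.bex | apply Df.all | apply Df.ex | exact Df.prop _)) g.hκ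 (by
          intro ξ hξ
          by_cases hne : fapp f ξ = fapp h ξ
          · exact ⟨ξ, g.hM.tr g.hκ hξ, fun h => absurd hne h⟩
          · by_contra hno
            push Not at hno
            apply hne
            ext y
            constructor
            · intro hy
              by_contra hy'
              have := hno y (g.hM.tr (g.hM.fapp hfM (g.hM.tr g.hκ hξ)) hy); tauto
            · intro hy
              by_contra hy'
              have := hno y (g.hM.tr (g.hM.fapp hhM (g.hM.tr g.hκ hξ)) hy); tauto)
      have hcX : c ∈ upX κ M := ZFSet.mem_sep.2 ⟨hc, hcf⟩
      have mf := (df_eq_mem g.hκ hc hfM g.hM).1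
      have mh := (df_eq_mem g.hκ hc hhM g.hM).1
      by_cases hcu : ZFSet.sep (fun ξ => fapp c ξ ∈ fapp f ξ) κ ∈ U
      · have hr := mrel_up.2 ⟨hcX, hf, hcu⟩
        have : mcol wf c ∈ mcol wf h := e ▸ (mem_mcol wf).2 ⟨c, hr, rfl⟩
        obtain ⟨q, hq, hqe⟩ := (mem_mcol wf).1 this
        obtain ⟨hq1, _, hq3⟩ := mrel_up.1 hq
        have := (ih c hr hcX q hq1).1 hqe.symm
        obtain ⟨ξ, hξ, ⟨a1, a2⟩, a3, a4⟩ := g.ex2 (g.and h1 hcu) (g.and this hq3)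
        rcases hcP ξ hξ a1 with b | b
        · exact b.2 (a3 ▸ a4)
        · exact b.2 a2
      · have hcu' := (g.not_iff mf).2 hcu
        have hch : ZFSet.sep (fun ξ => fapp c ξ ∈ fapp h ξ) κ ∈ U := g.imp (g.and h1 hcu') mh (by
          rintro ξ hξ ⟨a1, a2⟩
          rcases hcP ξ hξ a1 with b | b
          · exact absurd b.1 a2
          · exact b.1)
        have : mcol wf c ∈ mcol wf f := e ▸ (mem_mcol wf).2 ⟨c, mrel_up.2 ⟨hcX, hh, hch⟩, rfl⟩
        obtain ⟨q, hq, hqe⟩ := (mem_mcol wf).1 this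
        obtain ⟨hq1, _, hq3⟩ := mrel_up.1 hq
        have := (ih q hq hq1 c hcX).1 hqe
        obtain ⟨ξ, hξ, ⟨a1, a2⟩, a3, a4⟩ := g.ex2 (g.and h1 hcu') (g.and this hq3)
        exact a2 (a3 ▸ a4)
    · intro e
      ext z
      exact ⟨hback f hf h hh e z, hback h hh f hf (hsym e) z⟩

theorem up_mem (g : GU κ M U) (wf : WellFounded (mrel (upX κ M) (upE κ M U)))
    {f h : ZFSet.{u}} (hf : f ∈ upX κ M) (hh : h ∈ upX κ M) : (mcol wf f ∈ mcol wf h ↔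
      ZFSet.sep (fun ξ => fapp f ξ ∈ fapp h ξ) κ ∈ U) := by
  constructor
  · intro hz
    obtain ⟨q, hq, e⟩ := (mem_mcol wf).1 hz
    obtain ⟨h1, h2, h3⟩ := mrel_up.1 hq
    have := (up_eq g wf q h1 f hf).1 e
    refine g.imp (g.and this h3) (df_eq_mem g.hκ (ZFSet.mem_sep.1 hf).1 (ZFSet.mem_sep.1 hh).1 g.hM).1 ?_
    rintro ξ hξ ⟨e, h⟩
    rwa [← e]
  · intro hu
    exact (mem_mcol wf).2 ⟨f, mrel_up.2 ⟨hf, hh, hu⟩, rfl⟩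

theorem exists_los (g : GU κ M U) : ∃ N π, Los κ M U N π := by
  have wf := up_wf g
  have hX : ∀ {f}, f ∈ upX κ M ↔ f ∈ M ∧ IsZFunc κ f := ZFSet.mem_sep
  refine ⟨img (upX κ M) (mcol wf), mcol wf, ?_, ?_, ?_, ?_⟩
  · intro x hx y hy
    obtain ⟨f, hf, rfl⟩ := mem_img.1 hx
    obtain ⟨q, hq, rfl⟩ := (mem_mcol wf).1 hy
    exact mem_img.2 ⟨q, (mrel_up.1 hq).1, rfl⟩
  · intro f hf hz
    exact mem_img.2 ⟨f, hX.2 ⟨hf, hz⟩, rfl⟩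
  · intro a ha
    obtain ⟨f, hf, rfl⟩ := mem_img.1 ha
    exact ⟨f, (hX.1 hf).1, (hX.1 hf).2, rfl⟩
  · intro φ
    induction φ with
    | mem i j => intro v hv; exact up_mem g wf (hX.2 (hv i)) (hX.2 (hv j))
    | eq i j => intro v hv; exact up_eq g wf _ (hX.2 (hv i)) _ (hX.2 (hv j))
    | impl φ ψ ih1 ih2 =>
      intro v hv
      have m1 := sep_sat g.hM g.hκ (φ := φ) (fun n => (hv n).1)
      have m2 := sep_sat g.hM g.hκ (φ := ψ) (fun n => (hv n).1)
      have m3 := sep_sat g.hM g.hκ (φ := φ.impl ψ) (fun n => (hv n).1)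
      show (Sat _ φ _ → Sat _ ψ _) ↔ _
      rw [ih1 v hv, ih2 v hv]
      constructor
      · intro h
        by_cases h1 : ZFSet.sep (fun ξ => Sat M.toSet φ (fun n => fapp (v n) ξ)) κ ∈ U
        · exact g.imp (h h1) m3 (fun ξ _ h _ => h)
        · exact g.imp ((g.not_iff m1).2 h1) m3 (fun ξ _ h h' => absurd h' h)
      · intro h h1
        exact g.imp (g.and h h1) m2 (fun ξ _ h => h.1 h.2)
    | neg φ ih =>
      intro v hv
      have m1 := sep_sat g.hM g.hκ (φ := φ) (fun n => (hv n).1)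
      show (¬ Sat _ φ _) ↔ _
      rw [ih v hv]
      exact (g.not_iff m1).symm
    | all n φ ih =>
      intro v hv
      have m3 := sep_sat g.hM g.hκ (φ := φ.all n) (fun n => (hv n).1)
      have up : ∀ f, f ∈ M ∧ IsZFunc κ f → ∀ k, Function.update v n f k ∈ M ∧ IsZFunc κ (Function.update v n f k) := by
        intro f hf k
        by_cases hk : k = n
        · subst hk; rw [Function.update_self]; exact hf
        · rw [Function.update_of_ne hk]; exact hv k
      have e1 : ∀ f, (fun k => mcol wf (Function.update v n f k)) =
          Function.update (fun k => mcol wf (v k)) n (mcol wf f) := by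
        intro f; funext k
        by_cases hk : k = n
        · subst hk; simp
        · simp [hk]
      have e2 : ∀ f ξ, (fun k => fapp (Function.update v n f k) ξ) =
          Function.update (fun k => fapp (v k) ξ) n (fapp f ξ) := by
        intro f ξ; funext k
        by_cases hk : k = n
        · subst hk; simp
        · simp [hk]
      have key : ∀ f, f ∈ M ∧ IsZFunc κ f → (Sat (img (upX κ M) (mcol wf)).toSet φ
          (Function.update (fun k => mcol wf (v k)) n (mcol wf f)) ↔
          ZFSet.sep (fun ξ => Sat M.toSet φ (Function.update (fun k => fapp (v k) ξ) n (fapp f ξ))) κ ∈ U) := by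
        intro f hf
        have := ih (Function.update v n f) (up f hf)
        simp only [e1, e2] at this
        exact this
      have ms : ∀ f, f ∈ M ∧ IsZFunc κ f → ZFSet.sep (fun ξ => Sat M.toSet φ (Function.update (fun k => fapp (v k) ξ) n (fapp f ξ))) κ ∈ M := by
        intro f hf
        have := sep_sat g.hM g.hκ (φ := φ) (fun k => (up f hf k).1)
        simp only [e2] at this
        exact this
      constructor
      · intro h
        by_contra hn
        have hn' := (g.not_iff m3).2 hn
        obtain ⟨f, hf, hff, hfP⟩ := g.hM.choice (a := κ) (P := fun ξ y =>
          (¬ ∀ x ∈ M, Sat M.toSet φ (Function.update (fun k => fapp (v k) ξ) n x)) →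
            ¬ Sat M.toSet φ (Function.update (fun k => fapp (v k) ξ) n y)) (by
            have hd : ∀ a b : ℕ, Df {M.toSet} (fun _ w => Sat M.toSet φ (Function.update (fun k => fapp (v k) (w a)) n (w b))) := by
              intro a b
              refine df_sat (t := fun k w => Function.update (fun k => fapp (v k) (w a)) n (w b) k) (fun k => ?_)
              by_cases hk : k = n
              · subst hk; simp only [Function.update_self]; exact DT.var b
              · simp only [Function.update_of_ne hk]
                have := (hv k).1
                (repeat' first | assumption | exact DT.constM (by assumption) | exact DT.var _ | exact DT.empty | apply DT.fapp | apply DT.union | apply DT.inter | apply DT.sUnion | apply DT.tail | apply DT.compl | apply DT.sep | apply DT.constM | apply Df.pair_mem | apply Df.eq_pair | apply Df.mem | apply Df.eq | apply Df.subset | apply Df.and | apply Df.or | apply Df.iff | apply Df.not | apply Df.imp | apply Df.allM | apply Df.exM | apply Df.ball | apply Df.bex | apply Df.all | apply Df.ex | exact Df.prop _)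
            exact Df.imp (Df.not (Df.allM (hd 1 0))) (Df.not (hd 0 1))) g.hκ (by
              intro ξ hξ
              by_cases h : ∀ x ∈ M, Sat M.toSet φ (Function.update (fun k => fapp (v k) ξ) n x)
              · exact ⟨κ, g.hκ, fun h' => absurd h h'⟩
              · push Not at h
                obtain ⟨x, hx, h⟩ := h
                exact ⟨x, hx, fun _ => h⟩)
        have h2 := (key f ⟨hf, hff⟩).1 (h _ (mem_img.2 ⟨f, hX.2 ⟨hf, hff⟩, rfl⟩))
        obtain ⟨ξ, hξ, a, b⟩ := g.ex2 hn' h2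
        exact hfP ξ hξ a b
      · intro h x hx
        obtain ⟨f, hf, rfl⟩ := mem_img.1 hx
        refine (key f (hX.1 hf)).2 (g.imp h (ms f (hX.1 hf)) ?_)
        intro ξ hξ h
        exact h _ (g.hM.fapp (hX.1 hf).1 (g.hM.tr g.hκ hξ))

theorem Los.emb (L : Los κ M U N π) (g : GU κ M U) :
    IsUltrapowerEmb κ M U N (fun x => π (kf κ x)) := by
  have hk := fun {x} (hx : x ∈ M) => kf_mem g.hM g.hκ hx
  refine ⟨L.tr, fun x hx => L.mem _ (hk hx) (kf_func _), ?_, ?_, ?_⟩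
  · intro φ v hv
    rw [L.los φ (fun n => kf κ (v n)) (fun n => ⟨hk (hv n), kf_func _⟩)]
    rw [sep_congr (Q := fun ξ => Sat M.toSet φ v) (fun ξ hξ => by simp only [kf_app hξ])]
    constructor
    · intro h
      exact g.sep_self (fun _ _ => h)
    · intro h
      obtain ⟨x, hx, h⟩ := g.ex h
      exact (ZFSet.mem_sep.1 h).2
  · intro a ha
    obtain ⟨f, hf, hff, rfl⟩ := L.surj a ha
    refine ⟨f, hf, hff, fun x hx => g.hM.fapp hf (g.hM.tr g.hκ hx), ?_⟩
    have := (L.dfl g [f, kf κ f, idf κ] (by simp [hf, hff, hk hf, kf_func, idf_func, idf_mem g.hM g.hκ]) (by simp)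
      (R := fun D v => fapp (v 1) (v 2) = v 0) (by (repeat' first | assumption | exact DT.constM (by assumption) | exact DT.var _ | exact DT.empty | apply DT.fapp | apply DT.union | apply DT.inter | apply DT.sUnion | apply DT.tail | apply DT.compl | apply DT.sep | apply DT.constM | apply Df.pair_mem | apply Df.eq_pair | apply Df.mem | apply Df.eq | apply Df.subset | apply Df.and | apply Df.or | apply Df.iff | apply Df.not | apply Df.imp | apply Df.allM | apply Df.exM | apply Df.ball | apply Df.bex | apply Df.all | apply Df.ex | exact Df.prop _))).2 (by
        refine g.sep_self (fun ξ hξ => ?_)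
        show fapp (fapp (kf κ f) ξ) (fapp (idf κ) ξ) = fapp f ξ
        rw [kf_app hξ, idf_app hξ])
    have h2 : fapp (π (kf κ f)) (π (idf κ)) = π f := this
    rwa [L.idf_eq g] at h2
  · intro A hA hs
    have := L.mem_iff g (idf_mem g.hM g.hκ) idf_func (hk hA) (kf_func A)
    rw [L.idf_eq g] at this
    rw [this, sep_congr (Q := fun ξ => ξ ∈ A) (fun ξ hξ => by rw [kf_app hξ, idf_app hξ])]
    have e : ZFSet.sep (fun ξ => ξ ∈ A) κ = A := by
      ext x; rw [ZFSet.mem_sep]; exact ⟨fun h => h.2, fun h => ⟨hs h, h⟩⟩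
    rw [e]
end

end

section

/-! ### Properties of ultrapowers -/

section
variable {κ M U N : ZFSet.{u}} {π : ZFSet.{u} → ZFSet.{u}}

theorem Los.lt_mem_iff (L : Los κ M U N π) (g : GU κ M U) {γ f : ZFSet.{u}} (hγ : γ ∈ κ) (hf : f ∈ M)
    (hff : IsZFunc κ f) : γ ∈ π f ↔ ZFSet.sep (fun ξ => γ ∈ fapp f ξ) κ ∈ U := by
  have := L.mem_iff g (kf_mem g.hM g.hκ (g.hM.tr g.hκ hγ)) (kf_func _) hf hff
  rw [L.kf_of_lt g γ hγ] at this
  rw [this, sep_congr (Q := fun ξ => γ ∈ fapp f ξ) (fun ξ hξ => by rw [kf_app hξ])]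

theorem Los.sub_M (L : Los κ M U N π) (g : GU κ M U) {A : ZFSet.{u}} (hA : A ∈ N) (hs : A ⊆ κ) :
    A ∈ M := by
  obtain ⟨f, hf, hff, rfl⟩ := L.surj A hA
  have hκ := g.hκ
  have hlam : lam κ (fun γ => ZFSet.sep (fun ξ => γ ∈ fapp f ξ) κ) ∈ M :=
    g.hM.lam (by (repeat' first | assumption | exact DT.constM (by assumption) | exact DT.var _ | exact DT.empty | apply DT.fapp | apply DT.union | apply DT.inter | apply DT.sUnion | apply DT.tail | apply DT.compl | apply DT.sep | apply DT.constM | apply Df.pair_mem | apply Df.eq_pair | apply Df.mem | apply Df.eq | apply Df.subset | apply Df.and | apply Df.or | apply Df.iff | apply Df.not | apply Df.imp | apply Df.allM | apply Df.exM | apply Df.ball | apply Df.bex | apply Df.all | apply Df.ex | exact Df.prop _)) g.hκ (fun γ hγ => by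
      have := g.hM.tr g.hκ hγ
      exact g.hM.sep (by (repeat' first | assumption | exact DT.constM (by assumption) | exact DT.var _ | exact DT.empty | apply DT.fapp | apply DT.union | apply DT.inter | apply DT.sUnion | apply DT.tail | apply DT.compl | apply DT.sep | apply DT.constM | apply Df.pair_mem | apply Df.eq_pair | apply Df.mem | apply Df.eq | apply Df.subset | apply Df.and | apply Df.or | apply Df.iff | apply Df.not | apply Df.imp | apply Df.allM | apply Df.exM | apply Df.ball | apply Df.bex | apply Df.all | apply Df.ex | exact Df.prop _)) g.hκ)
  have himg : img κ (fun γ => ZFSet.sep (fun ξ => γ ∈ fapp f ξ) κ) ∈ M :=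
    g.hM.img (by (repeat' first | assumption | exact DT.constM (by assumption) | exact DT.var _ | exact DT.empty | apply DT.fapp | apply DT.union | apply DT.inter | apply DT.sUnion | apply DT.tail | apply DT.compl | apply DT.sep | apply DT.constM | apply Df.pair_mem | apply Df.eq_pair | apply Df.mem | apply Df.eq | apply Df.subset | apply Df.and | apply Df.or | apply Df.iff | apply Df.not | apply Df.imp | apply Df.allM | apply Df.exM | apply Df.ball | apply Df.bex | apply Df.all | apply Df.ex | exact Df.prop _)) g.hκ (fun γ hγ => by
      have := g.hM.tr g.hκ hγ
      exact g.hM.sep (by (repeat' first | assumption | exact DT.constM (by assumption) | exact DT.var _ | exact DT.empty | apply DT.fapp | apply DT.union | apply DT.inter | apply DT.sUnion | apply DT.tail | apply DT.compl | apply DT.sep | apply DT.constM | apply Df.pair_mem | apply Df.eq_pair | apply Df.mem | apply Df.eq | apply Df.subset | apply Df.and | apply Df.or | apply Df.iff | apply Df.not | apply Df.imp | apply Df.allM | apply Df.exM | apply Df.ball | apply Df.bex | apply Df.all | apply Df.ex | exact Df.prop _)) g.hκ)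
  have hX := g.wa _ himg ⟨_, hlam, isZFunc_lam _ _, fun y hy => by
    obtain ⟨γ, hγ, rfl⟩ := mem_img.1 hy
    exact ⟨γ, hγ, fapp_lam hγ⟩⟩
  obtain ⟨Y, hY⟩ : ∃ Y, Y = img κ (fun γ => ZFSet.sep (fun ξ => γ ∈ fapp f ξ) κ) ∩ U := ⟨_, rfl⟩
  rw [← hY] at hX
  have e : π f = ZFSet.sep (fun γ => ZFSet.sep (fun ξ => γ ∈ fapp f ξ) κ ∈ Y) κ := by
    ext γ
    rw [ZFSet.mem_sep]
    constructor
    · intro h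
      have hγ := hs h
      refine ⟨hγ, ?_⟩
      rw [hY, ZFSet.mem_inter]
      exact ⟨mem_img.2 ⟨γ, hγ, rfl⟩, (L.lt_mem_iff g hγ hf hff).1 h⟩
    · rintro ⟨hγ, h⟩
      rw [hY, ZFSet.mem_inter] at h
      exact (L.lt_mem_iff g hγ hf hff).2 h.2
  rw [e]
  exact g.hM.sep (by (repeat' first | assumption | exact DT.constM (by assumption) | exact DT.var _ | exact DT.empty | apply DT.fapp | apply DT.union | apply DT.inter | apply DT.sUnion | apply DT.tail | apply DT.compl | apply DT.sep | apply DT.constM | apply Df.pair_mem | apply Df.eq_pair | apply Df.mem | apply Df.eq | apply Df.subset | apply Df.and | apply Df.or | apply Df.iff | apply Df.not | apply Df.imp | apply Df.allM | apply Df.exM | apply Df.ball | apply Df.bex | apply Df.all | apply Df.ex | exact Df.prop _)) g.hκ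

theorem Los.kf_inter (L : Los κ M U N π) (g : GU κ M U) {A : ZFSet.{u}} (hA : A ∈ M) (hs : A ⊆ κ) :
    π (kf κ A) ∩ κ = A := by
  ext γ
  rw [ZFSet.mem_inter]
  have key : γ ∈ κ → (γ ∈ π (kf κ A) ↔ γ ∈ A) := by
    intro hγ
    rw [L.lt_mem_iff g hγ (kf_mem g.hM g.hκ hA) (kf_func _),
      sep_congr (Q := fun _ => γ ∈ A) (fun ξ hξ => by rw [kf_app hξ])]
    constructor
    · intro h
      obtain ⟨x, hx, h⟩ := g.ex h
      exact (ZFSet.mem_sep.1 h).2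
    · intro h
      exact g.sep_self (fun _ _ => h)
  exact ⟨fun h => (key h.2).1 h.1, fun h => ⟨(key (hs h)).2 h, hs h⟩⟩

/-- the function `ξ ↦ A ∩ ξ` -/
def capf (κ A : ZFSet.{u}) : ZFSet.{u} := lam κ (fun ξ => A ∩ ξ)
theorem capf_mem (hM : IsTransModel M) (hκ : κ ∈ M) {A : ZFSet.{u}} (hA : A ∈ M) : capf κ A ∈ M :=
  hM.lam (by (repeat' first | assumption | exact DT.constM (by assumption) | exact DT.var _ | exact DT.empty | apply DT.fapp | apply DT.union | apply DT.inter | apply DT.sUnion | apply DT.tail | apply DT.compl | apply DT.sep | apply DT.constM | apply Df.pair_mem | apply Df.eq_pair | apply Df.mem | apply Df.eq | apply Df.subset | apply Df.and | apply Df.or | apply Df.iff | apply Df.not | apply Df.imp | apply Df.allM | apply Df.exM | apply Df.ball | apply Df.bex | apply Df.all | apply Df.ex | exact Df.prop _)) hκ (fun _ h => hM.inter hA (hM.tr hκ h))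
theorem capf_func (A : ZFSet.{u}) : IsZFunc κ (capf κ A) := isZFunc_lam _ _
theorem capf_app {A ξ : ZFSet.{u}} (h : ξ ∈ κ) : fapp (capf κ A) ξ = A ∩ ξ := fapp_lam h

theorem Los.capf_eq (L : Los κ M U N π) (g : GU κ M U) {A : ZFSet.{u}} (hA : A ∈ M) (hs : A ⊆ κ) :
    π (capf κ A) = A := by
  have := (L.dfl g [capf κ A, kf κ A, idf κ] (by
      simp [capf_mem g.hM g.hκ hA, capf_func, kf_mem g.hM g.hκ hA, kf_func, idf_func, idf_mem g.hM g.hκ]) (by simp)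
      (R := fun D v => v 0 = v 1 ∩ v 2) (by (repeat' first | assumption | exact DT.constM (by assumption) | exact DT.var _ | exact DT.empty | apply DT.fapp | apply DT.union | apply DT.inter | apply DT.sUnion | apply DT.tail | apply DT.compl | apply DT.sep | apply DT.constM | apply Df.pair_mem | apply Df.eq_pair | apply Df.mem | apply Df.eq | apply Df.subset | apply Df.and | apply Df.or | apply Df.iff | apply Df.not | apply Df.imp | apply Df.allM | apply Df.exM | apply Df.ball | apply Df.bex | apply Df.all | apply Df.ex | exact Df.prop _))).2 (by
        refine g.sep_self (fun ξ hξ => ?_)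
        show fapp (capf κ A) ξ = fapp (kf κ A) ξ ∩ fapp (idf κ) ξ
        rw [kf_app hξ, idf_app hξ, capf_app hξ])
  have h2 : π (capf κ A) = π (kf κ A) ∩ π (idf κ) := this
  rw [h2, L.idf_eq g, L.kf_inter g hA hs]

theorem Los.all1 (L : Los κ M U N π) (g : GU κ M U)
    {R : Set ZFSet.{u} → (ℕ → ZFSet.{u}) → Prop} (hR : Df Set.univ R)
    (h : ∀ v : ℕ → ZFSet.{u}, (∀ n, v n ∈ M) → R M.toSet v) :
    ∀ v : ℕ → ZFSet.{u}, (∀ n, v n ∈ N) → R N.toSet v := by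
  intro v hv
  choose f hf hff e using fun n => L.surj (v n) (hv n)
  have := (L.df g hR f (fun n => ⟨hf n, hff n⟩)).2
    (g.sep_self (fun ξ hξ => h _ (fun n => g.hM.fapp (hf n) (g.hM.tr g.hκ hξ))))
  simpa only [e] using this

theorem df_upd {𝒟 : Set (Set ZFSet.{u})} {φ : Fml} {t : ℕ → Set ZFSet.{u} → (ℕ → ZFSet.{u}) → ZFSet.{u}}
    {s : Set ZFSet.{u} → (ℕ → ZFSet.{u}) → ZFSet.{u}} (k : ℕ)
    (h : ∀ n, DT 𝒟 (t n)) (hs : DT 𝒟 s) :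
    Df 𝒟 (fun D v => Sat D φ (Function.update (fun n => t n D v) k (s D v))) := by
  refine Df.sat φ (fun m D v => Function.update (fun n => t n D v) k (s D v) m) (fun m => ?_)
  by_cases hk : m = k
  · subst hk; simp only [Function.update_self]; exact hs
  · simp only [Function.update_of_ne hk]; exact h m

theorem df_upd2 {𝒟 : Set (Set ZFSet.{u})} {φ : Fml} {t : ℕ → Set ZFSet.{u} → (ℕ → ZFSet.{u}) → ZFSet.{u}}
    {s r : Set ZFSet.{u} → (ℕ → ZFSet.{u}) → ZFSet.{u}} (k l : ℕ)
    (h : ∀ n, DT 𝒟 (t n)) (hs : DT 𝒟 s) (hr : DT 𝒟 r) :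
    Df 𝒟 (fun D v => Sat D φ (Function.update (Function.update (fun n => t n D v) k (s D v)) l (r D v))) := by
  refine df_upd (t := fun m D v => Function.update (fun n => t n D v) k (s D v) m) l (fun m => ?_) hr
  by_cases hk : m = k
  · subst hk; simp only [Function.update_self]; exact hs
  · simp only [Function.update_of_ne hk]; exact h m

/-- every set in a nice model is well-ordered by an injection into `κ` -/
theorem Nice.wo (g : GU κ M U) (hn : Nice κ M) {x : ZFSet.{u}} (hx : x ∈ M) :
    ∃ r ∈ M, ∃ h ∈ M, (∀ p ∈ r, ∃ a ∈ x, ∃ b ∈ x, p = ZFSet.pair a b) ∧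
      (∀ a ∈ x, ∀ b ∈ x, (ZFSet.pair a b ∈ r ↔ fapp h a ∈ fapp h b)) ∧
      (∀ a ∈ x, fapp h a ∈ κ) ∧ ∀ a ∈ x, ∀ b ∈ x, fapp h a = fapp h b → a = b := by
  obtain ⟨t, ht, hxt, htt, f, hf, hff, -, hsur⟩ := hn x hx
  have hκ := g.hκ
  obtain ⟨h, hh, hhf, hP⟩ := g.hM.choice (a := x) (P := fun a η => η ∈ κ ∧ fapp f η = a)
    (by (repeat' first | assumption | exact DT.constM (by assumption) | exact DT.var _ | exact DT.empty | apply DT.fapp | apply DT.union | apply DT.inter | apply DT.sUnion | apply DT.tail | apply DT.compl | apply DT.sep | apply DT.constM | apply Df.pair_mem | apply Df.eq_pair | apply Df.mem | apply Df.eq | apply Df.subset | apply Df.and | apply Df.or | apply Df.iff | apply Df.not | apply Df.imp | apply Df.allM | apply Df.exM | apply Df.ball | apply Df.bex | apply Df.all | apply Df.ex | exact Df.prop _)) hx (fun a ha => by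
      obtain ⟨η, hη, e⟩ := hsur a (htt x hxt ha)
      exact ⟨η, g.hM.tr hκ hη, hη, e⟩)
  have hxx := g.hM.prod hx hx
  refine ⟨ZFSet.sep (fun p => ∃ a ∈ x, ∃ b ∈ x, p = ZFSet.pair a b ∧ fapp h a ∈ fapp h b) (x.prod x),
    g.hM.sep (by (repeat' first | assumption | exact DT.constM (by assumption) | exact DT.var _ | exact DT.empty | apply DT.fapp | apply DT.union | apply DT.inter | apply DT.sUnion | apply DT.tail | apply DT.compl | apply DT.sep | apply DT.constM | apply Df.pair_mem | apply Df.eq_pair | apply Df.mem | apply Df.eq | apply Df.subset | apply Df.and | apply Df.or | apply Df.iff | apply Df.not | apply Df.imp | apply Df.allM | apply Df.exM | apply Df.ball | apply Df.bex | apply Df.all | apply Df.ex | exact Df.prop _)) hxx, h, hh, ?_, ?_, fun a ha => (hP a ha).1, ?_⟩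
  · intro p hp
    obtain ⟨a, ha, b, hb, e, -⟩ := (ZFSet.mem_sep.1 hp).2
    exact ⟨a, ha, b, hb, e⟩
  · intro a ha b hb
    rw [ZFSet.mem_sep]
    constructor
    · rintro ⟨-, a', ha', b', hb', e, h⟩
      obtain ⟨rfl, rfl⟩ := ZFSet.pair_inj.1 e
      exact h
    · intro h
      exact ⟨ZFSet.pair_mem_prod.2 ⟨ha, hb⟩, a, ha, b, hb, rfl, h⟩
  · intro a ha b hb e
    rw [← (hP a ha).2, ← (hP b hb).2, e]

theorem Los.model (L : Los κ M U N π) (g : GU κ M U) (hn : Nice κ M) : IsTransModel N := by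
  refine ⟨L.tr, ?_, ?_, ?_, ?_, ?_, ?_⟩
  · rw [← L.kf_of_lt g _ g.omega_mem]
    exact L.mem _ (kf_mem g.hM g.hκ g.hM.omega) (kf_func _)
  · intro x hx y hy
    obtain ⟨z, hz, e⟩ := L.all1 g (R := fun D v => ∃ z ∈ D, z = {v 0, v 1})
      (Df.ex (Df.eq_upair (DT.var 0) (DT.var 1) (DT.var 2)))
      (fun v hv => ⟨_, g.hM.upair (hv 0) (hv 1), rfl⟩) (vc [x, y])
      (vc_all (P := (· ∈ N)) (by simp) (by simp [hx, hy]))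
    have e' : z = {x, y} := e
    exact e' ▸ hz
  · intro x hx
    obtain ⟨z, hz, e⟩ := L.all1 g (R := fun D v => ∃ z ∈ D, z = (⋃₀ (v 0) : ZFSet))
      (by (repeat' first | assumption | exact DT.constM (by assumption) | exact DT.var _ | exact DT.empty | apply DT.fapp | apply DT.union | apply DT.inter | apply DT.sUnion | apply DT.tail | apply DT.compl | apply DT.sep | apply DT.constM | apply Df.pair_mem | apply Df.eq_pair | apply Df.mem | apply Df.eq | apply Df.subset | apply Df.and | apply Df.or | apply Df.iff | apply Df.not | apply Df.imp | apply Df.allM | apply Df.exM | apply Df.ball | apply Df.bex | apply Df.all | apply Df.ex | exact Df.prop _))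
      (fun v hv => ⟨_, g.hM.sU (hv 0), rfl⟩) (vc [x])
      (vc_all (P := (· ∈ N)) (by simp) (by simp [hx]))
    have e' : z = (⋃₀ x : ZFSet) := e
    exact e' ▸ hz
  · intro φ v hv a ha
    obtain ⟨b, hb, h⟩ := L.all1 g (R := fun D w => ∃ b ∈ D, ∀ x ∈ D, (x ∈ b ↔ (x ∈ w 0 ∧
        Sat D φ (Function.update (fun n => w (n + 1)) 0 x))))
      (Df.ex (Df.all (Df.iff (by (repeat' first | assumption | exact DT.constM (by assumption) | exact DT.var _ | exact DT.empty | apply DT.fapp | apply DT.union | apply DT.inter | apply DT.sUnion | apply DT.tail | apply DT.compl | apply DT.sep | apply DT.constM | apply Df.pair_mem | apply Df.eq_pair | apply Df.mem | apply Df.eq | apply Df.subset | apply Df.and | apply Df.or | apply Df.iff | apply Df.not | apply Df.imp | apply Df.allM | apply Df.exM | apply Df.ball | apply Df.bex | apply Df.all | apply Df.ex | exact Df.prop _)) (Df.and (by (repeat' first | assumption | exact DT.constM (by assumption) | exact DT.var _ | exact DT.empty | apply DT.fapp | apply DT.union | apply DT.inter | apply DT.sUnion | apply DT.tail | apply DT.compl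 | apply DT.sep | apply DT.constM | apply Df.pair_mem | apply Df.eq_pair | apply Df.mem | apply Df.eq | apply Df.subset | apply Df.and | apply Df.or | apply Df.iff | apply Df.not | apply Df.imp | apply Df.allM | apply Df.exM | apply Df.ball | apply Df.bex | apply Df.all | apply Df.ex | exact Df.prop _))
        (df_upd (t := fun n D v => v (n + 3)) 0 (fun n => DT.var _) (DT.var 0))))))
      (fun v hv => by
        obtain ⟨b, hb, h⟩ := g.hM.2.2.2.2.1 φ (fun n => v (n + 1)) (fun n => hv _) (v 0) (hv 0)
        exact ⟨b, hb, fun x _ => h x⟩) (cons a v) (by rintro (_ | n); exacts [ha, hv n])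
    refine ⟨b, hb, fun x => ?_⟩
    by_cases hx : x ∈ N
    · exact h x hx
    · exact ⟨fun h => absurd (L.tr b hb h) hx, fun h => absurd (L.tr a ha h.1) hx⟩
  · intro φ v hv a ha
    exact L.all1 g (R := fun D w =>
      (∀ x ∈ w 0, ∃ y ∈ D, Sat D φ (Function.update (Function.update (fun n => w (n + 1)) 0 x) 1 y)) →
      ∃ b ∈ D, ∀ x ∈ w 0, ∃ y ∈ b, Sat D φ (Function.update (Function.update (fun n => w (n + 1)) 0 x) 1 y))
      (Df.imp (Df.ball (DT.var 0) (Df.ex (df_upd2 (t := fun n D v => v (n + 3)) 0 1 (fun n => DT.var _)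
        (DT.var 1) (DT.var 0))))
        (Df.ex (Df.ball (DT.var 1) (Df.bex (DT.var 1) (df_upd2 (t := fun n D v => v (n + 4)) 0 1 (fun n => DT.var _)
        (DT.var 1) (DT.var 0))))))
      (fun v hv => g.hM.2.2.2.2.2.1 φ (fun n => v (n + 1)) (fun n => hv _) (v 0) (hv 0))
      (cons a v) (by rintro (_ | n); exacts [ha, hv n])
  · intro x hx
    obtain ⟨f, hf, hff, rfl⟩ := L.surj x hx
    obtain ⟨⟨o1, o2⟩, r, hr, h, hh, h1, h2, h3, h4⟩ := (L.dfl g [f, kf κ κ] (by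
      simp [hf, hff, kf_mem g.hM g.hκ g.hκ, kf_func]) (by simp)
      (R := fun D v => ((∀ a ∈ v 1, a ⊆ v 1) ∧ (∀ b ∈ v 1, ∀ a ∈ b, a ⊆ b)) ∧
       ∃ r ∈ D, ∃ h ∈ D, (∀ p ∈ r, ∃ a ∈ v 0, ∃ b ∈ v 0, p = ZFSet.pair a b) ∧
      (∀ a ∈ v 0, ∀ b ∈ v 0, (ZFSet.pair a b ∈ r ↔ fapp h a ∈ fapp h b)) ∧
      (∀ a ∈ v 0, fapp h a ∈ v 1) ∧ ∀ a ∈ v 0, ∀ b ∈ v 0, fapp h a = fapp h b → a = b)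
      (by (repeat' first | assumption | exact DT.constM (by assumption) | exact DT.var _ | exact DT.empty | apply DT.fapp | apply DT.union | apply DT.inter | apply DT.sUnion | apply DT.tail | apply DT.compl | apply DT.sep | apply DT.constM | apply Df.pair_mem | apply Df.eq_pair | apply Df.mem | apply Df.eq | apply Df.subset | apply Df.and | apply Df.or | apply Df.iff | apply Df.not | apply Df.imp | apply Df.allM | apply Df.exM | apply Df.ball | apply Df.bex | apply Df.all | apply Df.ex | exact Df.prop _))).2 (by
        refine g.sep_self (fun ξ hξ => ?_)
        have := Nice.wo g hn (g.hM.fapp hf (g.hM.tr g.hκ hξ))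
        have e : fapp (vc [f, kf κ κ] 1) ξ = κ := kf_app hξ
        simp only [e]
        exact ⟨⟨g.ic.ord.isTransitive, fun b hb => (g.ic.ord.mem hb).isTransitive⟩, this⟩)
    change ∀ p ∈ r, ∃ a ∈ π f, ∃ b ∈ π f, p = ZFSet.pair a b at h1
    change ∀ a ∈ π f, ∀ b ∈ π f, (ZFSet.pair a b ∈ r ↔ fapp h a ∈ fapp h b) at h2
    change ∀ a ∈ π f, fapp h a ∈ π (kf κ κ) at h3
    change ∀ a ∈ π f, ∀ b ∈ π f, fapp h a = fapp h b → a = b at h4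
    have ho : (π (kf κ κ)).IsOrdinal := isOrd_iff.1 ⟨o1, o2⟩
    refine ⟨r, hr, h1, ?_, ?_, ?_, ?_⟩
    · intro a ha b hb
      rw [h2 a ha b hb, h2 b hb a ha]
      rcases (ho.mem (h3 a ha)).mem_trichotomous (ho.mem (h3 b hb)) with e | e | e
      · exact Or.inr (Or.inl e)
      · exact Or.inl (h4 a ha b hb e)
      · exact Or.inr (Or.inr e)
    · intro a ha b hb c hc
      rw [h2 a ha b hb, h2 b hb c hc, h2 a ha c hc]
      exact fun x y => (ho.mem (h3 c hc)).mem_trans x y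
    · intro a ha
      rw [h2 a ha a ha]
      exact ZFSet.mem_irrefl _
    · intro S hS ⟨s, hs⟩
      obtain ⟨m, ⟨a, ha, rfl⟩, hm⟩ := ZFSet.mem_wf.has_min ((fun a => fapp h a) '' S) ⟨_, s, hs, rfl⟩
      refine ⟨a, ha, fun b hb => ?_⟩
      rw [h2 b (hS hb) a (hS ha)]
      exact hm _ ⟨b, hb, rfl⟩

theorem Los.kappa_mem (L : Los κ M U N π) (g : GU κ M U) : κ ∈ N := by
  rw [← L.idf_eq g]; exact L.mem _ (idf_mem g.hM g.hκ) idf_func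

theorem Los.M_sub (L : Los κ M U N π) (g : GU κ M U) (hn : Nice κ M) : M ⊆ N := by
  refine hn.sub g.ic g.hM g.hκ (L.model g hn) (L.kappa_mem g) ?_
  intro A hA hs
  rw [← L.capf_eq g hA hs]
  exact L.mem _ (capf_mem g.hM g.hκ hA) (capf_func _)
end

/-! ### Ramsey measures -/

section
variable {κ M U : ZFSet.{u}}

theorem GU.kappa_le (g : GU κ M U) : zcard κ ≤ zcard U := by
  refine Cardinal.mk_le_of_injective (f := fun α : κ.toSet => (⟨tailSet κ α.1, g.tail α.2⟩ : U.toSet)) ?_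
  rintro ⟨a, ha⟩ ⟨b, hb⟩ e
  have e' : tailSet κ a = tailSet κ b := congrArg Subtype.val e
  have ha' : a ∈ tailSet κ a := ZFSet.mem_sep.2 ⟨ha, ZFSet.mem_irrefl _⟩
  have hb' : b ∈ tailSet κ b := ZFSet.mem_sep.2 ⟨hb, ZFSet.mem_irrefl _⟩
  have h1 := (ZFSet.mem_sep.1 (e' ▸ ha')).2
  have h2 := (ZFSet.mem_sep.1 (e'.symm ▸ hb')).2
  rcases (g.ic.ord.mem ha).mem_trichotomous (g.ic.ord.mem hb) with h | h | h
  · exact absurd h h1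
  · exact Subtype.ext h
  · exact absurd h h2

theorem ramsey_gu (ic : IC κ) (h : IsRamseyMeasure κ U) :
    GU κ (MU κ U) U ∧ V_ κ.rank ∈ MU κ U ∧ zcard (MU κ U) = zcard κ := by
  obtain ⟨⟨h1, h2, h3⟩, h4, h5⟩ := h
  have hm : IsMUModel κ U (MU κ U) := by
    unfold MU; rw [dif_pos h3]; exact h3.choose_spec
  obtain ⟨⟨a1, a2, a3⟩, ⟨v, hv, hv'⟩, a4, a5⟩ := hm
  refine ⟨⟨ic, a1, a2, a4, h4, h5⟩, ?_, a3⟩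
  have : v = V_ κ.rank := by
    ext x; rw [hv', ZFSet.mem_vonNeumann]
  exact this ▸ hv

theorem GU.kappa_mem (g : GU κ M U) : κ ∈ U := by
  have := g.sep_self (P := fun _ => True) (fun _ _ => trivial)
  have e : ZFSet.sep (fun _ => True) κ = κ := by ext; simp
  rwa [e] at this

theorem ramsey_los (ic : IC κ) (h : IsRamseyMeasure κ U) :
    ∃ π, Los κ (MU κ U) U (NU κ U) π := by
  have g := (ramsey_gu ic h).1
  obtain ⟨N, π, L⟩ := exists_los g
  have hex : ∃ p : ZFSet.{u} × (ZFSet.{u} → ZFSet.{u}), IsUltrapowerEmb κ (MU κ U) U p.1 p.2 :=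
    ⟨(N, _), L.emb g⟩
  have : IsUltrapowerEmb κ (MU κ U) U (NU κ U) (jU κ U) := by
    unfold NU jU upData; rw [dif_pos hex]; exact hex.choose_spec
  exact ⟨_, los_of_emb g.hM g.hκ g.kappa_mem this⟩

theorem GP.ramsey (g : GP κ M U) (hc : zcard M ≤ zcard κ) : IsRamseyMeasure κ U ∧ MU κ U = M := by
  have hc' : zcard M = zcard κ := le_antisymm hc (zcard_mono (fun x hx => g.hM.tr g.hκ hx))
  have hm : IsMUModel κ U M := by
    refine ⟨⟨g.hM, g.hκ, hc'⟩, ⟨_, g.hV, fun x => ZFSet.mem_vonNeumann⟩, g.uf, ?_⟩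
    intro M' hM' hκ' hU'
    refine g.nice.sub g.ic g.hM g.hκ hM' hκ' (fun A hA hs => ?_)
    rcases g.ultra hA hs with h | h
    · exact (hU'.1 A h).1
    · have := hM'.compl hκ' (hU'.1 _ h).1
      have e : compl κ (compl κ A) = A := by
        ext x
        simp only [compl, ZFSet.mem_sep]
        constructor
        · rintro ⟨h1, h2⟩
          by_contra h3
          exact h2 ⟨h1, h3⟩
        · intro h
          exact ⟨hs h, fun h' => h'.2 h⟩
      rwa [e] at this
  have hex : ∃ M, IsMUModel κ U M := ⟨M, hm⟩
  have hm' : IsMUModel κ U (MU κ U) := by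
    unfold MU; rw [dif_pos hex]; exact hex.choose_spec
  have e : MU κ U = M := by
    have a := hm.2.2.2 _ hm'.1.1 hm'.1.2.1 hm'.2.2.1
    have b := hm'.2.2.2 _ hm.1.1 hm.1.2.1 hm.2.2.1
    ext x
    exact ⟨fun h => b h, fun h => a h⟩
  refine ⟨⟨⟨?_, fun A hA => g.sub hA, hex⟩, e ▸ g.wa, g.oi⟩, e⟩
  exact le_antisymm ((zcard_mono (fun A hA => g.memM hA)).trans hc) g.kappa_le
end

end

section

/-! ### Well-foundedness of the Mitchell-like order -/

def oiD (D : Set ZFSet.{u}) (o F : ZFSet.{u}) : Prop :=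
  ∀ f ∈ D, IsZFunc o f → (∀ n ∈ o, fapp f n ∈ F) → ∃ x ∈ D, ∀ n ∈ o, x ∈ fapp f n

theorem df_oiD {𝒟 : Set (Set ZFSet.{u})} {s t : Set ZFSet.{u} → (ℕ → ZFSet.{u}) → ZFSet.{u}}
    (hs : DT 𝒟 s) (ht : DT 𝒟 t) : Df 𝒟 (fun D v => oiD D (s D v) (t D v)) := by
  have hs' := hs.succ
  have ht' := ht.succ
  have hs'' := hs'.succ
  have ht'' := ht'.succ
  unfold oiD
  refine Df.all (Df.imp (Df.isZFunc hs' (DT.var 0)) (Df.imp ?_ ?_))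
  · exact Df.ball hs' (Df.mem (DT.fapp (DT.var 1) (DT.var 0)) ht'')
  · exact Df.ex (Df.ball hs'' (Df.mem (DT.var 1) (DT.fapp (DT.var 2) (DT.var 0))))

/-- the external version gives the internal one -/
theorem oi_in {N U : ZFSet.{u}} (h : OmegaOneIntersecting U) : OmegaOneIntersectingIn N U := by
  intro f _ _ hf
  obtain ⟨x, hx⟩ := h (fun n => fapp f (nn n)) (fun n => hf _ (nn_omega n))
  refine ⟨x, fun n hn => ?_⟩
  obtain ⟨k, rfl⟩ := mem_omega.1 hn
  exact hx k

theorem seq_V {κ ξ : ZFSet.{u}} (ic : IC κ) (hω : ZFSet.omega ∈ κ) (hξ : ξ ∈ κ)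
    (G : ZFSet.{u} → ZFSet.{u}) (hG : ∀ x, G x ⊆ ξ) : lam ZFSet.omega G ∈ V_ κ.rank := by
  rw [ZFSet.mem_vonNeumann]
  obtain ⟨μ, hμ, h1, h2⟩ : ∃ μ ∈ κ, ZFSet.omega.rank ≤ μ.rank ∧ ξ.rank ≤ μ.rank := by
    rcases le_total ZFSet.omega.{u}.rank ξ.rank with h | h
    · exact ⟨ξ, hξ, h, le_rfl⟩
    · exact ⟨_, hω, le_rfl, h⟩
  have h3 := ZFSet.rank_lt_of_mem (ic.succ_mem (ic.succ_mem (ic.succ_mem hμ)))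
  have hs : ∀ x : ZFSet.{u}, (insert x x).rank = Order.succ x.rank := by
    intro x
    rw [ZFSet.rank_insert]
    exact max_eq_left (Order.le_succ _)
  simp only [hs] at h3
  refine lt_of_le_of_lt (ZFSet.rank_le_iff.2 ?_) h3
  intro p hp
  obtain ⟨x, hx, rfl⟩ := mem_lam.1 hp
  have a1 : x.rank ≤ μ.rank := (ZFSet.rank_lt_of_mem hx).le.trans h1
  have a2 : (G x).rank ≤ μ.rank := (ZFSet.rank_mono (hG x)).trans h2
  have b1 := Order.succ_le_succ a1
  have b2 := Order.succ_le_succ a2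
  refine Order.lt_succ_iff.2 ?_
  unfold ZFSet.pair
  rw [ZFSet.rank_pair, ZFSet.rank_pair, ZFSet.rank_singleton]
  exact max_le (Order.succ_le_succ b1) (Order.succ_le_succ (max_le b1 b2))

section
variable {κ : ZFSet.{u}}

def chS (κ : ZFSet.{u}) (M F : ℕ → ZFSet.{u}) : ℕ → ℕ → ZFSet.{u}
  | 0, _ => κ
  | k + 1, m => ZFSet.sep (fun ξ => oiD (M m).toSet ZFSet.omega (fapp (F m) ξ) ∧
      (∀ A ∈ fapp (F m) ξ, A ⊆ ξ) ∧ chS κ M F k (m + 1) ∩ ξ ∈ fapp (F m) ξ) κ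

theorem chS_sub (M F : ℕ → ZFSet.{u}) (k m : ℕ) : chS κ M F k m ⊆ κ := by
  cases k
  · exact fun x h => h
  · exact sep_sub

theorem no_chain (ic : IC κ) (W : ℕ → ZFSet.{u}) (hW : ∀ m, IsRamseyMeasure κ (W m))
    (hd : ∀ m, W (m + 1) ∈ NU κ (W m)) : False := by
  have g := fun m => (ramsey_gu ic (hW m)).1
  have hV := fun m => (ramsey_gu ic (hW m)).2.1
  choose π L using fun m => ramsey_los ic (hW m)
  obtain ⟨M, hM⟩ : ∃ M : ℕ → ZFSet.{u}, M = fun m => MU κ (W m) := ⟨_, rfl⟩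
  obtain ⟨N, hN⟩ : ∃ N : ℕ → ZFSet.{u}, N = fun m => NU κ (W m) := ⟨_, rfl⟩
  replace g : ∀ m, GU κ (M m) (W m) := by rw [hM]; exact g
  replace hV : ∀ m, V_ κ.rank ∈ M m := by rw [hM]; exact hV
  replace L : ∀ m, Los κ (M m) (W m) (N m) (π m) := by rw [hM, hN]; exact L
  replace hd : ∀ m, W (m + 1) ∈ N m := by rw [hN]; exact hd
  clear hM hN
  choose F hF hFf hFe using fun m => (L m).surj _ (hd m)
  obtain ⟨S, hS⟩ : ∃ S, S = chS κ M F := ⟨_, rfl⟩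
  have hSs : ∀ k m, S k m ⊆ κ := by rw [hS]; exact chS_sub M F
  have hS1 : ∀ k m, S (k+1) m = ZFSet.sep (fun ξ => oiD (M m).toSet ZFSet.omega (fapp (F m) ξ) ∧
      (∀ A ∈ fapp (F m) ξ, A ⊆ ξ) ∧ S k (m + 1) ∩ ξ ∈ fapp (F m) ξ) κ := by
    intro k m; rw [hS]; rfl
  have hSW : ∀ k m, S k m ∈ W m := by
    intro k
    induction k with
    | zero => intro m; rw [hS]; exact (g m).kappa_mem
    | succ k ih =>
      intro m
      have hN : S k (m+1) ∈ N m := (L m).tr _ (hd m) (ih (m+1))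
      have hMm := (L m).sub_M (g m) hN (hSs _ _)
      have gM := (g m).hM
      have hκ := (g m).hκ
      have := ((L m).dfl (g m) [F m, kf κ ZFSet.omega, capf κ (S k (m+1)), idf κ] (by
        simp [hF, hFf, kf_mem gM hκ gM.omega, kf_func, capf_mem gM hκ hMm, capf_func,
          idf_mem gM hκ, idf_func]) (by simp)
        (R := fun D v => oiD D (v 1) (v 0) ∧ (∀ A ∈ v 0, A ⊆ v 3) ∧ v 2 ∈ v 0)
        (Df.and (df_oiD (DT.var 1) (DT.var 0)) (by (repeat' first | assumption | exact DT.constM (by assumption) | exact DT.var _ | exact DT.empty | apply DT.fapp | apply DT.union | apply DT.inter | apply DT.sUnion | apply DT.tail | apply DT.compl | apply DT.sep | apply DT.constM | apply Df.pair_mem | apply Df.eq_pair | apply Df.mem | apply Df.eq | apply Df.subset | apply Df.and | apply Df.or | apply Df.iff | apply Df.not | apply Df.imp | apply Df.allM | apply Df.exM | apply Df.ball | apply Df.bex | apply Df.all | apply Df.ex | exact Df.prop _)))).1 (by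
          show oiD (N m).toSet (π m (kf κ ZFSet.omega)) (π m (F m)) ∧
            (∀ A ∈ π m (F m), A ⊆ π m (idf κ)) ∧ π m (capf κ (S k (m+1))) ∈ π m (F m)
          rw [hFe, (L m).kf_of_lt (g m) _ (g m).omega_mem, (L m).idf_eq (g m),
            (L m).capf_eq (g m) hMm (hSs _ _)]
          refine ⟨?_, fun A hA => (g (m+1)).sub hA, ih _⟩
          intro f hf hff hfw
          obtain ⟨x, hx⟩ := oi_in (g (m+1)).oi f hf hff hfw
          have h0 : ∅ ∈ ZFSet.omega := ZFSet.omega_zero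
          exact ⟨x, (L m).tr _ ((L m).tr _ (hd m) (hfw _ h0)) (hx _ h0), hx⟩)
      rw [hS1]
      convert this using 1
      refine sep_congr (fun ξ hξ => ?_)
      show _ ↔ oiD (M m).toSet (fapp (kf κ ZFSet.omega) ξ) (fapp (F m) ξ) ∧
            (∀ A ∈ fapp (F m) ξ, A ⊆ fapp (idf κ) ξ) ∧ fapp (capf κ (S k (m+1))) ξ ∈ fapp (F m) ξ
      rw [kf_app hξ, idf_app hξ, capf_app hξ]
  have step : ∀ m ξ, (∀ k, ξ ∈ S k m) → ∃ ξ' ∈ ξ, ∀ k, ξ' ∈ S k (m+1) := by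
    intro m ξ h
    have hξκ : ξ ∈ κ := hSs _ _ (h 0)
    have hk : ∀ k, _ := fun k => (ZFSet.mem_sep.1 (hS1 k m ▸ h (k+1))).2
    let G : ZFSet.{u} → ZFSet.{u} := fun x => S (Function.invFun nn x) (m+1) ∩ ξ
    have hG : ∀ k, G (nn k) = S k (m+1) ∩ ξ := by
      intro k; show S (Function.invFun nn (nn k)) (m+1) ∩ ξ = _
      rw [Function.leftInverse_invFun nn_inj k]
    have hf : lam ZFSet.omega G ∈ M m := (g m).hM.tr (hV m)
      (seq_V ic (g m).omega_mem hξκ G (fun x y hy => (ZFSet.mem_inter.1 hy).2))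
    obtain ⟨x, -, hx⟩ := (hk 0).1 _ hf (isZFunc_lam _ _) (by
      intro n hn
      rw [fapp_lam hn]
      obtain ⟨k, rfl⟩ := mem_omega.1 hn
      rw [hG]
      exact (hk k).2.2)
    have hx' : ∀ k, x ∈ S k (m+1) ∩ ξ := by
      intro k
      have := hx _ (nn_omega k)
      rwa [fapp_lam (nn_omega k), hG] at this
    exact ⟨x, (ZFSet.mem_inter.1 (hx' 0)).2, fun k => (ZFSet.mem_inter.1 (hx' k)).1⟩
  obtain ⟨ξ₀, hξ₀⟩ := (g 0).oi (fun k => S k 0) (fun k => hSW k 0)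
  choose nx hn1 hn2 using step
  let sq : (m : ℕ) → {ξ // ∀ k, ξ ∈ S k m} := fun m =>
    Nat.rec ⟨ξ₀, hξ₀⟩ (fun m p => ⟨nx m p.1 p.2, hn2 m p.1 p.2⟩) m
  exact no_seq (fun m => (sq m).1) (fun m => hn1 m _ _)

/-- `U` is below `W` -/
def mE (κ U W : ZFSet.{u}) : Prop :=
  IsRamseyMeasure κ U ∧ IsRamseyMeasure κ W ∧ U ∈ NU κ W

theorem mE_wf (ic : IC κ) : WellFounded (mE κ) :=
  wf_of_noseq (fun s h => no_chain ic s (fun m => (h m).2.1) (fun m => (h m).2.2))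

theorem mo_wf (ic : IC κ) : WellFounded (MOrder IsRamseyMeasure RamseyMeasureIn κ) := by
  have key : ∀ W, ∀ 𝒲 : Set ZFSet.{u}, W ∈ 𝒲 → Acc (MOrder IsRamseyMeasure RamseyMeasureIn κ) 𝒲 := by
    intro W
    induction W using (mE_wf ic).induction with
    | _ W ih =>
    intro 𝒲 hW
    refine ⟨_, fun 𝒰 h => ?_⟩
    obtain ⟨h1, h2, h3, h4⟩ := h
    have hr := h2.1 W hW
    obtain ⟨π, L⟩ := ramsey_los ic hr
    have g := (ramsey_gu ic hr).1
    obtain ⟨U, hU, hUN, -⟩ := h3 W hW ∅ (L.tr _ (L.kappa_mem g) ic.empty_mem) (ZFSet.empty_subset _)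
    exact ih U ⟨h1.1 U hU, hr, hUN⟩ 𝒰 hU
  refine ⟨fun 𝒲 => ⟨_, fun 𝒰 h => ?_⟩⟩
  obtain ⟨U, hU, -⟩ := h.1.2 ∅ (ZFSet.empty_subset _)
  exact key U 𝒰 hU

theorem nu_card (ic : IC κ) {W : ZFSet.{u}} (hr : IsRamseyMeasure κ W) :
    zcard (NU κ W) ≤ zcard κ := by
  obtain ⟨π, L⟩ := ramsey_los ic hr
  rw [← (ramsey_gu ic hr).2.2]
  refine le_trans (zcard_mono (y := img (MU κ W) π) ?_) (zcard_img_le _ _)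
  intro x hx
  obtain ⟨f, hf, -, e⟩ := L.surj x hx
  exact mem_img.2 ⟨f, hf, e⟩

theorem rank_lt (ic : IC κ) : ∀ W, ((mE_wf ic).apply W).rank < cardSuccOrd κ := by
  intro W
  induction W using (mE_wf ic).induction with
  | _ W ih =>
  have hreg := Cardinal.isRegular_succ ic.2
  rw [Acc.rank_eq]
  refine Cardinal.iSup_lt_ord_of_isRegular hreg ?_ ?_
  · refine Order.lt_succ_iff.2 ?_
    by_cases hr : IsRamseyMeasure κ W
    · refine le_trans ?_ (nu_card ic hr)
      exact Cardinal.mk_le_of_injective (f := fun b : {b // mE κ b W} => (⟨b.1, b.2.2.2⟩ : (NU κ W).toSet))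
        (fun a b e => Subtype.ext (congrArg (fun z => z.1) e))
    · have : IsEmpty {b // mE κ b W} := ⟨fun b => hr b.2.2.1⟩
      simp
  · intro b
    exact (Cardinal.isSuccLimit_ord hreg.1).succ_lt (ih b.1 b.2)

theorem relRank_eq (ic : IC κ) (𝒲 : Set ZFSet.{u}) :
    relRank (MOrder IsRamseyMeasure RamseyMeasureIn κ) 𝒲 = ((mo_wf ic).apply 𝒲).rank := by
  unfold relRank
  rw [dif_pos ((mo_wf ic).apply 𝒲)]

theorem relRank_le (ic : IC κ) : ∀ W, ∀ 𝒲 : Set ZFSet.{u}, W ∈ 𝒲 →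
    relRank (MOrder IsRamseyMeasure RamseyMeasureIn κ) 𝒲 ≤ ((mE_wf ic).apply W).rank := by
  intro W
  induction W using (mE_wf ic).induction with
  | _ W ih =>
  intro 𝒲 hW
  rw [relRank_eq ic, Acc.rank_eq]
  refine ciSup_le' ?_
  rintro ⟨𝒰, h⟩
  refine Order.succ_le_of_lt ?_
  obtain ⟨h1, h2, h3, h4⟩ := h
  have hr := h2.1 W hW
  obtain ⟨π, L⟩ := ramsey_los ic hr
  have g := (ramsey_gu ic hr).1
  obtain ⟨U, hU, hUN, -⟩ := h3 W hW ∅ (L.tr _ (L.kappa_mem g) ic.empty_mem) (ZFSet.empty_subset _)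
  have hE : mE κ U W := ⟨h1.1 U hU, hr, hUN⟩
  refine lt_of_le_of_lt (le_trans (le_of_eq (relRank_eq ic 𝒰).symm) (ih U hE 𝒰 hU)) ?_
  exact Acc.rank_lt_of_rel _ hE

theorem witness_rank (ic : IC κ) {𝒲 : Set ZFSet.{u}} (h : IsWitness IsRamseyMeasure κ 𝒲) :
    relRank (MOrder IsRamseyMeasure RamseyMeasureIn κ) 𝒲 + 1 ≤ cardSuccOrd κ := by
  obtain ⟨W, hW, -⟩ := h.2 ∅ (ZFSet.empty_subset _)
  rw [← Order.succ_eq_add_one]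
  exact Order.succ_le_of_lt ((relRank_le ic W 𝒲 hW).trans_lt (rank_lt ic W))

theorem oRank_eq (ic : IC κ) (h : ∀ α < cardSuccOrd κ, ∃ 𝒲 : Set ZFSet.{u},
      IsWitness IsRamseyMeasure κ 𝒲 ∧ α ≤ relRank (MOrder IsRamseyMeasure RamseyMeasureIn κ) 𝒲) :
    oRank IsRamseyMeasure RamseyMeasureIn κ = cardSuccOrd κ := by
  refine le_antisymm (csSup_le' ?_) (le_of_forall_lt ?_)
  · rintro o ⟨𝒲, h1, rfl⟩
    exact witness_rank ic h1
  · intro α hα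
    obtain ⟨𝒲, h1, h2⟩ := h α hα
    refine lt_of_lt_of_le (lt_of_le_of_lt h2 (Order.lt_succ _)) (le_csSup ?_ ⟨𝒲, h1, rfl⟩)
    refine ⟨cardSuccOrd κ, ?_⟩
    rintro o ⟨𝒲, h1, rfl⟩
    exact witness_rank ic h1
end

end

section

/-! ### A bounded formula expressing the schemes in a transitive set -/

def Ag (s s' n : ZFSet.{u}) : Prop := ∀ k ∈ ZFSet.omega, ¬ (k = n) → fapp s' k = fapp s k

def Sch (m P E : ZFSet.{u}) : Prop :=
  (∃ s ∈ P, s = s) ∧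
  (∀ s ∈ P, ∀ n ∈ ZFSet.omega, fapp s n ∈ m) ∧
  (∀ s ∈ P, ∀ n ∈ ZFSet.omega, ∀ x ∈ m, ∃ s' ∈ P, fapp s' n = x ∧ Ag s s' n) ∧
  (∀ i ∈ ZFSet.omega, ∀ j ∈ ZFSet.omega, ∃ S ∈ E, ∀ s ∈ P, (s ∈ S ↔ fapp s i ∈ fapp s j)) ∧
  (∀ i ∈ ZFSet.omega, ∀ j ∈ ZFSet.omega, ∃ S ∈ E, ∀ s ∈ P, (s ∈ S ↔ fapp s i = fapp s j)) ∧
  (∀ S ∈ E, ∃ T ∈ E, ∀ s ∈ P, (s ∈ T ↔ ¬ (s ∈ S))) ∧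
  (∀ S ∈ E, ∀ S' ∈ E, ∃ T ∈ E, ∀ s ∈ P, (s ∈ T ↔ (s ∈ S → s ∈ S'))) ∧
  (∀ S ∈ E, ∀ n ∈ ZFSet.omega, ∃ T ∈ E, ∀ s ∈ P, (s ∈ T ↔ ∀ s' ∈ P, Ag s s' n → s' ∈ S)) ∧
  (∀ S ∈ E, ∀ s ∈ P, ∀ a ∈ m, ∃ b ∈ m, ∀ x ∈ m, (x ∈ b ↔ (x ∈ a ∧
    ∃ s' ∈ P, fapp s' ∅ = x ∧ Ag s s' ∅ ∧ s' ∈ S))) ∧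
  (∀ S ∈ E, ∀ s ∈ P, ∀ a ∈ m,
    (∀ x ∈ a, ∃ y ∈ m, ∃ s' ∈ P, ∃ s'' ∈ P, (fapp s' ∅ = x ∧ Ag s s' ∅) ∧
      (fapp s'' (nn 1) = y ∧ Ag s' s'' (nn 1)) ∧ s'' ∈ S) →
    ∃ b ∈ m, ∀ x ∈ a, ∃ y ∈ b, ∃ s' ∈ P, ∃ s'' ∈ P, (fapp s' ∅ = x ∧ Ag s s' ∅) ∧
      (fapp s'' (nn 1) = y ∧ Ag s' s'' (nn 1)) ∧ s'' ∈ S)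

theorem df_Sch {𝒟 : Set (Set ZFSet.{u})} (hw : DT 𝒟 (fun _ _ => ZFSet.omega))
    (h1 : DT 𝒟 (fun _ _ => nn 1)) (i j k : ℕ) :
    Df 𝒟 (fun D v => Sch (v i) (v j) (v k)) := by
  obtain ⟨w, hw'⟩ : ∃ w, w = ZFSet.omega := ⟨_, rfl⟩
  obtain ⟨e, he⟩ : ∃ e, e = nn 1 := ⟨_, rfl⟩
  unfold Sch Ag
  rw [← hw'] at hw ⊢
  rw [← he] at h1 ⊢
  clear hw' he
  (repeat' first | assumption | exact DT.constM (by assumption) | exact DT.var _ | exact DT.empty | apply DT.fapp | apply DT.union | apply DT.inter | apply DT.sUnion | apply DT.tail | apply DT.compl | apply DT.sep | apply DT.constM | apply Df.pair_mem | apply Df.eq_pair | apply Df.mem | apply Df.eq | apply Df.subset | apply Df.and | apply Df.or | apply Df.iff | apply Df.not | apply Df.imp | apply Df.allM | apply Df.exM | apply Df.ball | apply Df.bex | apply Df.all | apply Df.ex | exact Df.prop _)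

theorem sat_fin (D : Set ZFSet.{u}) (φ : Fml) : ∃ n : ℕ, ∀ v v' : ℕ → ZFSet.{u},
    (∀ i < n, v i = v' i) → (Sat D φ v ↔ Sat D φ v') := by
  induction φ with
  | mem i j =>
    refine ⟨max i j + 1, fun v v' h => ?_⟩
    show v i ∈ v j ↔ v' i ∈ v' j
    rw [h i (by omega), h j (by omega)]
  | eq i j =>
    refine ⟨max i j + 1, fun v v' h => ?_⟩
    show v i = v j ↔ v' i = v' j
    rw [h i (by omega), h j (by omega)]
  | impl φ ψ h1 h2 =>
    obtain ⟨n, hn⟩ := h1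
    obtain ⟨k, hk⟩ := h2
    refine ⟨max n k, fun v v' h => ?_⟩
    show (Sat D φ v → Sat D ψ v) ↔ (Sat D φ v' → Sat D ψ v')
    rw [hn v v' (fun i hi => h i (by omega)), hk v v' (fun i hi => h i (by omega))]
  | neg φ h1 =>
    obtain ⟨n, hn⟩ := h1
    refine ⟨n, fun v v' h => ?_⟩
    show (¬ Sat D φ v) ↔ ¬ Sat D φ v'
    rw [hn v v' h]
  | all k φ h1 =>
    obtain ⟨n, hn⟩ := h1
    refine ⟨n, fun v v' h => ?_⟩
    refine forall₂_congr fun x _ => hn _ _ (fun i hi => ?_)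
    by_cases e : i = k
    · subst e; simp
    · simp [e, h i hi]

/-- the assignment attached to a set function -/
def asg (s : ZFSet.{u}) : ℕ → ZFSet.{u} := fun i => fapp s (nn i)

theorem ag_upd {s s' x : ZFSet.{u}} {n : ℕ} :
    (fapp s' (nn n) = x ∧ Ag s s' (nn n)) ↔ asg s' = Function.update (asg s) n x := by
  constructor
  · rintro ⟨h1, h2⟩
    funext i
    by_cases e : i = n
    · subst e; simpa [asg] using h1
    · rw [Function.update_of_ne e]
      exact h2 _ (nn_omega i) (fun h => e (nn_inj h))
  · intro h
    refine ⟨by have := congrFun h n; simpa [asg] using this, ?_⟩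
    intro k hk hne
    obtain ⟨i, rfl⟩ := mem_omega.1 hk
    have := congrFun h i
    rwa [Function.update_of_ne (fun e => hne (by rw [e]))] at this

section
variable {m P E : ZFSet.{u}}

theorem Sch.sat (h : Sch m P E) (φ : Fml) : ∃ S ∈ E, ∀ s ∈ P, (s ∈ S ↔ Sat m.toSet φ (asg s)) := by
  obtain ⟨-, h2, h3, h4, h5, h6, h7, h8, -, -⟩ := h
  induction φ with
  | mem i j => exact h4 _ (nn_omega i) _ (nn_omega j)
  | eq i j => exact h5 _ (nn_omega i) _ (nn_omega j)
  | neg φ ih =>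
    obtain ⟨S, hS, e⟩ := ih
    obtain ⟨T, hT, e'⟩ := h6 S hS
    refine ⟨T, hT, fun s hs => ?_⟩
    rw [e' s hs, e s hs]; rfl
  | impl φ ψ ih1 ih2 =>
    obtain ⟨S, hS, e⟩ := ih1
    obtain ⟨S', hS', e1⟩ := ih2
    obtain ⟨T, hT, e'⟩ := h7 S hS S' hS'
    refine ⟨T, hT, fun s hs => ?_⟩
    rw [e' s hs, e s hs, e1 s hs]; rfl
  | all n φ ih =>
    obtain ⟨S, hS, e⟩ := ih
    obtain ⟨T, hT, e'⟩ := h8 S hS _ (nn_omega n)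
    refine ⟨T, hT, fun s hs => ?_⟩
    rw [e' s hs]
    constructor
    · intro h x hx
      obtain ⟨s', hs', ha⟩ := h3 s hs _ (nn_omega n) x hx
      rw [← ag_upd.1 ha, ← e s' hs']
      exact h s' hs' ha.2
    · intro h s' hs' ha
      rw [e s' hs', ag_upd.1 ⟨rfl, ha⟩]
      exact h _ (h2 s' hs' _ (nn_omega n))

theorem Sch.asg (h : Sch m P E) (v : ℕ → ZFSet.{u}) (hv : ∀ n, v n ∈ m) (n : ℕ) :
    ∃ s ∈ P, ∀ i < n, MPaper.asg s i = v i := by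
  obtain ⟨h1, h2, h3, -⟩ := h
  induction n with
  | zero =>
    obtain ⟨s, hs, -⟩ := h1
    exact ⟨s, hs, by simp⟩
  | succ n ih =>
    obtain ⟨s, hs, e⟩ := ih
    obtain ⟨s', hs', ha⟩ := h3 s hs _ (nn_omega n) _ (hv n)
    refine ⟨s', hs', fun i hi => ?_⟩
    rw [ag_upd.1 ha]
    by_cases e' : i = n
    · subst e'; simp
    · rw [Function.update_of_ne e']; exact e i (by omega)

theorem upd_agree {v w : ℕ → ZFSet.{u}} {n k : ℕ} {x : ZFSet.{u}} (h : ∀ i < n, v i = w i) :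
    ∀ i < n, Function.update v k x i = Function.update w k x i := by
  intro i hi
  by_cases e : i = k
  · subst e; simp
  · simp [e, h i hi]

theorem Sch.sep (h : Sch m P E) (hm : m.IsTransitive) (φ : Fml) (v : ℕ → ZFSet.{u}) (hv : ∀ n, v n ∈ m) :
    ∀ a ∈ m, ∃ b ∈ m, ∀ x, x ∈ b ↔ x ∈ a ∧ Sat m.toSet φ (Function.update v 0 x) := by
  intro a ha
  obtain ⟨S, hS, e⟩ := h.sat φ
  obtain ⟨n, hn⟩ := sat_fin m.toSet φ
  obtain ⟨s, hs, es⟩ := h.asg v hv n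
  obtain ⟨h1, h2, h3, -, -, -, -, -, h9, -⟩ := h
  obtain ⟨b, hb, hx⟩ := h9 S hS s hs a ha
  refine ⟨b, hb, fun x => ?_⟩
  by_cases hxm : x ∈ m
  · rw [hx x hxm]
    refine and_congr Iff.rfl ?_
    rw [← hn (Function.update (MPaper.asg s) 0 x) _ (upd_agree es)]
    constructor
    · rintro ⟨s', hs', h1, h2, h3⟩
      rw [← ag_upd (n := 0) |>.1 ⟨h1, h2⟩, ← e s' hs']
      exact h3
    · intro h
      obtain ⟨s', hs', ha⟩ := h3 s hs _ (nn_omega 0) x hxm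
      refine ⟨s', hs', ha.1, ha.2, ?_⟩
      rw [e s' hs', ag_upd.1 ha]
      exact h
  · exact ⟨fun h => absurd (hm b hb h) hxm, fun h => absurd (hm a ha h.1) hxm⟩

theorem Sch.coll (h : Sch m P E) (hm : m.IsTransitive) (φ : Fml) (v : ℕ → ZFSet.{u}) (hv : ∀ n, v n ∈ m) :
    ∀ a ∈ m, (∀ x ∈ a, ∃ y ∈ m, Sat m.toSet φ (Function.update (Function.update v 0 x) 1 y)) →
    ∃ b ∈ m, ∀ x ∈ a, ∃ y ∈ b, Sat m.toSet φ (Function.update (Function.update v 0 x) 1 y) := by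
  intro a ha
  obtain ⟨S, hS, e⟩ := h.sat φ
  obtain ⟨n, hn⟩ := sat_fin m.toSet φ
  obtain ⟨s, hs, es⟩ := h.asg v hv n
  obtain ⟨h1, h2, h3, -, -, -, -, -, -, h10⟩ := h
  have key : ∀ x ∈ m, ∀ y ∈ m, ((∃ s' ∈ P, ∃ s'' ∈ P, (fapp s' ∅ = x ∧ Ag s s' ∅) ∧
      (fapp s'' (nn 1) = y ∧ Ag s' s'' (nn 1)) ∧ s'' ∈ S) ↔
      Sat m.toSet φ (Function.update (Function.update v 0 x) 1 y)) := by
    intro x hx y hy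
    rw [← hn (Function.update (Function.update (MPaper.asg s) 0 x) 1 y) _ (upd_agree (upd_agree es))]
    constructor
    · rintro ⟨s', hs', s'', hs'', h1, h2, h3⟩
      rw [← ag_upd (n := 0) |>.1 h1, ← ag_upd.1 h2, ← e s'' hs'']
      exact h3
    · intro h
      obtain ⟨s', hs', ha⟩ := h3 s hs _ (nn_omega 0) x hx
      obtain ⟨s'', hs'', ha'⟩ := h3 s' hs' _ (nn_omega 1) y hy
      refine ⟨s', hs', s'', hs'', ha, ha', ?_⟩
      rw [e s'' hs'', ag_upd.1 ha', ag_upd.1 ha]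
      exact h
  intro hex
  obtain ⟨b, hb, hx⟩ := h10 S hS s hs a ha (fun x hx => by
    obtain ⟨y, hy, hs⟩ := hex x hx
    exact ⟨y, hy, (key x (hm a ha hx) y hy).2 hs⟩)
  refine ⟨b, hb, fun x hxa => ?_⟩
  obtain ⟨y, hy, hs⟩ := hx x hxa
  exact ⟨y, hy, (key x (hm a ha hxa) y (hm b hb hy)).1 hs⟩

end

/-! ### existence of `P`, `E` -/

def fenc : Fml → ℕ
  | .mem i j => Nat.pair 0 (Nat.pair i j)
  | .eq i j => Nat.pair 1 (Nat.pair i j)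
  | .impl φ ψ => Nat.pair 2 (Nat.pair (fenc φ) (fenc ψ))
  | .neg φ => Nat.pair 3 (fenc φ)
  | .all n φ => Nat.pair 4 (Nat.pair n (fenc φ))

theorem fenc_inj : ∀ φ ψ : Fml, fenc φ = fenc ψ → φ = ψ := by
  intro φ
  induction φ with
  | mem i j => intro ψ h; cases ψ <;> simp_all [fenc, Nat.pair_eq_pair]
  | eq i j => intro ψ h; cases ψ <;> simp_all [fenc, Nat.pair_eq_pair]
  | impl a b h1 h2 =>
    intro ψ h
    cases ψ with
    | impl c d =>
      simp only [fenc, Nat.pair_eq_pair] at h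
      rw [h1 _ h.2.1, h2 _ h.2.2]
    | _ => simp [fenc, Nat.pair_eq_pair] at h
  | neg a h1 =>
    intro ψ h
    cases ψ with
    | neg c =>
      simp only [fenc, Nat.pair_eq_pair] at h
      rw [h1 _ h.2]
    | _ => simp [fenc, Nat.pair_eq_pair] at h
  | all n a h1 =>
    intro ψ h
    cases ψ with
    | all k c =>
      simp only [fenc, Nat.pair_eq_pair] at h
      rw [h.2.1, h1 _ h.2.2]
    | _ => simp [fenc, Nat.pair_eq_pair] at h

/-- eventually empty functions from `ω` to `m` -/
def evP (m : ZFSet.{u}) : ZFSet.{u} :=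
  ZFSet.sep (fun s => IsZFunc ZFSet.omega s ∧ ∃ n : ℕ, ∀ i, n ≤ i → fapp s (nn i) = ∅)
    (ZFSet.powerset (ZFSet.omega.prod m))

theorem mem_evP {m s : ZFSet.{u}} : s ∈ evP m ↔ IsZFunc ZFSet.omega s ∧
    (∀ n ∈ ZFSet.omega, fapp s n ∈ m) ∧ ∃ n : ℕ, ∀ i, n ≤ i → fapp s (nn i) = ∅ := by
  unfold evP
  rw [ZFSet.mem_sep, ZFSet.mem_powerset]
  constructor
  · rintro ⟨h, h1, h2⟩
    exact ⟨h1, fun n hn => (ZFSet.pair_mem_prod.1 (h (h1.pair_mem hn))).2, h2⟩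
  · rintro ⟨h1, h2, h3⟩
    refine ⟨?_, h1, h3⟩
    rw [h1.eq_lam]
    intro p hp
    obtain ⟨x, hx, rfl⟩ := mem_lam.1 hp
    exact ZFSet.pair_mem_prod.2 ⟨hx, h2 x hx⟩

theorem evP_H {κ m : ZFSet.{u}} (ic : IC κ) (hm : m ∈ Hclass κ) : evP m ∈ Hclass κ := by
  rw [mem_H]
  constructor
  · have hall : ∀ s : (evP m).toSet, _ := fun s => mem_evP.1 s.2
    choose h1 h2 N h3 using hall
    have : zcard (evP m) ≤ Cardinal.mk (List m.toSet) := by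
      refine Cardinal.mk_le_of_injective (f := fun s : (evP m).toSet =>
        List.ofFn (fun i : Fin (N s) => (⟨fapp s.1 (nn i), h2 s _ (nn_omega i)⟩ : m.toSet))) ?_
      intro s t e
      have hl : N s = N t := by simpa using congrArg List.length e
      refine Subtype.ext ((h1 s).ext (h1 t) (fun a ha => ?_))
      obtain ⟨i, rfl⟩ := mem_omega.1 ha
      by_cases hi : i < N s
      · have e2 := congrArg (fun l : List m.toSet => l[i]?) e
        simp [List.getElem?_ofFn, hi, hl ▸ hi] at e2
        exact e2
      · rw [h3 s i (by omega), h3 t i (by omega)]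
    refine this.trans ((Cardinal.mk_list_le_max _).trans (max_le ic.2 (mem_H.1 hm).1))
  · intro s hs
    obtain ⟨h1, h2, -⟩ := mem_evP.1 hs
    rw [h1.eq_lam]
    have hω : ZFSet.omega ∈ Hclass κ := by
      refine H_of_trans omega_ord.isTransitive (le_trans ?_ ic.2)
      refine Cardinal.mk_le_aleph0_iff.2 ?_
      refine Set.Countable.mono (s₂ := Set.range nn) ?_ (Set.countable_range _)
      intro x hx; exact mem_omega.1 hx
    exact H_lam ic hω (fun n hn => (mem_H.1 hm).2 _ (h2 n hn))

def famE (m : ZFSet.{u}) : ZFSet.{u} :=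
  img ZFSet.omega (fun k => ZFSet.sep (fun s => ∃ φ : Fml, nn (fenc φ) = k ∧
    Sat m.toSet φ (asg s)) (evP m))

def setS (m : ZFSet.{u}) (φ : Fml) : ZFSet.{u} := ZFSet.sep (fun s => Sat m.toSet φ (asg s)) (evP m)

theorem famE_spec {m : ZFSet.{u}} {φ : Fml} : setS m φ ∈ famE m := by
  refine mem_img.2 ⟨nn (fenc φ), nn_omega _, ?_⟩
  unfold setS
  refine sep_congr (fun s _ => ?_)
  constructor
  · rintro ⟨ψ, e, h⟩
    rwa [fenc_inj _ _ (nn_inj e)] at h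
  · intro h; exact ⟨φ, rfl, h⟩

end

section

theorem mem_setS {m s : ZFSet.{u}} {φ : Fml} (hs : s ∈ evP m) : s ∈ setS m φ ↔ Sat m.toSet φ (asg s) := by
  unfold setS
  rw [ZFSet.mem_sep]
  exact ⟨fun h => h.2, fun h => ⟨hs, h⟩⟩

theorem evP_upd {m s x : ZFSet.{u}} (hs : s ∈ evP m) (hx : x ∈ m) (n : ℕ) :
    ∃ s' ∈ evP m, asg s' = Function.update (asg s) n x := by
  obtain ⟨h1, h2, k, hk⟩ := mem_evP.1 hs
  have e : ∀ i, fapp (lam ZFSet.omega (fun a => if a = nn n then x else fapp s a)) (nn i)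
      = if nn i = nn n then x else fapp s (nn i) := fun i => by
    rw [fapp_lam (nn_omega i)]
  refine ⟨lam ZFSet.omega (fun a => if a = nn n then x else fapp s a), mem_evP.2 ⟨isZFunc_lam _ _, ?_, ?_⟩, ?_⟩
  · intro a ha
    obtain ⟨i, rfl⟩ := mem_omega.1 ha
    rw [e]
    split_ifs
    · exact hx
    · exact h2 _ ha
  · refine ⟨max k (n + 1), fun i hi => ?_⟩
    rw [e, if_neg, hk i (by omega)]
    intro h
    have := nn_inj h
    omega
  · funext i
    show fapp _ (nn i) = _
    rw [e]
    by_cases h : i = n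
    · subst h; simp
    · rw [Function.update_of_ne h, if_neg (fun h' => h (nn_inj h'))]; rfl

theorem asg_mem {m s : ZFSet.{u}} (hs : s ∈ evP m) (n : ℕ) : asg s n ∈ m :=
  (mem_evP.1 hs).2.1 _ (nn_omega n)

theorem famE_ex {m S : ZFSet.{u}} (h : S ∈ famE m) : ∃ φ, S = setS m φ := by
  obtain ⟨k, hk, rfl⟩ := mem_img.1 h
  by_cases hc : ∃ φ : Fml, nn (fenc φ) = k
  · obtain ⟨φ, rfl⟩ := hc
    refine ⟨φ, ?_⟩
    unfold setS
    ext s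
    simp only [ZFSet.mem_sep]
    refine and_congr_right fun _ => ?_
    constructor
    · rintro ⟨ψ, e, h⟩
      rw [← fenc_inj _ _ (nn_inj e)]; exact h
    · exact fun h => ⟨φ, rfl, h⟩
  · refine ⟨.neg (.eq 0 0), ?_⟩
    unfold setS
    ext s
    simp only [ZFSet.mem_sep]
    refine and_congr_right fun _ => ?_
    constructor
    · rintro ⟨ψ, e, h⟩
      exact absurd ⟨ψ, e⟩ hc
    · intro h
      exact absurd rfl h

theorem exUpd {m s x : ZFSet.{u}} {φ : Fml} (hs : s ∈ evP m) (hx : x ∈ m) (n : ℕ) :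
    (∃ s' ∈ evP m, (fapp s' (nn n) = x ∧ Ag s s' (nn n)) ∧ s' ∈ setS m φ) ↔
      Sat m.toSet φ (Function.update (asg s) n x) := by
  constructor
  · rintro ⟨s', h1, h2, h3⟩
    rw [← ag_upd.1 h2]; exact (mem_setS h1).1 h3
  · intro h
    obtain ⟨s', h1, h2⟩ := evP_upd hs hx n
    refine ⟨s', h1, ag_upd.2 h2, (mem_setS h1).2 ?_⟩
    rw [h2]; exact h

theorem ag_upd0 {s s' x : ZFSet.{u}} :
    (fapp s' ∅ = x ∧ Ag s s' ∅) ↔ asg s' = Function.update (asg s) 0 x := by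
  have := ag_upd (s := s) (s' := s') (x := x) (n := 0)
  rwa [show nn 0 = ∅ from rfl] at this

theorem exUpd2 {m s x y : ZFSet.{u}} {φ : Fml} (hs : s ∈ evP m) (hx : x ∈ m) (hy : y ∈ m) :
    (∃ s' ∈ evP m, ∃ s'' ∈ evP m, (fapp s' ∅ = x ∧ Ag s s' ∅) ∧
      (fapp s'' (nn 1) = y ∧ Ag s' s'' (nn 1)) ∧ s'' ∈ setS m φ) ↔
      Sat m.toSet φ (Function.update (Function.update (asg s) 0 x) 1 y) := by
  constructor
  · rintro ⟨s', h1, s'', h4, h2, h5, h3⟩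
    have e1 := ag_upd0.1 h2
    have e2 := ag_upd.1 h5
    rw [← e1, ← e2]; exact (mem_setS h4).1 h3
  · intro h
    obtain ⟨s', h1, h2⟩ := evP_upd hs hx 0
    obtain ⟨s'', h3, h4⟩ := evP_upd h1 hy 1
    refine ⟨s', h1, s'', h3, ag_upd0.2 h2, ag_upd.2 h4, (mem_setS h3).2 ?_⟩
    rw [h4, h2]; exact h

theorem Sch_ex {m : ZFSet.{u}} (hm : IsTransModel m) : Sch m (evP m) (famE m) := by
  refine ⟨?_, ?_, ?_, ?_, ?_, ?_, ?_, ?_, ?_, ?_⟩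
  · refine ⟨lam ZFSet.omega (fun _ => ∅), mem_evP.2 ⟨isZFunc_lam _ _, ?_, 0, ?_⟩, rfl⟩
    · intro n hn; rw [fapp_lam hn]; exact hm.empty
    · intro i _; rw [fapp_lam (nn_omega i)]
  · intro s hs n hn
    exact (mem_evP.1 hs).2.1 n hn
  · intro s hs n hn x hx
    obtain ⟨i, rfl⟩ := mem_omega.1 hn
    obtain ⟨s', h1, h2⟩ := evP_upd hs hx i
    exact ⟨s', h1, ag_upd.2 h2⟩
  · intro i hi j hj
    obtain ⟨i, rfl⟩ := mem_omega.1 hi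
    obtain ⟨j, rfl⟩ := mem_omega.1 hj
    exact ⟨_, famE_spec (φ := .mem i j), fun s hs => mem_setS hs⟩
  · intro i hi j hj
    obtain ⟨i, rfl⟩ := mem_omega.1 hi
    obtain ⟨j, rfl⟩ := mem_omega.1 hj
    exact ⟨_, famE_spec (φ := .eq i j), fun s hs => mem_setS hs⟩
  · intro S hS
    obtain ⟨φ, rfl⟩ := famE_ex hS
    exact ⟨_, famE_spec (φ := .neg φ), fun s hs => by rw [mem_setS hs, mem_setS hs]; rfl⟩
  · intro S hS S' hS'
    obtain ⟨φ, rfl⟩ := famE_ex hS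
    obtain ⟨ψ, rfl⟩ := famE_ex hS'
    exact ⟨_, famE_spec (φ := .impl φ ψ), fun s hs => by
      rw [mem_setS hs, mem_setS hs, mem_setS hs]; rfl⟩
  · intro S hS n hn
    obtain ⟨φ, rfl⟩ := famE_ex hS
    obtain ⟨n, rfl⟩ := mem_omega.1 hn
    refine ⟨_, famE_spec (φ := .all n φ), fun s hs => ?_⟩
    rw [mem_setS hs]
    constructor
    · intro h s' hs' ha
      rw [mem_setS hs', ag_upd.1 ⟨rfl, ha⟩]
      exact h _ (asg_mem hs' n)
    · intro h x hx
      obtain ⟨s', h1, h2⟩ := evP_upd hs hx n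
      have := (mem_setS h1).1 (h s' h1 (ag_upd.2 h2).2)
      rwa [h2] at this
  · intro S hS s hs a ha
    obtain ⟨φ, rfl⟩ := famE_ex hS
    obtain ⟨b, hb, h⟩ := hm.2.2.2.2.1 φ (asg s) (asg_mem hs) a ha
    refine ⟨b, hb, fun x hx => ?_⟩
    have e := exUpd (φ := φ) hs hx 0
    rw [show nn 0 = ∅ from rfl] at e
    rw [h, ← e]
    simp only [and_assoc]
  · intro S hS s hs a ha h
    obtain ⟨φ, rfl⟩ := famE_ex hS
    have ht := hm.1
    obtain ⟨b, hb, h'⟩ := hm.2.2.2.2.2.1 φ (asg s) (asg_mem hs) a ha (fun x hx => by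
      obtain ⟨y, hy, h'⟩ := h x hx
      exact ⟨y, hy, (exUpd2 hs (ht _ ha hx) hy).1 h'⟩)
    refine ⟨b, hb, fun x hx => ?_⟩
    obtain ⟨y, hy, h''⟩ := h' x hx
    exact ⟨y, hy, (exUpd2 hs (ht _ ha hx) (ht _ hb hy)).2 h''⟩

theorem H_omega {κ : ZFSet.{u}} (ic : IC κ) : ZFSet.omega ∈ Hclass κ := by
  refine H_of_trans omega_ord.isTransitive (le_trans ?_ ic.2)
  refine Cardinal.mk_le_aleph0_iff.2 ?_
  refine Set.Countable.mono (s₂ := Set.range nn) ?_ (Set.countable_range _)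
  intro x hx; exact mem_omega.1 hx

theorem famE_H {κ m : ZFSet.{u}} (ic : IC κ) (hm : m ∈ Hclass κ) : famE m ∈ Hclass κ :=
  H_img (mem_H.1 (H_omega ic)).1 (fun x _ => H_sub (evP_H ic hm) (fun _ h => (ZFSet.mem_sep.1 h).1))

end

section

/-! ### Relativized good pairs -/

def RWO (D : Set ZFSet.{u}) (x r : ZFSet.{u}) : Prop :=
  (∀ p ∈ r, ∃ a ∈ x, ∃ b ∈ x, p = ZFSet.pair a b) ∧
  (∀ a ∈ x, ∀ b ∈ x, a = b ∨ ZFSet.pair a b ∈ r ∨ ZFSet.pair b a ∈ r) ∧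
  (∀ a ∈ x, ∀ b ∈ x, ∀ c ∈ x,
    ZFSet.pair a b ∈ r → ZFSet.pair b c ∈ r → ZFSet.pair a c ∈ r) ∧
  (∀ a ∈ x, ¬ (ZFSet.pair a a ∈ r)) ∧
  (∀ S ∈ D, S ⊆ x → (∃ a ∈ S, a = a) → ∃ a ∈ S, ∀ b ∈ S, ¬ (ZFSet.pair b a ∈ r))

theorem df_RWO {𝒟 : Set (Set ZFSet.{u})} (i j : ℕ) : Df 𝒟 (fun D v => RWO D (v i) (v j)) := by
  unfold RWO
  (repeat' first | assumption | apply Df.isZFunc | exact df_Sch (by assumption) (by assumption) _ _ _ | apply df_oiD | exact DT.constM (by assumption) | exact DT.var _ | exact DT.empty | apply DT.fapp | apply DT.union | apply DT.inter | apply DT.sUnion | apply DT.tail | apply DT.compl | apply DT.sep | apply DT.constM | apply Df.pair_mem | apply Df.eq_pair | apply Df.eq_upair | apply Df.mem | apply Df.eq | apply Df.subset | apply Df.and | apply Df.or | apply Df.iff | apply Df.not | apply Df.imp | apply Df.allM | apply Df.exM | apply Df.ball | apply Df.bex | apply Df.all | apply Df.ex | exact Df.prop _)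

theorem rwo_iff {κ x r : ZFSet.{u}} (hx : x ∈ Hclass κ) :
    RWO (Hclass κ) x r ↔ IsWellOrderOn x r := by
  unfold RWO IsWellOrderOn
  refine and_congr_right fun _ => and_congr_right fun _ => and_congr_right fun _ =>
    and_congr_right fun _ => ?_
  constructor
  · intro h S hS hne
    obtain ⟨a, ha, h'⟩ := h (ZFSet.sep (fun y => y ∈ S) x) (H_sub hx (fun _ h => (ZFSet.mem_sep.1 h).1))
      (fun _ h => (ZFSet.mem_sep.1 h).1) (by
        obtain ⟨a, ha⟩ := hne
        exact ⟨a, ZFSet.mem_sep.2 ⟨hS ha, ha⟩, rfl⟩)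
    exact ⟨a, (ZFSet.mem_sep.1 ha).2, fun b hb => h' b (ZFSet.mem_sep.2 ⟨hS hb, hb⟩)⟩
  · intro h S _ hS hne
    obtain ⟨a, ha, h'⟩ := h S.toSet (fun y hy => hS hy) (by obtain ⟨a, ha, _⟩ := hne; exact ⟨a, ha⟩)
    exact ⟨a, ha, fun b hb => h' b hb⟩

def RTM (D : Set ZFSet.{u}) (m : ZFSet.{u}) : Prop :=
  (∀ x ∈ m, x ⊆ m) ∧ ZFSet.omega ∈ m ∧ (∀ x ∈ m, ∀ y ∈ m, ∃ z ∈ m, z = {x, y}) ∧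
  (∀ x ∈ m, (⋃₀ x : ZFSet) ∈ m) ∧ (∃ P ∈ D, ∃ E ∈ D, Sch m P E) ∧
  ∀ x ∈ m, ∃ r ∈ m, RWO D x r

theorem df_RTM {𝒟 : Set (Set ZFSet.{u})} (hw : DT 𝒟 (fun _ _ => ZFSet.omega))
    (h1 : DT 𝒟 (fun _ _ => nn 1)) (i : ℕ) : Df 𝒟 (fun D v => RTM D (v i)) := by
  unfold RTM
  refine Df.and ?_ (Df.and ?_ (Df.and ?_ (Df.and ?_ (Df.and ?_ ?_))))
  · (repeat' first | assumption | apply Df.isZFunc | exact df_Sch (by assumption) (by assumption) _ _ _ | apply df_oiD | exact DT.constM (by assumption) | exact DT.var _ | exact DT.empty | apply DT.fapp | apply DT.union | apply DT.inter | apply DT.sUnion | apply DT.tail | apply DT.compl | apply DT.sep | apply DT.constM | apply Df.pair_mem | apply Df.eq_pair | apply Df.eq_upair | apply Df.mem | apply Df.eq | apply Df.subset | apply Df.and | apply Df.or | apply Df.iff | apply Df.not | apply Df.imp | apply Df.allM | apply Df.exM | apply Df.ball | apply Df.bex | apply Df.all | apply Df.ex | exact Df.prop _)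
  · (repeat' first | assumption | apply Df.isZFunc | exact df_Sch (by assumption) (by assumption) _ _ _ | apply df_oiD | exact DT.constM (by assumption) | exact DT.var _ | exact DT.empty | apply DT.fapp | apply DT.union | apply DT.inter | apply DT.sUnion | apply DT.tail | apply DT.compl | apply DT.sep | apply DT.constM | apply Df.pair_mem | apply Df.eq_pair | apply Df.eq_upair | apply Df.mem | apply Df.eq | apply Df.subset | apply Df.and | apply Df.or | apply Df.iff | apply Df.not | apply Df.imp | apply Df.allM | apply Df.exM | apply Df.ball | apply Df.bex | apply Df.all | apply Df.ex | exact Df.prop _)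
  · (repeat' first | assumption | apply Df.isZFunc | exact df_Sch (by assumption) (by assumption) _ _ _ | apply df_oiD | exact DT.constM (by assumption) | exact DT.var _ | exact DT.empty | apply DT.fapp | apply DT.union | apply DT.inter | apply DT.sUnion | apply DT.tail | apply DT.compl | apply DT.sep | apply DT.constM | apply Df.pair_mem | apply Df.eq_pair | apply Df.eq_upair | apply Df.mem | apply Df.eq | apply Df.subset | apply Df.and | apply Df.or | apply Df.iff | apply Df.not | apply Df.imp | apply Df.allM | apply Df.exM | apply Df.ball | apply Df.bex | apply Df.all | apply Df.ex | exact Df.prop _)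
  · (repeat' first | assumption | apply Df.isZFunc | exact df_Sch (by assumption) (by assumption) _ _ _ | apply df_oiD | exact DT.constM (by assumption) | exact DT.var _ | exact DT.empty | apply DT.fapp | apply DT.union | apply DT.inter | apply DT.sUnion | apply DT.tail | apply DT.compl | apply DT.sep | apply DT.constM | apply Df.pair_mem | apply Df.eq_pair | apply Df.eq_upair | apply Df.mem | apply Df.eq | apply Df.subset | apply Df.and | apply Df.or | apply Df.iff | apply Df.not | apply Df.imp | apply Df.allM | apply Df.exM | apply Df.ball | apply Df.bex | apply Df.all | apply Df.ex | exact Df.prop _)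
  · apply Df.ex
    apply Df.ex
    exact df_Sch hw h1 _ _ _
  · apply Df.ball (DT.var _)
    apply Df.bex (DT.var _)
    exact df_RWO _ _

theorem rtm_iff {κ m : ZFSet.{u}} (ic : IC κ) (hm : m ∈ Hclass κ) :
    RTM (Hclass κ) m ↔ IsTransModel m := by
  constructor
  · rintro ⟨h1, h2, h3, h4, ⟨P, _, E, _, h⟩, h5⟩
    refine ⟨fun x hx => h1 x hx, h2, fun x hx y hy => ?_, h4, fun φ v hv => h.sep (fun x hx => h1 x hx) φ v hv,
      fun φ v hv => h.coll (fun x hx => h1 x hx) φ v hv, fun x hx => ?_⟩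
    · obtain ⟨z, hz, rfl⟩ := h3 x hx y hy; exact hz
    · obtain ⟨r, hr, h⟩ := h5 x hx
      exact ⟨r, hr, (rwo_iff ((mem_H.1 hm).2 x hx)).1 h⟩
  · intro h
    refine ⟨fun x hx => h.1 x hx, h.2.1, fun x hx y hy => ⟨_, h.2.2.1 x hx y hy, rfl⟩, h.2.2.2.1,
      ⟨evP m, evP_H ic hm, famE m, famE_H ic hm, Sch_ex h⟩, fun x hx => ?_⟩
    obtain ⟨r, hr, h'⟩ := h.2.2.2.2.2.2 x hx
    exact ⟨r, hr, (rwo_iff ((mem_H.1 hm).2 x hx)).2 h'⟩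

theorem df_MUl {𝒟 : Set (Set ZFSet.{u})} {κ : ZFSet.{u}} (hk : DT 𝒟 (fun _ _ => κ)) (i j : ℕ) :
    Df 𝒟 (fun D v => IsMUltrafilter κ (v i) (v j)) := by
  unfold IsMUltrafilter
  (repeat' first | assumption | apply Df.isZFunc | exact df_Sch (by assumption) (by assumption) _ _ _ | apply df_oiD | exact DT.constM (by assumption) | exact DT.var _ | exact DT.empty | apply DT.fapp | apply DT.union | apply DT.inter | apply DT.sUnion | apply DT.tail | apply DT.compl | apply DT.sep | apply DT.constM | apply Df.pair_mem | apply Df.eq_pair | apply Df.eq_upair | apply Df.mem | apply Df.eq | apply Df.subset | apply Df.and | apply Df.or | apply Df.iff | apply Df.not | apply Df.imp | apply Df.allM | apply Df.exM | apply Df.ball | apply Df.bex | apply Df.all | apply Df.ex | exact Df.prop _)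

theorem df_WA {𝒟 : Set (Set ZFSet.{u})} {κ : ZFSet.{u}} (hk : DT 𝒟 (fun _ _ => κ)) (i j : ℕ) :
    Df 𝒟 (fun D v => WeaklyAmenable κ (v i) (v j)) := by
  unfold WeaklyAmenable
  show Df 𝒟 (fun D v => ∀ X ∈ v i, (∃ f ∈ v i, IsZFunc κ f ∧ ∀ y ∈ X, ∃ ξ ∈ κ, fapp f ξ = y) →
    X ∩ v j ∈ v i)
  (repeat' first | assumption | apply Df.isZFunc | exact df_Sch (by assumption) (by assumption) _ _ _ | apply df_oiD | exact DT.constM (by assumption) | exact DT.var _ | exact DT.empty | apply DT.fapp | apply DT.union | apply DT.inter | apply DT.sUnion | apply DT.tail | apply DT.compl | apply DT.sep | apply DT.constM | apply Df.pair_mem | apply Df.eq_pair | apply Df.eq_upair | apply Df.mem | apply Df.eq | apply Df.subset | apply Df.and | apply Df.or | apply Df.iff | apply Df.not | apply Df.imp | apply Df.allM | apply Df.exM | apply Df.ball | apply Df.bex | apply Df.all | apply Df.ex | exact Df.prop _)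

theorem df_Nice {𝒟 : Set (Set ZFSet.{u})} {κ : ZFSet.{u}} (hk : DT 𝒟 (fun _ _ => κ)) (i : ℕ) :
    Df 𝒟 (fun D v => Nice κ (v i)) := by
  unfold Nice SurjOnto MapsInto
  unfold ZFSet.IsTransitive
  (repeat' first | assumption | apply Df.isZFunc | exact df_Sch (by assumption) (by assumption) _ _ _ | apply df_oiD | exact DT.constM (by assumption) | exact DT.var _ | exact DT.empty | apply DT.fapp | apply DT.union | apply DT.inter | apply DT.sUnion | apply DT.tail | apply DT.compl | apply DT.sep | apply DT.constM | apply Df.pair_mem | apply Df.eq_pair | apply Df.eq_upair | apply Df.mem | apply Df.eq | apply Df.subset | apply Df.and | apply Df.or | apply Df.iff | apply Df.not | apply Df.imp | apply Df.allM | apply Df.exM | apply Df.ball | apply Df.bex | apply Df.all | apply Df.ex | exact Df.prop _)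

def RGP (D : Set ZFSet.{u}) (κ V m u : ZFSet.{u}) : Prop :=
  RTM D m ∧ κ ∈ m ∧ IsMUltrafilter κ m u ∧ WeaklyAmenable κ m u ∧ oiD D ZFSet.omega u ∧
  V ∈ m ∧ Nice κ m

theorem df_RGP {𝒟 : Set (Set ZFSet.{u})} {κ V : ZFSet.{u}} (hk : DT 𝒟 (fun _ _ => κ))
    (hV : DT 𝒟 (fun _ _ => V)) (hw : DT 𝒟 (fun _ _ => ZFSet.omega))
    (h1 : DT 𝒟 (fun _ _ => nn 1)) (i j : ℕ) : Df 𝒟 (fun D v => RGP D κ V (v i) (v j)) :=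
  Df.and (df_RTM hw h1 i) (Df.and (Df.mem hk (DT.var i)) (Df.and (df_MUl hk i j)
    (Df.and (df_WA hk i j) (Df.and (df_oiD hw (DT.var j)) (Df.and (Df.mem hV (DT.var i)) (df_Nice hk i))))))

theorem rgp_iff {κ m u : ZFSet.{u}} (ic : IC κ) (hm : m ∈ Hclass κ) (hu : u ∈ Hclass κ) :
    RGP (Hclass κ) κ (V_ κ.rank) m u ↔ GP κ m u := by
  constructor
  · rintro ⟨h1, h2, h3, h4, h5, h6, h7⟩
    refine { ic := ic, hM := (rtm_iff ic hm).1 h1, hκ := h2, uf := h3, wa := h4, oi := ?_, hV := h6, nice := h7 }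
    intro s hs
    let idx : ZFSet.{u} → ℕ := fun a => if h : ∃ n, nn n = a then h.choose else 0
    have hidx : ∀ n, idx (nn n) = n := fun n => by
      have h : ∃ k, nn k = nn.{u} n := ⟨n, rfl⟩
      show (if h : ∃ k, nn k = nn.{u} n then h.choose else 0) = n
      rw [dif_pos h]
      exact nn_inj h.choose_spec
    obtain ⟨x, _, hx⟩ := h5 (lam ZFSet.omega (fun a => s (idx a)))
      (H_lam ic (H_omega ic) (fun a _ => (mem_H.1 hu).2 _ (hs _))) (isZFunc_lam _ _)
      (fun n hn => by rw [fapp_lam hn]; exact hs _)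
    refine ⟨x, fun n => ?_⟩
    have := hx _ (nn_omega n)
    rw [fapp_lam (nn_omega n)] at this
    beta_reduce at this
    rwa [hidx] at this
  · intro g
    refine ⟨(rtm_iff ic hm).2 g.hM, g.hκ, g.uf, g.wa, ?_, g.hV, g.nice⟩
    intro f hf _ h
    obtain ⟨x, hx⟩ := g.oi (fun n => fapp f (nn n)) (fun n => h _ (nn_omega n))
    have hx0 := hx 0
    refine ⟨x, (mem_H.1 ((mem_H.1 hu).2 _ (h _ (nn_omega 0)))).2 x hx0, fun n hn => ?_⟩
    obtain ⟨k, rfl⟩ := mem_omega.1 hn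
    exact hx k

end

section

/-! ### Certificates -/

def Cert (D : Set ZFSet.{u}) (κ V C : ZFSet.{u}) : Prop :=
  ∀ p ∈ C, ∃ y ∈ D, ∃ m ∈ D, ∃ u ∈ D, ∃ q ∈ D, (p = ZFSet.pair y q ∧ q = ZFSet.pair m u) ∧
    RGP D κ V m u ∧ ∀ y' ∈ y, ∀ A ∈ m, A ⊆ κ → ∃ m' ∈ m, ∃ u' ∈ m, A ∈ m' ∧
      ∃ q' ∈ D, q' = ZFSet.pair m' u' ∧ ZFSet.pair y' q' ∈ C

def CEx (D : Set ZFSet.{u}) (κ V y x : ZFSet.{u}) : Prop :=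
  ∃ C ∈ D, Cert D κ V C ∧ ∃ m ∈ D, ∃ u ∈ D, ∃ q ∈ D, q = ZFSet.pair m u ∧ x ∈ m ∧
    ZFSet.pair y q ∈ C

section
variable {𝒟 : Set (Set ZFSet.{u})} {κ V : ZFSet.{u}}

theorem df_Cert (hk : DT 𝒟 (fun _ _ => κ))
    (hV : DT 𝒟 (fun _ _ => V)) (hw : DT 𝒟 (fun _ _ => ZFSet.omega))
    (h1 : DT 𝒟 (fun _ _ => nn 1)) (i : ℕ) : Df 𝒟 (fun D v => Cert D κ V (v i)) := by
  unfold Cert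
  apply Df.ball (DT.var _)
  apply Df.ex
  apply Df.ex
  apply Df.ex
  apply Df.ex
  refine Df.and ?_ (Df.and (df_RGP hk hV hw h1 _ _) ?_)
  · (repeat' first | assumption | apply Df.isZFunc | exact df_Sch (by assumption) (by assumption) _ _ _ | apply df_oiD | exact DT.constM (by assumption) | exact DT.var _ | exact DT.empty | apply DT.fapp | apply DT.union | apply DT.inter | apply DT.sUnion | apply DT.tail | apply DT.compl | apply DT.sep | apply DT.constM | apply Df.pair_mem | apply Df.eq_pair | apply Df.eq_upair | apply Df.mem | apply Df.eq | apply Df.subset | apply Df.and | apply Df.or | apply Df.iff | apply Df.not | apply Df.imp | apply Df.allM | apply Df.exM | apply Df.ball | apply Df.bex | apply Df.all | apply Df.ex | exact Df.prop _)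
  · (repeat' first | assumption | apply Df.isZFunc | exact df_Sch (by assumption) (by assumption) _ _ _ | apply df_oiD | exact DT.constM (by assumption) | exact DT.var _ | exact DT.empty | apply DT.fapp | apply DT.union | apply DT.inter | apply DT.sUnion | apply DT.tail | apply DT.compl | apply DT.sep | apply DT.constM | apply Df.pair_mem | apply Df.eq_pair | apply Df.eq_upair | apply Df.mem | apply Df.eq | apply Df.subset | apply Df.and | apply Df.or | apply Df.iff | apply Df.not | apply Df.imp | apply Df.allM | apply Df.exM | apply Df.ball | apply Df.bex | apply Df.all | apply Df.ex | exact Df.prop _)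

theorem df_CEx (hk : DT 𝒟 (fun _ _ => κ))
    (hV : DT 𝒟 (fun _ _ => V)) (hw : DT 𝒟 (fun _ _ => ZFSet.omega))
    (h1 : DT 𝒟 (fun _ _ => nn 1)) (i j : ℕ) : Df 𝒟 (fun D v => CEx D κ V (v i) (v j)) := by
  unfold CEx
  apply Df.ex
  refine Df.and (df_Cert hk hV hw h1 _) ?_
  (repeat' first | assumption | apply Df.isZFunc | exact df_Sch (by assumption) (by assumption) _ _ _ | apply df_oiD | exact DT.constM (by assumption) | exact DT.var _ | exact DT.empty | apply DT.fapp | apply DT.union | apply DT.inter | apply DT.sUnion | apply DT.tail | apply DT.compl | apply DT.sep | apply DT.constM | apply Df.pair_mem | apply Df.eq_pair | apply Df.eq_upair | apply Df.mem | apply Df.eq | apply Df.subset | apply Df.and | apply Df.or | apply Df.iff | apply Df.not | apply Df.imp | apply Df.allM | apply Df.exM | apply Df.ball | apply Df.bex | apply Df.all | apply Df.ex | exact Df.prop _)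
end

theorem GE.H {κ M U : ZFSet.{u}} (g : GE κ M U) : M ∈ Hclass κ :=
  H_of_trans g.hM.1 g.card.le

theorem GE.UH {κ M U : ZFSet.{u}} (g : GE κ M U) : U ∈ Hclass κ :=
  H_sub g.H (fun _ h => g.memM h)

theorem cex {κ : ZFSet.{u}} (hκ : IsWeaklySuperRamseyCard κ) (y : ZFSet.{u}) :
    y ∈ Hclass κ → ∀ x ∈ Hclass κ, CEx (Hclass κ) κ (V_ κ.rank) y x := by
  have ic := ic_of_wsr hκ
  induction y using ZFSet.inductionOn with
  | _ y ih =>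
  intro hy x hx
  obtain ⟨M, U, g, hp⟩ := exists_GE hκ (H_pair ic hx hy)
  obtain ⟨hxM, hyM⟩ := g.hM.of_pair hp
  have hk : DT (fam κ M) (fun _ _ => κ) := dt_const g.el g.hκ
  have hV : DT (fam κ M) (fun _ _ => V_ κ.rank) := dt_const g.el g.hV
  have hw : DT (fam κ M) (fun _ _ => ZFSet.omega) := dt_const g.el g.hM.omega
  have h1 : DT (fam κ M) (fun _ _ => nn 1) := dt_const g.el (g.hM.tr g.hM.omega (nn_omega 1))
  have hMH := g.H
  have hq : ZFSet.pair M U ∈ Hclass κ := H_pair ic g.H g.UH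
  have hS : ⋃₀ (ZFSet.sep (fun C => Cert (Hclass κ) κ (V_ κ.rank) C) M) ∈ Hclass κ :=
    H_sUnion ic (H_sub hMH (fun _ h => (ZFSet.mem_sep.1 h).1))
  refine ⟨insert (ZFSet.pair y (ZFSet.pair M U))
    (⋃₀ (ZFSet.sep (fun C => Cert (Hclass κ) κ (V_ κ.rank) C) M)),
    H_insert ic (H_pair ic hy hq) hS, ?_, M, g.H, U, g.UH, _, hq, rfl, hxM,
    ZFSet.mem_insert_iff.2 (Or.inl rfl)⟩
  intro p hp
  rcases ZFSet.mem_insert_iff.1 hp with rfl | hp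
  · refine ⟨y, hy, M, g.H, U, g.UH, _, hq, ⟨rfl, rfl⟩, (rgp_iff ic g.H g.UH).2 g.toGP, ?_⟩
    intro y' hy' A hA _
    have hy'M := g.hM.tr hyM hy'
    have e := elem_fam g.hM g.el (df_CEx hk hV hw h1 0 1) (fun n => if n = 0 then y' else A)
      (fun n => by beta_reduce; split_ifs; exacts [hy'M, hA])
    simp only [if_true, one_ne_zero, if_false] at e
    obtain ⟨C, hC, hc, m, hm, u, hu, q, hq', e1, e2, e3⟩ := e.2 (ih y' hy' ((mem_H.1 hy).2 _ hy') A ((mem_H.1 hMH).2 _ hA))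
    have e' := elem_fam g.hM g.el (df_Cert hk hV hw h1 0) (fun n => C) (fun n => hC)
    refine ⟨m, hm, u, hu, e2, q, (mem_H.1 hMH).2 _ hq', e1, ?_⟩
    refine ZFSet.mem_insert_iff.2 (Or.inr (ZFSet.mem_sUnion.2 ⟨C, ZFSet.mem_sep.2 ⟨hC, e'.1 hc⟩, e3⟩))
  · obtain ⟨C, hC, hpC⟩ := ZFSet.mem_sUnion.1 hp
    obtain ⟨hC, hc⟩ := ZFSet.mem_sep.1 hC
    obtain ⟨y, hy, m, hm, u, hu, q, hq, e, hr, h⟩ := hc p hpC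
    refine ⟨y, hy, m, hm, u, hu, q, hq, e, hr, ?_⟩
    intro y' hy' A hA hs
    obtain ⟨m', h1, u', h2, h3, q', h4, h5, h6⟩ := h y' hy' A hA hs
    exact ⟨m', h1, u', h2, h3, q', h4, h5, ZFSet.mem_insert_iff.2 (Or.inr
      (ZFSet.mem_sUnion.2 ⟨C, ZFSet.mem_sep.2 ⟨hC, hc⟩, h6⟩))⟩

def RR (κ y : ZFSet.{u}) : Set ZFSet.{u} :=
  {U | ∃ C ∈ Hclass κ, Cert (Hclass κ) κ (V_ κ.rank) C ∧ ∃ m, ZFSet.pair y (ZFSet.pair m U) ∈ C}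

theorem RR_spec {κ y U : ZFSet.{u}} (ic : IC κ) (h : U ∈ RR κ y) : IsRamseyMeasure κ U ∧
    GP κ (MU κ U) U ∧ U ∈ Hclass κ ∧ ∀ y' ∈ y, ∀ A ∈ MU κ U, A ⊆ κ → ∃ u' ∈ MU κ U, u' ∈ RR κ y' ∧
      A ∈ MU κ u' := by
  have key : ∀ {C y m u}, Cert (Hclass κ) κ (V_ κ.rank) C → ZFSet.pair y (ZFSet.pair m u) ∈ C →
      GP κ m u ∧ IsRamseyMeasure κ u ∧ MU κ u = m ∧ u ∈ Hclass κ ∧ ∀ y' ∈ y, ∀ A ∈ m, A ⊆ κ →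
      ∃ m' ∈ m, ∃ u' ∈ m, A ∈ m' ∧ ZFSet.pair y' (ZFSet.pair m' u') ∈ C := by
    intro C y m u hc hp
    obtain ⟨y1, hy, m1, hm, u1, hu, q, hq, ⟨e, e'⟩, hr, h⟩ := hc _ hp
    subst e'
    obtain ⟨e1, e2⟩ := ZFSet.pair_inj.1 e
    obtain ⟨e3, e4⟩ := ZFSet.pair_inj.1 e2
    subst e1 e3 e4
    have g := (rgp_iff ic hm hu).1 hr
    obtain ⟨h1, h2⟩ := g.ramsey (mem_H.1 hm).1
    refine ⟨g, h1, h2, hu, ?_⟩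
    intro y' hy' A hA hs
    obtain ⟨m', h1, u', h2, h3, q', h4, rfl, h6⟩ := h y' hy' A hA hs
    exact ⟨m', h1, u', h2, h3, h6⟩
  obtain ⟨C, hC, hc, m, hp⟩ := h
  obtain ⟨g, hr, e, hu, h⟩ := key hc hp
  rw [e]
  refine ⟨hr, g, hu, ?_⟩
  intro y' hy' A hA hs
  obtain ⟨m', h1, u', h2, h3, h4⟩ := h y' hy' A hA hs
  refine ⟨u', h2, ⟨C, hC, hc, m', h4⟩, ?_⟩
  rw [(key hc h4).2.2.1]; exact h3

theorem RR_ex {κ y x : ZFSet.{u}} (hκ : IsWeaklySuperRamseyCard κ) (hy : y ∈ Hclass κ)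
    (hx : x ∈ Hclass κ) : ∃ U ∈ RR κ y, x ∈ MU κ U := by
  have ic := ic_of_wsr hκ
  obtain ⟨C, hC, hc, m, hm, u, hu, q, hq, rfl, hxm, hp⟩ := cex hκ y hy x hx
  refine ⟨u, ⟨C, hC, hc, m, hp⟩, ?_⟩
  obtain ⟨y1, hy, m1, hm, u1, hu, q, hq, ⟨e, e'⟩, hr, h⟩ := hc _ hp
  subst e'
  obtain ⟨e1, e2⟩ := ZFSet.pair_inj.1 e
  obtain ⟨e3, e4⟩ := ZFSet.pair_inj.1 e2
  subst e1 e3 e4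
  have g := (rgp_iff ic hm hu).1 hr
  rw [(g.ramsey (mem_H.1 hm).1).2]; exact hxm

theorem RR_witness {κ y : ZFSet.{u}} (hκ : IsWeaklySuperRamseyCard κ) (hy : y ∈ Hclass κ) :
    IsWitness IsRamseyMeasure κ (RR κ y) :=
  ⟨fun U hU => (RR_spec (ic_of_wsr hκ) hU).1, fun A hA =>
    RR_ex hκ hy (H_sub (H_kappa (ic_of_wsr hκ)) hA)⟩

theorem RR_order {κ y y' : ZFSet.{u}} (hκ : IsWeaklySuperRamseyCard κ) (hy : y ∈ Hclass κ)
    (hy' : y' ∈ y) : MOrder IsRamseyMeasure RamseyMeasureIn κ (RR κ y') (RR κ y) := by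
  have ic := ic_of_wsr hκ
  refine ⟨RR_witness hκ ((mem_H.1 hy).2 _ hy'), RR_witness hκ hy, ?_, ?_⟩
  · intro W hW A hA hs
    obtain ⟨hr, g, -, h⟩ := RR_spec ic hW
    obtain ⟨π, L⟩ := ramsey_los ic hr
    obtain ⟨u, hu, hu', hA'⟩ := h y' hy' A (L.sub_M g.toGU hA hs) hs
    have hr' := (RR_spec ic hu').1
    have hN := L.M_sub g.toGU g.nice hu
    exact ⟨u, hu', hN, hA', hN, hr'.1, hr'.2.1, oi_in hr'.2.2⟩
  · intro U hU
    obtain ⟨W, hW, hm⟩ := RR_ex hκ hy (RR_spec ic hU).2.2.1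
    obtain ⟨hr, g, -, h⟩ := RR_spec ic hW
    obtain ⟨π, L⟩ := ramsey_los ic hr
    exact ⟨W, hW, L.M_sub g.toGU g.nice hm⟩

theorem RR_rank {κ : ZFSet.{u}} (hκ : IsWeaklySuperRamseyCard κ) (y : ZFSet.{u}) : y ∈ Hclass κ →
    Ordinal.lift.{u+1} y.rank ≤ relRank (MOrder IsRamseyMeasure RamseyMeasureIn κ) (RR κ y) := by
  have ic := ic_of_wsr hκ
  induction y using ZFSet.inductionOn with
  | _ y ih =>
  intro hy
  refine le_of_forall_lt fun a ha => ?_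
  obtain ⟨b, rfl⟩ := Ordinal.mem_range_lift_of_le ha.le
  rw [Ordinal.lift_lt, ZFSet.lt_rank_iff] at ha
  obtain ⟨y', hy', hb⟩ := ha
  have h1 := ih y' hy' ((mem_H.1 hy).2 _ hy')
  refine lt_of_le_of_lt ((Ordinal.lift_le.2 hb).trans h1) ?_
  rw [relRank_eq ic, relRank_eq ic]
  exact Acc.rank_lt_of_rel _ (RR_order hκ hy hy')

theorem final {κ : ZFSet.{u}} (hκ : IsWeaklySuperRamseyCard κ) :
    oRank IsRamseyMeasure RamseyMeasureIn κ = cardSuccOrd κ := by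
  have ic := ic_of_wsr hκ
  refine oRank_eq ic fun α hα => ?_
  have hc : α.card ≤ zcard κ := by
    unfold cardSuccOrd at hα
    exact Order.lt_succ_iff.1 (Cardinal.lt_ord.1 hα)
  obtain ⟨β, rfl⟩ : ∃ β : Ordinal.{u}, Ordinal.lift.{u+1} β = α := by
    rw [zcard_eq] at hc
    exact Ordinal.mem_range_lift_of_card_le hc
  have hy : β.toZFSet ∈ Hclass κ := by
    refine H_of_trans (ZFSet.isOrdinal_toZFSet β).isTransitive ?_
    rw [zcard_eq, Ordinal.card_toZFSet]
    rwa [← Ordinal.lift_card] at hc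
  refine ⟨RR κ β.toZFSet, RR_witness hκ hy, ?_⟩
  have := RR_rank hκ _ hy
  rwa [Ordinal.rank_toZFSet] at this

end

/-- If `κ` is a weakly super Ramsey cardinal, then `κ` has the maximum
Ramsey M-rank `o_Ram(κ) = κ⁺`. -/
theorem weaklySuperRamsey_max_ramsey_rank (κ : ZFSet) (hκ : IsWeaklySuperRamseyCard κ) :
    oRank IsRamseyMeasure RamseyMeasureIn κ = cardSuccOrd κ := by
  exact final hκ


end MPaper
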